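/- Let n ≥ 4. The outer automorphism group Out(B_n) = Aut(B_n)/Inn(B_n) of the braid group B_n is cyclic of order 2, generated by the class of the inversion automorphism χ. Equivalently: every automorphism of B_n is of the form g ↦ c·χ^e(g)·c^{−1} for some c ∈ B_n and e ∈ {0,1}, and χ is not an inner automorphism. -/

import Mathlib

/-- Relators for the braid group with generators `σ_0, …, σ_{m-1}`:
the braid relations `σ_i σ_j σ_i = σ_j σ_i σ_j` for `j = i+1`, and the
commutation relations `σ_i σ_j = σ_j σ_i` for `j ≥ i+2`. -/
def braidRels (m : ℕ) : Set (FreeGroup (Fin m)) :=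
  { r | ∃ i j : Fin m,
      ((i : ℕ) + 1 = (j : ℕ) ∧
        r = FreeGroup.of i * FreeGroup.of j * FreeGroup.of i *
            (FreeGroup.of j * FreeGroup.of i * FreeGroup.of j)⁻¹) ∨
      ((i : ℕ) + 2 ≤ (j : ℕ) ∧
        r = FreeGroup.of i * FreeGroup.of j * (FreeGroup.of j * FreeGroup.of i)⁻¹) }

/-- The braid group on `n` strands: the presented group with generators
`σ_1, …, σ_{n-1}` (indexed by `Fin (n-1)`) and the braid relators. -/
abbrev BraidGroup (n : ℕ) : Type := PresentedGroup (braidRels (n - 1))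

/-- The standard generator `σ_{i+1}` of the braid group (0-indexed). -/
def braidσ (n : ℕ) (i : Fin (n - 1)) : BraidGroup n := PresentedGroup.of i

/-- The element `δ = σ_1 σ_2 ⋯ σ_{n-1}` of the braid group. -/
def braidδ (n : ℕ) : BraidGroup n := (List.ofFn (braidσ n)).prod

/-- The full twist `z = (σ_1 σ_2 ⋯ σ_{n-1})^n`. -/
def fullTwist (n : ℕ) : BraidGroup n := braidδ n ^ n

namespace BraidOut

open FreeGroup (of lift)

theorem exists_zpow_of_commute {α : Type*} {u v : FreeGroup α} (h : Commute u v) :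
    ∃ (d : FreeGroup α) (i j : ℤ), u = d ^ i ∧ v = d ^ j := by
  classical
  let H := Subgroup.closure ({u, v} : Set (FreeGroup α))
  have hc : ∀ x ∈ H, ∀ y ∈ H, x * y = y * x := by
    have hH : H ≤ Subgroup.centralizer (H : Set (FreeGroup α)) := by
      rw [Subgroup.closure_le]
      intro x hx
      rw [SetLike.mem_coe, Subgroup.mem_centralizer_iff]
      intro y hy
      suffices H ≤ Subgroup.centralizer {x} by
        have := this hy
        rw [Subgroup.mem_centralizer_iff] at this
        exact (this x rfl).symm
      rw [Subgroup.closure_le]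
      intro z hz
      rw [SetLike.mem_coe, Subgroup.mem_centralizer_iff]
      rintro _ rfl
      rcases hx with rfl | rfl <;> rcases hz with rfl | rfl
      · rfl
      · exact h.eq
      · exact h.eq.symm
      · rfl
    intro x hx y hy
    exact Subgroup.mem_centralizer_iff.1 (hH hy) x hx
  let e := IsFreeGroup.toFreeGroup H
  have hsub : Subsingleton (IsFreeGroup.Generators H) := by
    refine ⟨fun a b => ?_⟩
    by_contra hab
    have h1 : (e.symm (of a)) * e.symm (of b) = e.symm (of b) * e.symm (of a) :=
      Subtype.ext (hc _ (e.symm (of a)).2 _ (e.symm (of b)).2)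
    have h2 : of a * of b = of b * of a := by
      apply e.symm.injective
      rw [map_mul, map_mul, h1]
    have h3 := congrArg (lift (fun x => if x = a then Equiv.swap (0 : Fin 3) 1
      else Equiv.swap (1 : Fin 3) 2)) h2
    simp only [map_mul, FreeGroup.lift_apply_of, if_pos, if_neg (Ne.symm hab)] at h3
    exact absurd h3 (by decide)
  have key : ∃ d : H, ∀ x : H, ∃ k : ℤ, x = d ^ k := by
    rcases isEmpty_or_nonempty (IsFreeGroup.Generators H) with hE | ⟨⟨a⟩⟩
    · refine ⟨1, fun x => ⟨0, ?_⟩⟩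
      apply e.injective
      exact Subsingleton.elim _ _
    · refine ⟨e.symm (of a), fun x => ?_⟩
      have : ∀ f : FreeGroup (IsFreeGroup.Generators H), ∃ k : ℤ, f = of a ^ k := by
        intro f
        induction f using FreeGroup.induction_on with
        | C1 => exact ⟨0, by simp⟩
        | of b => exact ⟨1, by rw [Subsingleton.elim a b, zpow_one]⟩
        | inv_of b _ => exact ⟨-1, by rw [Subsingleton.elim a b, zpow_neg, zpow_one]⟩
        | mul x y hx hy =>
          obtain ⟨k, rfl⟩ := hx
          obtain ⟨l, rfl⟩ := hy
          exact ⟨k + l, by rw [zpow_add]⟩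
      obtain ⟨k, hk⟩ := this (e x)
      refine ⟨k, e.injective ?_⟩
      rw [hk, map_zpow, MulEquiv.apply_symm_apply]
  obtain ⟨d, hd⟩ := key
  obtain ⟨i, hi⟩ := hd ⟨u, Subgroup.subset_closure (by simp)⟩
  obtain ⟨j, hj⟩ := hd ⟨v, Subgroup.subset_closure (by simp)⟩
  exact ⟨d, i, j, congrArg Subtype.val hi, congrArg Subtype.val hj⟩

theorem exists_eq_zpow_of_commute {α : Type*} {u v : FreeGroup α} (h : Commute u v)
    (ψ : FreeGroup α →* Multiplicative ℤ) (hv : (ψ v).toAdd = 1) : ∃ k : ℤ, u = v ^ k := by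
  obtain ⟨d, i, j, rfl, rfl⟩ := exists_zpow_of_commute h
  rw [map_zpow, toAdd_zpow, smul_eq_mul] at hv
  rcases Int.eq_one_or_neg_one_of_mul_eq_one hv with rfl | rfl
  · exact ⟨i, by simp⟩
  · exact ⟨-i, by rw [← zpow_mul]; simp⟩

theorem eq_one_of_commute {α : Type*} {u v : FreeGroup α} (h : Commute u v)
    (ψ : FreeGroup α →* Multiplicative ℤ) (hu : (ψ u).toAdd = 0) (hv : (ψ v).toAdd ≠ 0) :
    u = 1 := by
  obtain ⟨d, i, j, rfl, rfl⟩ := exists_zpow_of_commute h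
  rw [map_zpow, toAdd_zpow, smul_eq_mul] at hu hv
  rcases mul_eq_zero.1 hu with rfl | h0
  · simp
  · simp [h0] at hv

theorem commute_of_commute_zpow {α : Type*} {w c : FreeGroup α} {j : ℤ} (hj : j ≠ 0)
    (h : Commute w (c ^ j)) : Commute w c := by
  have h1 : (w * c * w⁻¹) ^ j = c ^ j := by
    rw [conj_zpow, h.eq, mul_inv_cancel_right]
  have h2 := zpow_left_injective hj h1
  exact mul_inv_eq_iff_eq_mul.1 h2

variable {α : Type*}

theorem mem_of_mem_toWord [DecidableEq α] {S : Set α} {w : FreeGroup α}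
    (hw : w ∈ Subgroup.closure (of '' S)) :
    ∀ p ∈ w.toWord, p.1 ∈ S := by
  induction hw using Subgroup.closure_induction with
  | mem x hx =>
    obtain ⟨a, ha, rfl⟩ := hx
    simpa [FreeGroup.toWord_of] using ha
  | one => simp
  | mul x y _ _ hx hy =>
    intro p hp
    rcases List.mem_append.1 ((FreeGroup.toWord_mul_sublist x y).subset hp) with h | h
    · exact hx p h
    · exact hy p h
  | inv x _ hx =>
    intro p hp
    rw [FreeGroup.toWord_inv, FreeGroup.invRev] at hp
    simp only [List.mem_reverse, List.mem_map] at hp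
    obtain ⟨q, hq, rfl⟩ := hp
    exact hx q hq

theorem mem_closure_of_mem_toWord [DecidableEq α] {S : Set α} {w : FreeGroup α}
    (hw : ∀ p ∈ w.toWord, p.1 ∈ S) :
    w ∈ Subgroup.closure (of '' S) := by
  rw [← FreeGroup.mk_toWord (x := w)]
  generalize w.toWord = L at hw
  induction L with
  | nil => exact one_mem _
  | cons a L ih =>
    have : FreeGroup.mk (a :: L) = FreeGroup.mk [a] * FreeGroup.mk L := by simp
    rw [this]
    refine mul_mem ?_ (ih fun p hp => hw p (List.mem_cons_of_mem _ hp))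
    have ha := hw a List.mem_cons_self
    obtain ⟨x, _ | _⟩ := a
    · have : FreeGroup.mk [(x, false)] = (of x)⁻¹ := by
        simp [of, FreeGroup.inv_mk, FreeGroup.invRev]
      rw [this]
      exact inv_mem (Subgroup.subset_closure ⟨x, ha, rfl⟩)
    · exact Subgroup.subset_closure ⟨x, ha, rfl⟩

theorem isReduced_append {l₁ l₂ : List (α × Bool)} (h₁ : FreeGroup.IsReduced l₁)
    (h₂ : FreeGroup.IsReduced l₂) (h : ∀ x ∈ l₁.getLast?, ∀ y ∈ l₂.head?, x.1 ≠ y.1) :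
    FreeGroup.IsReduced (l₁ ++ l₂) := by
  unfold FreeGroup.IsReduced at *
  rw [List.isChain_append]
  exact ⟨h₁, h₂, fun x hx y hy e => absurd e (h x hx y hy)⟩

theorem toWord_mul_of_isReduced [DecidableEq α] {u v : FreeGroup α}
    (h : FreeGroup.IsReduced (u.toWord ++ v.toWord)) : (u * v).toWord = u.toWord ++ v.toWord := by
  rw [FreeGroup.toWord_mul, h.reduce_eq]

/-- The product of the syllables `b ^ e * w` listed in `L`. -/
def syllProd (b : α) (L : List (ℤ × FreeGroup α)) : FreeGroup α :=
  (L.map fun p => of b ^ p.1 * p.2).prod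

/-- The number of letters in a list of syllables. -/
def syllCost [DecidableEq α] (L : List (ℤ × FreeGroup α)) : ℕ :=
  (L.map fun p => p.1.natAbs + p.2.norm).sum

@[simp] theorem syllProd_nil (b : α) : syllProd b [] = 1 := rfl

@[simp] theorem syllProd_cons (b : α) (p : ℤ × FreeGroup α) (L : List (ℤ × FreeGroup α)) :
    syllProd b (p :: L) = of b ^ p.1 * p.2 * syllProd b L := by
  simp [syllProd]

@[simp] theorem syllProd_append (b : α) (L M : List (ℤ × FreeGroup α)) :
    syllProd b (L ++ M) = syllProd b L * syllProd b M := by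
  simp [syllProd]

/-- All powers of `b` are nontrivial, all other factors are nontrivial and avoid `b`. -/
def SyllGood (b : α) (L : List (ℤ × FreeGroup α)) : Prop :=
  ∀ p ∈ L, p.1 ≠ 0 ∧ p.2 ≠ 1 ∧ p.2 ∈ Subgroup.closure (of '' {x | x ≠ b})

theorem toWord_of_zpow [DecidableEq α] (b : α) (e : ℤ) :
    (of b ^ e).toWord = List.replicate e.natAbs (b, decide (0 ≤ e)) := by
  rcases e with n | n
  · simp [FreeGroup.toWord_of_pow]
  · rw [zpow_negSucc, FreeGroup.toWord_inv, FreeGroup.toWord_of_pow]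
    simp [FreeGroup.invRev]

theorem toWord_syllProd [DecidableEq α] (b : α) {L : List (ℤ × FreeGroup α)} (hL : SyllGood b L) :
    (syllProd b L).norm = syllCost L ∧ ∀ y ∈ (syllProd b L).toWord.head?, y.1 = b := by
  induction L with
  | nil => simp [syllCost]
  | cons p L ih =>
    obtain ⟨ih1, ih2⟩ := ih fun q hq => hL q (List.mem_cons_of_mem _ hq)
    obtain ⟨h0, h1, hA⟩ := hL p List.mem_cons_self
    have hw := mem_of_mem_toWord hA
    have e1 : (of b ^ p.1 * p.2).toWord = (of b ^ p.1).toWord ++ p.2.toWord := by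
      apply toWord_mul_of_isReduced
      apply isReduced_append FreeGroup.isReduced_toWord FreeGroup.isReduced_toWord
      intro x hx y hy
      rw [toWord_of_zpow] at hx
      have hx' := List.eq_of_mem_replicate (List.mem_of_getLast? hx)
      rw [hx']
      exact (hw y (List.mem_of_mem_head? hy)).symm
    have e2 : (of b ^ p.1 * p.2 * syllProd b L).toWord
        = (of b ^ p.1).toWord ++ p.2.toWord ++ (syllProd b L).toWord := by
      rw [← e1]
      apply toWord_mul_of_isReduced
      apply isReduced_append FreeGroup.isReduced_toWord FreeGroup.isReduced_toWord
      intro x hx y hy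
      rw [ih2 y hy]
      rw [e1, List.getLast?_append_of_ne_nil _
        (by simpa [FreeGroup.toWord_eq_nil_iff] using h1)] at hx
      exact hw x (List.mem_of_getLast? hx)
    rw [syllProd_cons]
    constructor
    · rw [FreeGroup.norm, e2]
      simp only [List.length_append, syllCost, List.map_cons, List.sum_cons]
      rw [toWord_of_zpow, List.length_replicate]
      unfold syllCost at ih1
      rw [← ih1]
      rfl
    · intro y hy
      rw [e2, toWord_of_zpow] at hy
      obtain ⟨k, hk⟩ := Nat.exists_eq_succ_of_ne_zero (Int.natAbs_ne_zero.2 h0)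
      rw [hk] at hy
      simp [List.replicate_succ] at hy
      rw [← hy]

theorem exists_syllProd [DecidableEq α] (b : α) (f : FreeGroup α) :
    ∃ L : List (ℤ × FreeGroup α), (∀ p ∈ L, p.2 ∈ Subgroup.closure (of '' {x | x ≠ b})) ∧
      syllProd b L = f := by
  have key : ∀ x : α, ∀ e : ℤ, ∃ L : List (ℤ × FreeGroup α),
      (∀ p ∈ L, p.2 ∈ Subgroup.closure (of '' {x | x ≠ b})) ∧ syllProd b L = of x ^ e := by
    intro x e
    by_cases hx : x = b
    · subst hx
      exact ⟨[(e, 1)], by simp [one_mem], by simp⟩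
    · have hm : of x ∈ Subgroup.closure (of '' {x | x ≠ b}) :=
        Subgroup.subset_closure ⟨x, hx, rfl⟩
      exact ⟨[(0, of x ^ e)], by simpa using zpow_mem hm e, by simp⟩
  induction f using FreeGroup.induction_on with
  | C1 => exact ⟨[], by simp, rfl⟩
  | of x => simpa using key x 1
  | inv_of x _ => simpa using key x (-1)
  | mul x y hx hy =>
    obtain ⟨L, hL, rfl⟩ := hx
    obtain ⟨M, hM, rfl⟩ := hy
    refine ⟨L ++ M, fun p hp => ?_, by simp⟩
    rcases List.mem_append.1 hp with h | h
    · exact hL p h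
    · exact hM p h

theorem isConj_mul_comm {G : Type*} [Group G] (a b : G) : IsConj (a * b) (b * a) :=
  isConj_iff.2 ⟨b, by group⟩

theorem exists_good_syllProd [DecidableEq α] (b : α) (f : FreeGroup α) :
    (∃ g ∈ Subgroup.closure (of '' {x | x ≠ b}), IsConj f g) ∨ (∃ e : ℤ, IsConj f (of b ^ e)) ∨
    ∃ L, SyllGood b L ∧ IsConj f (syllProd b L) := by
  classical
  let P : ℕ → Prop := fun n => ∃ L : List (ℤ × FreeGroup α), L.length = n ∧
    (∀ p ∈ L, p.2 ∈ Subgroup.closure (of '' {x | x ≠ b})) ∧ IsConj f (syllProd b L)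
  have hP : ∃ n, P n := by
    obtain ⟨L, hL, rfl⟩ := exists_syllProd b f
    exact ⟨_, L, rfl, hL, IsConj.refl _⟩
  obtain ⟨L, hlen, hL, hf⟩ := Nat.find_spec hP
  have hmin : ∀ M : List (ℤ × FreeGroup α),
      (∀ p ∈ M, p.2 ∈ Subgroup.closure (of '' {x | x ≠ b})) → IsConj f (syllProd b M) →
      L.length ≤ M.length := fun M h1 h2 => hlen ▸ Nat.find_min' hP ⟨M, rfl, h1, h2⟩
  by_cases hg : SyllGood b L
  · exact Or.inr (Or.inr ⟨L, hg, hf⟩)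
  unfold SyllGood at hg
  push Not at hg
  obtain ⟨p, hp, hbad⟩ := hg
  obtain ⟨l₁, l₂, rfl⟩ := List.append_of_mem hp
  by_cases h0 : p.1 = 0
  · have hf' : IsConj f (syllProd b ((l₂ ++ l₁) ++ [p])) := by
      refine hf.trans ?_
      simp only [syllProd_append, syllProd_cons, syllProd_nil, mul_one]
      have := isConj_mul_comm (syllProd b l₁ * (of b ^ p.1 * p.2)) (syllProd b l₂)
      simpa only [mul_assoc] using this
    rcases List.eq_nil_or_concat (l₂ ++ l₁) with h | ⟨M, q, h⟩
    · left
      rw [h] at hf'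
      refine ⟨p.2, hL p hp, ?_⟩
      simpa [h0] using hf'
    · exfalso
      rw [List.concat_eq_append] at h
      have hmem : ∀ x, x ∈ M ++ [q] → x.2 ∈ Subgroup.closure (of '' {x | x ≠ b}) := by
        intro x hx
        rw [← h] at hx
        apply hL
        simp only [List.mem_append, List.mem_cons] at hx ⊢
        tauto
      have := hmin (M ++ [(q.1, q.2 * p.2)]) ?_ ?_
      · have h3 := congrArg List.length h
        simp only [List.length_append, List.length_cons, List.length_nil] at this h3
        omega
      · intro x hx
        rcases List.mem_append.1 hx with hx | hx
        · exact hmem x (List.mem_append_left _ hx)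
        · rw [List.mem_singleton] at hx
          rw [hx]
          exact mul_mem (hmem q (by simp)) (hL p hp)
      · rw [h] at hf'
        simpa [h0, mul_assoc] using hf'
  · have h1 : p.2 = 1 := by
      by_contra hne
      exact hbad h0 hne (hL p hp)
    have hf' : IsConj f (syllProd b (p :: (l₂ ++ l₁))) := by
      refine hf.trans ?_
      simp only [syllProd_append, syllProd_cons]
      have := isConj_mul_comm (syllProd b l₁) (of b ^ p.1 * p.2 * syllProd b l₂)
      simpa only [mul_assoc] using this
    rcases h : l₂ ++ l₁ with _ | ⟨q, M⟩
    · right; left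
      rw [h] at hf'
      refine ⟨p.1, ?_⟩
      simpa [h1] using hf'
    · exfalso
      have hmem : ∀ x, x ∈ q :: M → x.2 ∈ Subgroup.closure (of '' {x | x ≠ b}) := by
        intro x hx
        rw [← h] at hx
        apply hL
        simp only [List.mem_append, List.mem_cons] at hx ⊢
        tauto
      have := hmin ((p.1 + q.1, q.2) :: M) ?_ ?_
      · have h3 := congrArg List.length h
        simp only [List.length_append, List.length_cons] at this h3
        omega
      · intro x hx
        rcases List.mem_cons.1 hx with hx | hx
        · rw [hx]
          exact hmem q (by simp)
        · exact hmem x (List.mem_cons_of_mem _ hx)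
      · rw [h] at hf'
        simpa [h1, mul_assoc, zpow_add] using hf'

theorem SyllGood.conj {b c : α} (hbc : c ≠ b) {L : List (ℤ × FreeGroup α)} (hL : SyllGood b L)
    (k : ℤ) : SyllGood b (L.map fun p => (p.1, of c ^ k * p.2 * (of c ^ k)⁻¹)) := by
  intro p hp
  obtain ⟨q, hq, rfl⟩ := List.mem_map.1 hp
  obtain ⟨h0, h1, hA⟩ := hL q hq
  have hc : of c ^ k ∈ Subgroup.closure (of '' {x | x ≠ b}) :=
    zpow_mem (Subgroup.subset_closure (Set.mem_image_of_mem of hbc)) k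
  exact ⟨h0, by simpa using h1, mul_mem (mul_mem hc hA) (inv_mem hc)⟩

theorem map_eq_self_of_mem_closure {G : Type*} [Group G] (τ : G →* G) (S : Set G)
    (h : ∀ x ∈ S, τ x = x) {w : G} (hw : w ∈ Subgroup.closure S) : τ w = w := by
  have : Set.EqOn τ (MonoidHom.id G) (Subgroup.closure S) :=
    MonoidHom.eqOn_closure (f := τ) (g := MonoidHom.id G) h
  exact this hw

theorem norm_pow_conj_le [DecidableEq α] {f g : FreeGroup α} (h : IsConj f g) :
    ∃ C : ℕ, ∀ N : ℕ, (f ^ N).norm ≤ C + N * g.norm := by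
  obtain ⟨c, rfl⟩ := isConj_iff.1 h.symm
  refine ⟨c.norm + c.norm, fun N => ?_⟩
  rw [conj_pow]
  have h1 := FreeGroup.norm_mul_le (c * g ^ N) c⁻¹
  have h2 := FreeGroup.norm_mul_le c (g ^ N)
  rw [FreeGroup.norm_inv_eq] at h1
  have h3 : (g ^ N).norm ≤ N * g.norm := by
    induction N with
    | zero => simp
    | succ N ih =>
      have := FreeGroup.norm_mul_le (g ^ N) g
      have h4 := FreeGroup.norm_mul_le (c * g ^ N) c⁻¹
      have h5 := FreeGroup.norm_mul_le c (g ^ N)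
      rw [FreeGroup.norm_inv_eq] at h4
      have := ih h4 h5
      rw [pow_succ]
      linarith
  omega

theorem SyllGood.flatten_replicate {b : α} {L : List (ℤ × FreeGroup α)} (hL : SyllGood b L)
    (N : ℕ) : SyllGood b (List.replicate N L).flatten := by
  intro p hp
  obtain ⟨M, hM, hp⟩ := List.mem_flatten.1 hp
  rw [List.eq_of_mem_replicate hM] at hp
  exact hL p hp

theorem syllProd_flatten_replicate (b : α) (L : List (ℤ × FreeGroup α)) (N : ℕ) :
    syllProd b (List.replicate N L).flatten = syllProd b L ^ N := by
  induction N with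
  | zero => simp
  | succ N ih => rw [List.replicate_succ, List.flatten_cons, syllProd_append, ih, pow_succ']

theorem syllCost_flatten_replicate [DecidableEq α] (L : List (ℤ × FreeGroup α)) (N : ℕ) :
    syllCost (List.replicate N L).flatten = N * syllCost L := by
  induction N with
  | zero => simp [syllCost]
  | succ N ih =>
    rw [List.replicate_succ, List.flatten_cons, add_mul, ← ih]
    simp [syllCost, add_comm]

theorem syllCost_le_of_isConj [DecidableEq α] {b : α} {L M : List (ℤ × FreeGroup α)}
    (hL : SyllGood b L) (hM : SyllGood b M) (h : IsConj (syllProd b L) (syllProd b M)) :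
    syllCost L ≤ syllCost M := by
  obtain ⟨C, hC⟩ := norm_pow_conj_le h
  by_contra hlt
  have := hC (C + 1)
  rw [← syllProd_flatten_replicate, (toWord_syllProd b (hL.flatten_replicate _)).1,
    syllCost_flatten_replicate, (toWord_syllProd b hM).1] at this
  nlinarith

theorem commute_of_norm_conj_le [DecidableEq α] (c : α) (w : FreeGroup α) (N : ℕ)
    (h : ∀ k : ℕ, (of c ^ (k : ℤ) * w * (of c ^ (k : ℤ))⁻¹).norm ≤ N) :
    Commute w (of c) := by
  let S : Set α := {x | x = c ∨ ∃ p ∈ w.toWord, p.1 = x}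
  have hS : S.Finite := by
    have : S = {c} ∪ (Prod.fst '' {p | p ∈ w.toWord}) := by
      ext x
      simp [S]
    rw [this]
    exact (Set.finite_singleton c).union ((List.finite_toSet _).image _)
  have : Finite S := hS
  have hfin : {f : FreeGroup α | f.norm ≤ N ∧ ∀ p ∈ f.toWord, p.1 ∈ S}.Finite := by
    refine Set.Finite.subset (((List.finite_length_le (S × Bool) N).image
      (fun L => FreeGroup.mk (L.map fun p => ((p.1 : α), p.2))))) ?_
    rintro f ⟨hf, hfS⟩
    refine ⟨f.toWord.attach.map fun p => (⟨p.1.1, hfS p.1 p.2⟩, p.1.2), ?_, ?_⟩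
    · simpa [FreeGroup.norm] using hf
    · simp only [List.map_map, Function.comp_def]
      rw [List.attach_map_subtype_val]
      exact FreeGroup.mk_toWord
  have hc : of c ∈ Subgroup.closure (of '' S) := Subgroup.subset_closure ⟨c, Or.inl rfl, rfl⟩
  have hw : w ∈ Subgroup.closure (of '' S) :=
    mem_closure_of_mem_toWord fun p hp => Or.inr ⟨p, hp, rfl⟩
  have hnot : ¬ Function.Injective fun k : ℕ => of c ^ (k : ℤ) * w * (of c ^ (k : ℤ))⁻¹ := by
    intro hinj
    refine Set.infinite_of_injective_forall_mem hinj (fun k => ?_) hfin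
    refine ⟨h k, mem_of_mem_toWord ?_⟩
    exact mul_mem (mul_mem (zpow_mem hc _) hw) (inv_mem (zpow_mem hc _))
  unfold Function.Injective at hnot
  push Not at hnot
  obtain ⟨k, l, hkl, hne⟩ := hnot
  apply commute_of_commute_zpow (j := (l : ℤ) - k) (by omega)
  have h1 : w = of c ^ ((l : ℤ) - k) * w * (of c ^ ((l : ℤ) - k))⁻¹ := by
    have := congrArg (fun x => (of c ^ (k : ℤ))⁻¹ * x * of c ^ (k : ℤ)) hkl
    rw [show (l : ℤ) - k = -k + l by ring, zpow_add, zpow_neg]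
    simpa [mul_assoc] using this
  exact (mul_inv_eq_iff_eq_mul.1 h1.symm).symm

/-- A conjugacy class invariant under `b ↦ c⁻¹ b c` meets the subgroup avoiding `b` or the
subgroup generated by `b` and `c`. -/
theorem isConj_of_partial_conj [DecidableEq α] {b c : α} (hbc : c ≠ b)
    (τ : FreeGroup α →* FreeGroup α) (hb : τ (of b) = (of c)⁻¹ * of b * of c)
    (hx : ∀ x, x ≠ b → τ (of x) = of x) {f : FreeGroup α} (hf : IsConj (τ f) f) :
    (∃ g ∈ Subgroup.closure (of '' {x | x ≠ b}), IsConj f g) ∨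
    (∃ g ∈ Subgroup.closure {of b, of c}, IsConj f g) := by
  rcases exists_good_syllProd b f with h | ⟨e, h⟩ | ⟨L, hL, hfL⟩
  · exact Or.inl h
  · exact Or.inr ⟨_, zpow_mem (Subgroup.subset_closure (by simp)) e, h⟩
  right
  let Lk : ℕ → List (ℤ × FreeGroup α) := fun k =>
    L.map fun p => (p.1, of c ^ (k : ℤ) * p.2 * (of c ^ (k : ℤ))⁻¹)
  have hτA : ∀ w ∈ Subgroup.closure (of '' {x | x ≠ b}), τ w = w := by
    intro w hw
    refine map_eq_self_of_mem_closure τ _ ?_ hw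
    rintro _ ⟨x, hxb, rfl⟩
    exact hx x hxb
  have hstep : ∀ M : List (ℤ × FreeGroup α),
      (∀ p ∈ M, p.2 ∈ Subgroup.closure (of '' {x | x ≠ b})) →
      of c * τ (syllProd b M) * (of c)⁻¹ =
        syllProd b (M.map fun p => (p.1, of c * p.2 * (of c)⁻¹)) := by
    intro M hM
    induction M with
    | nil => simp
    | cons p M ih =>
      have h1 : τ (of b ^ p.1) = (of c)⁻¹ * of b ^ p.1 * of c := by
        rw [map_zpow, hb]
        simpa using conj_zpow (i := p.1) (a := (of c)⁻¹) (b := of b)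
      rw [List.map_cons, syllProd_cons, syllProd_cons,
        ← ih fun q hq => hM q (List.mem_cons_of_mem _ hq), map_mul, map_mul, h1,
        hτA _ (hM p List.mem_cons_self)]
      group
  have hconj : ∀ k, IsConj (syllProd b (Lk k)) (syllProd b L) := by
    intro k
    induction k with
    | zero =>
      have : Lk 0 = L := by simp [Lk]
      rw [this]
    | succ k ih =>
      have hA : ∀ p ∈ Lk k, p.2 ∈ Subgroup.closure (of '' {x | x ≠ b}) :=
        fun p hp => (hL.conj hbc k p hp).2.2
      have e1 : Lk (k + 1) = (Lk k).map fun p => (p.1, of c * p.2 * (of c)⁻¹) := by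
        simp only [Lk, List.map_map]
        congr 1
        funext p
        simp only [Function.comp]
        push_cast
        rw [add_comm, zpow_add, zpow_one]
        group
      rw [e1, ← hstep _ hA]
      refine IsConj.trans (isConj_iff.2 ⟨of c, rfl⟩).symm ?_
      refine (τ.map_isConj (ih.trans hfL.symm)).trans (hf.trans hfL)
  have hcost : ∀ k : ℕ, ∀ p ∈ L,
      (of c ^ (k : ℤ) * p.2 * (of c ^ (k : ℤ))⁻¹).norm ≤ syllCost L := by
    intro k p hp
    refine le_trans ?_ (syllCost_le_of_isConj (hL.conj hbc k) hL (hconj k))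
    have hmem : p.1.natAbs + (of c ^ (k : ℤ) * p.2 * (of c ^ (k : ℤ))⁻¹).norm ∈
        (Lk k).map fun p => p.1.natAbs + p.2.norm := by
      simp only [Lk, List.map_map, List.mem_map]
      exact ⟨p, hp, rfl⟩
    have := List.single_le_sum (fun _ _ => Nat.zero_le _) _ hmem
    exact le_trans (Nat.le_add_left _ _) this
  refine ⟨_, ?_, hfL⟩
  refine Subgroup.list_prod_mem _ fun x hx => ?_
  obtain ⟨p, hp, rfl⟩ := List.mem_map.1 hx
  refine mul_mem (zpow_mem (Subgroup.subset_closure (by simp)) _) ?_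
  have hcomm : Commute p.2 (of c) := commute_of_norm_conj_le c p.2 _ fun k => hcost k p hp
  obtain ⟨k, hk⟩ := exists_eq_zpow_of_commute hcomm
    (lift fun x => if x = c then Multiplicative.ofAdd 1 else 1) (by simp)
  rw [hk]
  exact zpow_mem (Subgroup.subset_closure (by simp)) _

/-- The prefix products `x_0 x_1 ⋯ x_{k-1}`. -/
def yy : ℕ → FreeGroup ℕ
  | 0 => 1
  | k + 1 => yy k * of k

@[simp] theorem yy_zero : yy 0 = 1 := rfl

theorem yy_succ (k : ℕ) : yy (k + 1) = yy k * of k := rfl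

/-- The subgroup generated by the first `m` letters. -/
def FF (m : ℕ) : Subgroup (FreeGroup ℕ) := Subgroup.closure (of '' {j | j < m})

theorem of_mem_FF {j m : ℕ} (h : j < m) : of j ∈ FF m := Subgroup.subset_closure ⟨j, h, rfl⟩

theorem FF_mono {k m : ℕ} (h : k ≤ m) : FF k ≤ FF m :=
  Subgroup.closure_mono (Set.image_mono fun _ hj => lt_of_lt_of_le hj h)

theorem yy_mem_FF (m : ℕ) : yy m ∈ FF m := by
  induction m with
  | zero => exact one_mem _
  | succ m ih => exact mul_mem (FF_mono m.le_succ ih) (of_mem_FF m.lt_succ_self)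

/-- The retraction killing all letters with index at least `k`. -/
def rr (k : ℕ) : FreeGroup ℕ →* FreeGroup ℕ := lift fun j => if j < k then of j else 1

@[simp] theorem rr_of (k j : ℕ) : rr k (of j) = if j < k then of j else 1 := by simp [rr]

theorem rr_eq_self {k : ℕ} {f : FreeGroup ℕ} (hf : f ∈ FF k) : rr k f = f := by
  refine map_eq_self_of_mem_closure _ _ ?_ hf
  rintro _ ⟨j, hj, rfl⟩
  exact (rr_of k j).trans (if_pos hj)

theorem map_mem_of_mem_closure {G H : Type*} [Group G] [Group H] (r : G →* H) {S : Set G}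
    {K : Subgroup H} (h : ∀ x ∈ S, r x ∈ K) {w : G} (hw : w ∈ Subgroup.closure S) : r w ∈ K := by
  have : Subgroup.closure S ≤ K.comap r := (Subgroup.closure_le _).2 h
  exact this hw

theorem rr_mem (k : ℕ) (f : FreeGroup ℕ) : rr k f ∈ FF k := by
  induction f using FreeGroup.induction_on with
  | C1 => simp [one_mem]
  | of x =>
    rw [rr_of]
    split_ifs with h
    · exact of_mem_FF h
    · exact one_mem _
  | inv_of x h => rw [map_inv]; exact inv_mem h
  | mul x y hx hy => rw [map_mul]; exact mul_mem hx hy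

theorem exists_of_isConj_sq {i : ℕ} (T : FreeGroup ℕ →* FreeGroup ℕ)
    (h0 : T (of i) = (of i * of (i + 1))⁻¹ * of i * (of i * of (i + 1)))
    (h1 : T (of (i + 1)) = (of i * of (i + 1))⁻¹ * of (i + 1) * (of i * of (i + 1)))
    (h2 : ∀ k, k ≠ i → k ≠ i + 1 → T (of k) = of k) {f : FreeGroup ℕ} (hf : IsConj (T f) f) :
    (∃ g ∈ Subgroup.closure {of i, of (i + 1)}, IsConj f g) ∨
    (∃ g ∈ Subgroup.closure ({of i * of (i + 1)} ∪ of '' {k | k ≠ i ∧ k ≠ i + 1}),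
      IsConj f g) := by
  let κ : FreeGroup ℕ →* FreeGroup ℕ := lift fun k => if k = i + 1 then of i * of (i + 1) else of k
  let κ' : FreeGroup ℕ →* FreeGroup ℕ :=
    lift fun k => if k = i + 1 then (of i)⁻¹ * of (i + 1) else of k
  let τ : FreeGroup ℕ →* FreeGroup ℕ :=
    lift fun k => if k = i then (of (i + 1))⁻¹ * of i * of (i + 1) else of k
  have hii : i ≠ i + 1 := by omega
  have hκ : ∀ g, κ (κ' g) = g := by
    intro g
    have : κ.comp κ' = MonoidHom.id _ := by
      ext k
      by_cases hk : k = i + 1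
      · simp [κ, κ', hk]
      · simp [κ, κ', hk]
    exact DFunLike.congr_fun this g
  have hτ : ∀ g, τ (κ' g) = κ' (T g) := by
    intro g
    have : τ.comp κ' = κ'.comp T := by
      ext k
      by_cases hk : k = i + 1
      · subst hk
        simp [τ, κ', h1, mul_assoc]
      · by_cases hk' : k = i
        · subst hk'
          simp [τ, κ', h0, mul_assoc]
        · simp [τ, κ', h2 k hk' hk, hk, hk']
    exact DFunLike.congr_fun this g
  have hconj : IsConj (τ (κ' f)) (κ' f) := by
    rw [hτ]
    exact κ'.map_isConj hf
  rcases isConj_of_partial_conj (b := i) (c := i + 1) hii.symm τ (by simp [τ])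
    (fun x hx => by simp [τ, hx]) hconj with ⟨g, hg, hfg⟩ | ⟨g, hg, hfg⟩
  · right
    refine ⟨κ g, map_mem_of_mem_closure κ ?_ hg, ?_⟩
    · rintro _ ⟨k, hk, rfl⟩
      by_cases hk' : k = i + 1
      · simp only [κ, FreeGroup.lift_apply_of, if_pos hk']
        exact Subgroup.subset_closure (by simp)
      · simp only [κ, FreeGroup.lift_apply_of, if_neg hk']
        exact Subgroup.subset_closure (Or.inr ⟨k, ⟨hk, hk'⟩, rfl⟩)
    · simpa only [hκ] using κ.map_isConj hfg
  · left
    refine ⟨κ g, map_mem_of_mem_closure κ ?_ hg, ?_⟩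
    · have ha : of i ∈ Subgroup.closure {of i, of (i + 1)} := Subgroup.subset_closure (by simp)
      have hb : of (i + 1) ∈ Subgroup.closure {of i, of (i + 1)} :=
        Subgroup.subset_closure (by simp)
      rintro _ (rfl | rfl)
      · simpa [κ, hii] using ha
      · simpa [κ] using mul_mem ha hb
    · simpa only [hκ] using κ.map_isConj hfg

theorem isConj_zpow_of_retract {G : Type*} [Group G] {f g g' x : G} (r : G →* G) (hr : r g = g)
    (hf : IsConj f g) (hf' : IsConj f g') {S : Set G} (hg' : g' ∈ Subgroup.closure S)
    (h : ∀ s ∈ S, r s ∈ Subgroup.zpowers x) : ∃ e : ℤ, IsConj f (x ^ e) := by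
  obtain ⟨e, he⟩ := Subgroup.mem_zpowers_iff.1 (map_mem_of_mem_closure r h hg')
  refine ⟨e, ?_⟩
  rw [he]
  have := r.map_isConj (hf.symm.trans hf')
  rw [hr] at this
  exact hf.trans this

theorem isConj_zpow_of_sq_invariant {m : ℕ} (hm : 3 ≤ m)
    (T : ℕ → FreeGroup ℕ →* FreeGroup ℕ)
    (h0 : ∀ i, i + 1 < m → T i (of i) = (of i * of (i + 1))⁻¹ * of i * (of i * of (i + 1)))
    (h1 : ∀ i, i + 1 < m →
      T i (of (i + 1)) = (of i * of (i + 1))⁻¹ * of (i + 1) * (of i * of (i + 1)))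
    (h2 : ∀ i, i + 1 < m → ∀ k, k ≠ i → k ≠ i + 1 → T i (of k) = of k)
    {f : FreeGroup ℕ} (hf : f ∈ FF m) (hT : ∀ i, i + 1 < m → IsConj (T i f) f) :
    ∃ e : ℤ, (∃ i < m, IsConj f (of i ^ e)) ∨ IsConj f (yy m ^ e) := by
  have alt := fun i hi => exists_of_isConj_sq (T i) (h0 i hi) (h1 i hi) (h2 i hi) (hT i hi)
  by_cases hall : ∀ i, i + 1 < m →
      ∃ g ∈ Subgroup.closure ({of i * of (i + 1)} ∪ of '' {k | k ≠ i ∧ k ≠ i + 1}), IsConj f g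
  · have key : ∀ i, i < m → ∃ g ∈ Subgroup.closure (yy '' {k | i < k ∧ k ≤ m}), IsConj f g := by
      intro i hi
      induction i with
      | zero =>
        refine ⟨f, ?_, IsConj.refl f⟩
        refine (Subgroup.closure_le _).2 ?_ hf
        rintro _ ⟨j, hj, rfl⟩
        have e1 : of j = (yy j)⁻¹ * yy (j + 1) := by rw [yy_succ]; group
        rw [SetLike.mem_coe, e1]
        have hj' : j < m := hj
        refine mul_mem (inv_mem ?_) (Subgroup.subset_closure ⟨j + 1, ⟨by omega, by omega⟩, rfl⟩)
        rcases Nat.eq_zero_or_pos j with rfl | hp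
        · exact one_mem _
        · exact Subgroup.subset_closure ⟨j, ⟨hp, by omega⟩, rfl⟩
      | succ i ih =>
        obtain ⟨g, hg, hfg⟩ := ih (by omega)
        obtain ⟨g', hg', hfg'⟩ := hall i hi
        let r : FreeGroup ℕ →* FreeGroup ℕ := lift fun k =>
          if k = i then (yy i)⁻¹ else if k = i + 1 then yy (i + 2) else of k
        have hii : i + 1 ≠ i := by omega
        have hr1 : ∀ k ≤ i, r (yy k) = yy k := by
          intro k hk
          induction k with
          | zero => simp
          | succ k ihk =>
            rw [yy_succ, map_mul, ihk (by omega)]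
            simp [r, show k ≠ i by omega, show k ≠ i + 1 by omega]
        have hr2 : r (yy (i + 1)) = 1 := by
          rw [yy_succ, map_mul, hr1 i le_rfl]
          simp [r]
        have hr3 : ∀ k, r (yy (i + 2 + k)) = yy (i + 2 + k) := by
          intro k
          induction k with
          | zero => rw [add_zero, yy_succ (i + 1), map_mul, hr2]; simp [r, yy_succ]
          | succ k ihk =>
            rw [← add_assoc, yy_succ, map_mul, ihk]
            simp [r, show i + 2 + k ≠ i by omega, show i + 2 + k ≠ i + 1 by omega]
        have hrg' : r g' = g' := by
          refine map_eq_self_of_mem_closure r _ ?_ hg'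
          rintro _ (rfl | ⟨k, ⟨hk1, hk2⟩, rfl⟩)
          · simp [r, yy_succ, mul_assoc]
          · simp [r, hk1, hk2]
        refine ⟨r g, map_mem_of_mem_closure r ?_ hg, ?_⟩
        · rintro _ ⟨k, ⟨hk1, hk2⟩, rfl⟩
          rcases Nat.lt_or_ge k (i + 2) with hk | hk
          · rw [show k = i + 1 by omega, hr2]
            exact one_mem _
          · obtain ⟨l, rfl⟩ := Nat.exists_eq_add_of_le hk
            rw [hr3]
            exact Subgroup.subset_closure ⟨_, ⟨by omega, hk2⟩, rfl⟩
        · have := r.map_isConj (hfg'.symm.trans hfg)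
          rw [hrg'] at this
          exact hfg'.trans this
    obtain ⟨g, hg, hfg⟩ := key (m - 1) (by omega)
    have : {k | m - 1 < k ∧ k ≤ m} = {m} := by ext k; simp; omega
    rw [this, Set.image_singleton, ← Subgroup.zpowers_eq_closure] at hg
    obtain ⟨e, rfl⟩ := Subgroup.mem_zpowers_iff.1 hg
    exact ⟨e, Or.inr hfg⟩
  · push Not at hall
    obtain ⟨i, hi, hno⟩ := hall
    obtain ⟨g, hg, hfg⟩ : ∃ g ∈ Subgroup.closure {of i, of (i + 1)}, IsConj f g := by
      rcases alt i hi with h | ⟨g, hg, h⟩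
      · exact h
      · exact absurd h (hno g hg)
    have hii : i + 1 ≠ i := by omega
    have hrg : ∀ r : FreeGroup ℕ →* FreeGroup ℕ, r (of i) = of i → r (of (i + 1)) = of (i + 1) →
        r g = g := by
      intro r hr1 hr2
      refine map_eq_self_of_mem_closure r _ ?_ hg
      rintro _ (rfl | rfl)
      · exact hr1
      · exact hr2
    let r0 : FreeGroup ℕ →* FreeGroup ℕ := lift fun k =>
      if k = i then of i else if k = i + 1 then of (i + 1) else 1
    have hr0 : r0 g = g := hrg r0 (by simp [r0]) (by simp [r0])
    by_cases hi2 : i + 2 < m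
    · rcases alt (i + 1) hi2 with ⟨g', hg', hfg'⟩ | ⟨g', hg', hfg'⟩
      · obtain ⟨e, he⟩ := isConj_zpow_of_retract (x := of (i + 1)) r0 hr0 hfg hfg' hg' (by
          rintro _ (rfl | rfl)
          · simp [r0]
          · simp [r0, show i + 1 + 1 ≠ i by omega])
        exact ⟨e, Or.inl ⟨i + 1, by omega, he⟩⟩
      · let r : FreeGroup ℕ →* FreeGroup ℕ := lift fun k =>
          if k = i then of i else if k = i + 1 then of (i + 1) else
            if k = i + 2 then (of (i + 1))⁻¹ else 1
        obtain ⟨e, he⟩ := isConj_zpow_of_retract (x := of i) r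
          (hrg r (by simp [r]) (by simp [r])) hfg hfg' hg' (by
          rintro _ (rfl | ⟨k, ⟨hk1, hk2⟩, rfl⟩)
          · simp [r, show i + 1 + 1 ≠ i by omega]
          · by_cases hk : k = i
            · simp [r, hk]
            · simp [r, hk, hk1, hk2])
        exact ⟨e, Or.inl ⟨i, by omega, he⟩⟩
    · obtain ⟨j, rfl⟩ : ∃ j, i = j + 1 := ⟨i - 1, by omega⟩
      rcases alt j (by omega) with ⟨g', hg', hfg'⟩ | ⟨g', hg', hfg'⟩
      · obtain ⟨e, he⟩ := isConj_zpow_of_retract (x := of (j + 1)) r0 hr0 hfg hfg' hg' (by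
          rintro _ (rfl | rfl)
          · simp [r0, show j ≠ j + 1 + 1 by omega]
          · simp [r0])
        exact ⟨e, Or.inl ⟨j + 1, by omega, he⟩⟩
      · let r : FreeGroup ℕ →* FreeGroup ℕ := lift fun k =>
          if k = j + 1 then of (j + 1) else if k = j + 2 then of (j + 2) else
            if k = j then (of (j + 1))⁻¹ else 1
        obtain ⟨e, he⟩ := isConj_zpow_of_retract (x := of (j + 2)) r
          (hrg r (by simp [r]) (by simp [r])) hfg hfg' hg' (by
          rintro _ (rfl | ⟨k, ⟨hk1, hk2⟩, rfl⟩)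
          · simp [r]
          · by_cases hk : k = j + 2
            · simp [r, hk]
            · simp [r, hk, hk1, hk2])
        exact ⟨e, Or.inl ⟨j + 2, by omega, he⟩⟩

/-- The Artin automorphism `x_i ↦ x_{i+1}`, `x_{i+1} ↦ x_{i+1}⁻¹ x_i x_{i+1}`. -/
def artin (i : ℕ) : MulAut (FreeGroup ℕ) :=
  MonoidHom.toMulEquiv
    (lift fun k => if k = i then of (i + 1) else
      if k = i + 1 then (of (i + 1))⁻¹ * of i * of (i + 1) else of k)
    (lift fun k => if k = i then of i * of (i + 1) * (of i)⁻¹ else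
      if k = i + 1 then of i else of k)
    (by
      ext k
      by_cases h : k = i
      · simp [h]
      · by_cases h' : k = i + 1
        · simp [h', mul_assoc]
        · simp [h, h'])
    (by
      ext k
      by_cases h : k = i
      · simp [h, mul_assoc]
      · by_cases h' : k = i + 1
        · simp [h']
        · simp [h, h'])

theorem artin_of (i k : ℕ) : artin i (of k) = if k = i then of (i + 1) else
      if k = i + 1 then (of (i + 1))⁻¹ * of i * of (i + 1) else of k := by
  simp [artin]

theorem artin_symm_of (i k : ℕ) : (artin i)⁻¹ (of k) =
    if k = i then of i * of (i + 1) * (of i)⁻¹ else if k = i + 1 then of i else of k := by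
  have : (artin i)⁻¹ = (artin i).symm := rfl
  rw [this]
  simp [artin]

@[simp] theorem artin_self (i : ℕ) : artin i (of i) = of (i + 1) := by simp [artin_of]

@[simp] theorem artin_succ (i : ℕ) :
    artin i (of (i + 1)) = (of (i + 1))⁻¹ * of i * of (i + 1) := by simp [artin_of]

theorem artin_of_ne {i k : ℕ} (h : k ≠ i) (h' : k ≠ i + 1) : artin i (of k) = of k := by
  simp [artin_of, h, h']

theorem artin_yy {i k : ℕ} (h : k ≠ i + 1) : artin i (yy k) = yy k := by
  induction k with
  | zero => simp
  | succ k ih =>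
    by_cases hk : k = i + 1
    · subst hk
      rw [yy_succ, yy_succ]
      have : artin i (yy i) = yy i := by
        clear ih h
        have : ∀ j ≤ i, artin i (yy j) = yy j := by
          intro j hj
          induction j with
          | zero => simp
          | succ j ih =>
            rw [yy_succ, map_mul, ih (by omega), artin_of_ne (by omega) (by omega)]
        exact this i le_rfl
      simp [this, mul_assoc]
    · rw [yy_succ, map_mul, ih hk, artin_of_ne (by omega) hk]

theorem artin_mem_FF {i m : ℕ} (h : i + 1 < m) {f : FreeGroup ℕ} (hf : f ∈ FF m) :
    artin i f ∈ FF m := by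
  refine map_mem_of_mem_closure (artin i).toMonoidHom ?_ hf
  rintro _ ⟨k, hk, rfl⟩
  have h1 := of_mem_FF h
  have h0 : of i ∈ FF m := of_mem_FF (by omega)
  have hk' : of k ∈ FF m := of_mem_FF hk
  change artin i (of k) ∈ _
  rw [artin_of]
  split_ifs
  · exact h1
  · exact mul_mem (mul_mem (inv_mem h1) h0) h1
  · exact hk'

theorem artin_symm_mem_FF {i m : ℕ} (h : i + 1 < m) {f : FreeGroup ℕ} (hf : f ∈ FF m) :
    (artin i)⁻¹ f ∈ FF m := by
  refine map_mem_of_mem_closure ((artin i)⁻¹).toMonoidHom ?_ hf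
  rintro _ ⟨k, hk, rfl⟩
  have h1 := of_mem_FF h
  have h0 : of i ∈ FF m := of_mem_FF (by omega)
  have hk' : of k ∈ FF m := of_mem_FF hk
  change (artin i)⁻¹ (of k) ∈ _
  rw [artin_symm_of]
  split_ifs
  · exact mul_mem (mul_mem h0 h1) (inv_mem h0)
  · exact h0
  · exact hk'

theorem norm_lt_of_head {u v : FreeGroup ℕ} {k : ℕ} {s : Bool}
    (hu : ∀ x ∈ u.toWord.getLast?, x.1 ≠ k) (hv : (k, s) ∈ (u⁻¹ * v).toWord.head?) :
    (u * FreeGroup.mk [(k, !s)] * u⁻¹ * v).norm < v.norm := by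
  obtain ⟨P, hP⟩ : ∃ P, (u⁻¹ * v).toWord = (k, s) :: P := by
    rcases h : (u⁻¹ * v).toWord with _ | ⟨p, P⟩
    · simp [h] at hv
    · rw [h] at hv
      simp only [List.head?_cons, Option.mem_def, Option.some.injEq] at hv
      exact ⟨P, by rw [hv]⟩
  have h1 : u⁻¹ * v = FreeGroup.mk ((k, s) :: P) := by rw [← hP, FreeGroup.mk_toWord]
  have h2 : u * FreeGroup.mk [(k, !s)] * u⁻¹ * v = u * FreeGroup.mk P := by
    rw [mul_assoc _ u⁻¹, h1, mul_assoc, FreeGroup.mul_mk]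
    congr 1
    exact Quot.sound (by simp)
  have h3 : v.toWord = u.toWord ++ (u⁻¹ * v).toWord := by
    have := toWord_mul_of_isReduced (u := u) (v := u⁻¹ * v)
      (isReduced_append FreeGroup.isReduced_toWord FreeGroup.isReduced_toWord (by
        intro x hx y hy
        rw [hP] at hy
        simp only [List.head?_cons, Option.mem_def, Option.some.injEq] at hy
        rw [← hy]
        exact hu x hx))
    rwa [mul_inv_cancel_left] at this
  rw [h2]
  have h4 := FreeGroup.norm_mul_le u (FreeGroup.mk P)
  have h5 := FreeGroup.norm_mk_le (L₁ := P)
  have h6 : v.norm = u.norm + (P.length + 1) := by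
    rw [FreeGroup.norm, h3, hP]
    simp [FreeGroup.norm]
  omega

theorem exists_reduced_conj {w : FreeGroup ℕ} {k : ℕ} (h : IsConj (of k) w) :
    ∃ u : FreeGroup ℕ, w = u * of k * u⁻¹ ∧ (∀ x ∈ u.toWord.getLast?, x.1 ≠ k) ∧
      w.norm = 2 * u.norm + 1 := by
  classical
  have hex : ∃ n, ∃ u : FreeGroup ℕ, u.norm = n ∧ w = u * of k * u⁻¹ := by
    obtain ⟨u, hu⟩ := isConj_iff.1 h
    exact ⟨_, u, rfl, hu.symm⟩
  obtain ⟨u, hun, hu⟩ := Nat.find_spec hex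
  have hmin : ∀ v : FreeGroup ℕ, w = v * of k * v⁻¹ → u.norm ≤ v.norm := fun v hv =>
    hun ▸ Nat.find_min' hex ⟨v, rfl, hv⟩
  have hlast : ∀ x ∈ u.toWord.getLast?, x.1 ≠ k := by
    rintro ⟨k', s⟩ hx hk
    dsimp only at hk
    subst hk
    obtain ⟨P, hP⟩ := List.getLast?_eq_some_iff.1 hx
    have h1 : u = FreeGroup.mk P * FreeGroup.mk [(k', s)] := by
      rw [FreeGroup.mul_mk, ← hP, FreeGroup.mk_toWord]
    have h2 : FreeGroup.mk [(k', s)] * of k' * (FreeGroup.mk [(k', s)])⁻¹ = of k' := by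
      cases s
      · have : FreeGroup.mk [(k', false)] = (of k')⁻¹ := by
          simp [of, FreeGroup.inv_mk, FreeGroup.invRev]
        rw [this]
        group
      · change of k' * of k' * (of k')⁻¹ = _
        group
    have h3 := hmin (FreeGroup.mk P) (by
      rw [hu, h1, mul_inv_rev]
      calc _ = FreeGroup.mk P * (FreeGroup.mk [(k', s)] * of k' * (FreeGroup.mk [(k', s)])⁻¹) *
            (FreeGroup.mk P)⁻¹ := by group
        _ = _ := by rw [h2])
    have h4 := FreeGroup.norm_mk_le (L₁ := P)
    have h5 : u.norm = P.length + 1 := by rw [FreeGroup.norm, hP]; simp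
    omega
  refine ⟨u, hu, hlast, ?_⟩
  have e1 : (u * of k).toWord = u.toWord ++ (of k).toWord :=
    toWord_mul_of_isReduced (isReduced_append FreeGroup.isReduced_toWord FreeGroup.isReduced_toWord
      (by
        intro x hx y hy
        simp only [FreeGroup.toWord_of, List.head?_cons, Option.mem_def, Option.some.injEq] at hy
        rw [← hy]
        exact hlast x hx))
  have e2 : (u * of k * u⁻¹).toWord = (u * of k).toWord ++ u⁻¹.toWord :=
    toWord_mul_of_isReduced (isReduced_append FreeGroup.isReduced_toWord FreeGroup.isReduced_toWord
      (by
        intro x hx y hy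
        rw [e1] at hx
        simp only [FreeGroup.toWord_of, List.getLast?_append, List.getLast?_singleton,
          Option.some_or, Option.mem_def, Option.some.injEq] at hx
        rw [← hx]
        rw [FreeGroup.toWord_inv, FreeGroup.invRev, List.head?_reverse, List.getLast?_map] at hy
        simp only [Option.mem_def, Option.map_eq_some_iff] at hy
        obtain ⟨z, hz, rfl⟩ := hy
        exact (hlast z hz).symm))
  rw [hu, FreeGroup.norm, e2, e1]
  have : u⁻¹.toWord.length = u.norm := FreeGroup.norm_inv_eq
  simp only [List.length_append, this, FreeGroup.toWord_of, List.length_singleton]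
  change u.norm + 1 + u.norm = _
  ring

theorem yy_eq_mk (k : ℕ → ℕ) (m : ℕ) :
    lift (fun j => of (k j)) (yy m) = FreeGroup.mk ((List.range m).map fun j => (k j, true)) := by
  induction m with
  | zero => rfl
  | succ m ih =>
    rw [yy_succ, map_mul, ih, List.range_succ, List.map_append, ← FreeGroup.mul_mk]
    simp [of]

theorem isReduced_map_true (L : List ℕ) :
    FreeGroup.IsReduced (L.map fun j => (j, true)) := by
  unfold FreeGroup.IsReduced
  rw [List.isChain_map]
  exact (List.pairwise_of_forall fun _ _ _ => rfl).isChain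

theorem toWord_yy (m : ℕ) : (yy m).toWord = (List.range m).map fun j => (j, true) := by
  have h := yy_eq_mk id m
  have h' : lift (fun j => of (id j)) (yy m) = yy m := by
    have : lift (fun j : ℕ => of (id j)) = MonoidHom.id _ := by ext; simp
    rw [this]
    rfl
  rw [h'] at h
  rw [h, FreeGroup.toWord_mk]
  exact (isReduced_map_true _).reduce_eq

theorem eq_of_lift_yy {k : ℕ → ℕ} {m : ℕ} (h : lift (fun j => of (k j)) (yy m) = yy m) :
    ∀ j < m, k j = j := by
  have h1 := congrArg FreeGroup.toWord h
  rw [toWord_yy, yy_eq_mk, FreeGroup.toWord_mk] at h1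
  have h2 : FreeGroup.IsReduced ((List.range m).map fun j => (k j, true)) := by
    have := isReduced_map_true ((List.range m).map k)
    rwa [List.map_map] at this
  rw [h2.reduce_eq] at h1
  intro j hj
  have := List.map_inj_left.1 h1 j (List.mem_range.2 hj)
  exact (Prod.ext_iff.1 this).1

/-- A tuple of conjugates of letters with product `x_0 ⋯ x_{m-1}` that no braid move shortens is
the standard one. -/
theorem eq_of_norm_le {m : ℕ} {w : ℕ → FreeGroup ℕ} {k : ℕ → ℕ}
    (hw : ∀ j < m, IsConj (of (k j)) (w j)) (hprod : lift w (yy m) = yy m)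
    (h1 : ∀ i, i + 1 < m → (w (i + 1)).norm ≤ (w i * w (i + 1) * (w i)⁻¹).norm)
    (h2 : ∀ i, i + 1 < m → (w i).norm ≤ ((w (i + 1))⁻¹ * w i * w (i + 1)).norm) :
    ∀ j < m, w j = of j := by
  have hex : ∀ j, ∃ u : FreeGroup ℕ, j < m → w j = u * of (k j) * u⁻¹ ∧
      (∀ x ∈ u.toWord.getLast?, x.1 ≠ k j) ∧ (w j).norm = 2 * u.norm + 1 := by
    intro j
    by_cases hj : j < m
    · obtain ⟨u, hu⟩ := exists_reduced_conj (hw j hj)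
      exact ⟨u, fun _ => hu⟩
    · exact ⟨1, fun h => absurd h hj⟩
  choose u hu using hex
  have hconj : ∀ g x : FreeGroup ℕ, ∀ a : ℕ, x = g * of a * g⁻¹ → x.norm ≤ 2 * g.norm + 1 := by
    rintro g _ a rfl
    have h1 := FreeGroup.norm_mul_le (g * of a) g⁻¹
    have h2 := FreeGroup.norm_mul_le g (of a)
    rw [FreeGroup.norm_inv_eq] at h1
    rw [FreeGroup.norm_of] at h2
    omega
  have hhead : ∀ i, i + 1 < m → ∀ x ∈ ((u i)⁻¹ * u (i + 1)).toWord.head?, x ≠ (k i, false) := by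
    rintro i hi x hx rfl
    have hlt := norm_lt_of_head (hu i (by omega)).2.1 hx
    have e1 := h1 i hi
    have e2 := hconj (u i * FreeGroup.mk [(k i, !false)] * (u i)⁻¹ * u (i + 1))
      (w i * w (i + 1) * (w i)⁻¹) (k (i + 1)) (by
      rw [(hu i (by omega)).1, (hu (i + 1) hi).1]
      have e0 : FreeGroup.mk [(k i, !false)] = of (k i) := rfl
      rw [e0]
      group)
    rw [(hu (i + 1) hi).2.2] at e1
    exact absurd (e1.trans e2) (by omega)
  have hlast : ∀ i, i + 1 < m → ∀ x ∈ ((u i)⁻¹ * u (i + 1)).toWord.getLast?,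
      x ≠ (k (i + 1), false) := by
    rintro i hi x hx rfl
    have hx' : (k (i + 1), true) ∈ ((u (i + 1))⁻¹ * u i).toWord.head? := by
      have : (u (i + 1))⁻¹ * u i = ((u i)⁻¹ * u (i + 1))⁻¹ := by group
      rw [this, FreeGroup.toWord_inv, FreeGroup.invRev, List.head?_reverse, List.getLast?_map]
      rw [Option.mem_def] at hx ⊢
      rw [hx]
      rfl
    have hlt := norm_lt_of_head (hu (i + 1) hi).2.1 hx'
    have e1 := h2 i hi
    have e0 : FreeGroup.mk [(k (i + 1), !true)] = (of (k (i + 1)))⁻¹ := by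
      simp [of, FreeGroup.inv_mk, FreeGroup.invRev]
    have e2 := hconj (u (i + 1) * FreeGroup.mk [(k (i + 1), !true)] * (u (i + 1))⁻¹ * u i)
      ((w (i + 1))⁻¹ * w i * w (i + 1)) (k i) (by
      rw [(hu i (by omega)).1, (hu (i + 1) hi).1, e0]
      group)
    rw [(hu i (by omega)).2.2] at e1
    exact absurd (e1.trans e2) (by omega)
  -- lengths of the partial products
  have hQ : ∀ j, j < m →
      (lift w (yy j) * u j * of (k j)).toWord.getLast? = some (k j, true) ∧
      (lift w (yy j) * u j * of (k j)).norm =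
        j + 1 + (u 0).norm + ∑ i ∈ Finset.range j, ((u i)⁻¹ * u (i + 1)).norm := by
    intro j hj
    induction j with
    | zero =>
      have e1 : (u 0 * of (k 0)).toWord = (u 0).toWord ++ (of (k 0)).toWord :=
        toWord_mul_of_isReduced (isReduced_append FreeGroup.isReduced_toWord
          FreeGroup.isReduced_toWord (by
            intro x hx y hy
            simp only [FreeGroup.toWord_of, List.head?_cons, Option.mem_def,
              Option.some.injEq] at hy
            rw [← hy]
            exact (hu 0 hj).2.1 x hx))
      simp only [yy_zero, map_one, one_mul, FreeGroup.norm, e1]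
      simp [add_comm]
    | succ j ih =>
      obtain ⟨ih1, ih2⟩ := ih (by omega)
      have e0 : lift w (yy (j + 1)) * u (j + 1) =
          lift w (yy j) * u j * of (k j) * ((u j)⁻¹ * u (j + 1)) := by
        rw [yy_succ, map_mul, FreeGroup.lift_apply_of, (hu j (by omega)).1]
        group
      have hlastP := hlast j hj
      have hheadP := hhead j hj
      have hsumP := Finset.sum_range_succ (fun i => ((u i)⁻¹ * u (i + 1)).norm) j
      generalize lift w (yy j) * u j * of (k j) = Q at *
      generalize (u j)⁻¹ * u (j + 1) = P at *
      have hred1 : FreeGroup.IsReduced (P.toWord ++ [(k (j + 1), true)]) := by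
        unfold FreeGroup.IsReduced
        rw [List.isChain_append]
        refine ⟨FreeGroup.isReduced_toWord, by simp, fun x hx y hy e => ?_⟩
        simp only [List.head?_cons, Option.mem_def, Option.some.injEq] at hy
        subst hy
        by_contra hb
        refine hlastP x hx (Prod.ext e ?_)
        simpa using hb
      have hred2 : FreeGroup.IsReduced (Q.toWord ++ (P.toWord ++ [(k (j + 1), true)])) := by
        unfold FreeGroup.IsReduced
        rw [List.isChain_append]
        refine ⟨FreeGroup.isReduced_toWord, hred1, fun x hx y hy e => ?_⟩
        rw [ih1] at hx
        simp only [Option.mem_def, Option.some.injEq] at hx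
        subst hx
        rcases hP : P.toWord with _ | ⟨p, L⟩
        · rw [hP] at hy
          simp only [List.nil_append, List.head?_cons, Option.mem_def, Option.some.injEq] at hy
          rw [← hy]
        · rw [hP] at hy
          simp only [List.cons_append, List.head?_cons, Option.mem_def, Option.some.injEq] at hy
          subst hy
          by_contra hb
          refine hheadP p (by rw [hP]; rfl) (Prod.ext e.symm ?_)
          rcases h : p.2 with _ | _
          · rfl
          · simp [h] at hb
      have e1 : (lift w (yy (j + 1)) * u (j + 1) * of (k (j + 1))).toWord =
          Q.toWord ++ (P.toWord ++ [(k (j + 1), true)]) := by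
        rw [e0, mul_assoc, FreeGroup.toWord_mul, FreeGroup.toWord_mul, FreeGroup.toWord_of,
          hred1.reduce_eq, hred2.reduce_eq]
      refine ⟨?_, ?_⟩
      · rw [e1]
        simp
      · rw [FreeGroup.norm, e1, hsumP]
        have : Q.toWord.length = Q.norm := rfl
        have h3 : P.toWord.length = P.norm := rfl
        simp only [List.length_append, List.length_singleton, this, h3, ih2]
        ring
  rcases Nat.eq_zero_or_pos m with rfl | hm
  · intro j hj
    omega
  obtain ⟨l, rfl⟩ : ∃ l, m = l + 1 := ⟨m - 1, by omega⟩
  obtain ⟨hl1, hl2⟩ := hQ l (by omega)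
  have hfin : (yy (l + 1)).norm = (l + 1 + (u 0).norm +
      ∑ i ∈ Finset.range l, ((u i)⁻¹ * u (i + 1)).norm) + (u l).norm := by
    rw [← hl2, ← hprod]
    have e0 : lift w (yy (l + 1)) = lift w (yy l) * u l * of (k l) * (u l)⁻¹ := by
      rw [yy_succ, map_mul, FreeGroup.lift_apply_of, (hu l (by omega)).1]
      group
    rw [e0, FreeGroup.norm, toWord_mul_of_isReduced]
    · rw [List.length_append]
      congr 1
      exact FreeGroup.norm_inv_eq
    · refine isReduced_append FreeGroup.isReduced_toWord FreeGroup.isReduced_toWord ?_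
      intro x hx y hy
      rw [hl1] at hx
      simp only [Option.mem_def, Option.some.injEq] at hx
      rw [← hx]
      rw [FreeGroup.toWord_inv, FreeGroup.invRev, List.head?_reverse, List.getLast?_map] at hy
      simp only [Option.mem_def, Option.map_eq_some_iff] at hy
      obtain ⟨z, hz, rfl⟩ := hy
      exact ((hu l (by omega)).2.1 z hz).symm
  have hlen : (yy (l + 1)).norm = l + 1 := by
    rw [FreeGroup.norm, toWord_yy]
    simp
  have hu0 : (u 0).norm = 0 := by omega
  have hsum : ∑ i ∈ Finset.range l, ((u i)⁻¹ * u (i + 1)).norm = 0 := by omega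
  rw [Finset.sum_eq_zero_iff] at hsum
  have hu1 : ∀ j < l + 1, u j = 1 := by
    intro j hj
    induction j with
    | zero => exact FreeGroup.norm_eq_zero.1 hu0
    | succ j ih =>
      have := FreeGroup.norm_eq_zero.1 (hsum j (Finset.mem_range.2 (by omega)))
      rw [ih (by omega)] at this
      simpa using this
  have hwk : ∀ j < l + 1, w j = of (k j) := by
    intro j hj
    rw [(hu j hj).1, hu1 j hj]
    simp
  have hyy : ∀ j ≤ l + 1, lift w (yy j) = lift (fun j => of (k j)) (yy j) := by
    intro j hj
    induction j with
    | zero => simp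
    | succ j ih =>
      rw [yy_succ, map_mul, map_mul, ih (by omega), FreeGroup.lift_apply_of,
        FreeGroup.lift_apply_of, hwk j (by omega)]
  have hk := eq_of_lift_yy ((hyy _ le_rfl).symm.trans hprod)
  intro j hj
  rw [hwk j hj, hk j hj]

theorem mem_FF_of_mem_closure_artin {m : ℕ} {β : MulAut (FreeGroup ℕ)}
    (hβ : β ∈ Subgroup.closure (artin '' {i | i + 1 < m})) {f : FreeGroup ℕ} (hf : f ∈ FF m) :
    β f ∈ FF m := by
  induction hβ using Subgroup.closure_induction'' generalizing f with
  | mem x hx =>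
    obtain ⟨i, hi, rfl⟩ := hx
    exact artin_mem_FF hi hf
  | inv_mem x hx =>
    obtain ⟨i, hi, rfl⟩ := hx
    exact artin_symm_mem_FF hi hf
  | one => exact hf
  | mul x y _ _ ihx ihy => exact ihx (ihy hf)

/-- **Artin's theorem**: a tuple of conjugates of letters whose product is `x_0 ⋯ x_{m-1}` is the
image of the standard tuple under a braid automorphism. -/
theorem exists_artin {m : ℕ} {w : ℕ → FreeGroup ℕ}
    (hw : ∀ j < m, ∃ k, IsConj (of k) (w j)) (hprod : lift w (yy m) = yy m) :
    ∃ β ∈ Subgroup.closure (artin '' {i | i + 1 < m}), ∀ j < m, β (of j) = w j := by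
  induction hN : ∑ j ∈ Finset.range m, (w j).norm using Nat.strong_induction_on
    generalizing w with
  | _ N ih =>
  subst hN
  by_cases hirr : (∀ i, i + 1 < m → (w (i + 1)).norm ≤ (w i * w (i + 1) * (w i)⁻¹).norm) ∧
      ∀ i, i + 1 < m → (w i).norm ≤ ((w (i + 1))⁻¹ * w i * w (i + 1)).norm
  · have hex : ∀ j, ∃ k, j < m → IsConj (of k) (w j) := by
      intro j
      by_cases hj : j < m
      · obtain ⟨k, hk⟩ := hw j hj
        exact ⟨k, fun _ => hk⟩
      · exact ⟨0, fun h => absurd h hj⟩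
    choose k hk using hex
    exact ⟨1, one_mem _, fun j hj => (eq_of_norm_le hk hprod hirr.1 hirr.2 j hj).symm⟩
  -- a braid move that shortens the tuple
  have hstep : ∀ i, i + 1 < m → ∀ α : MulAut (FreeGroup ℕ), (α = artin i ∨ α = (artin i)⁻¹) →
      (lift w (α (of i))).norm + (lift w (α (of (i + 1)))).norm <
        (w i).norm + (w (i + 1)).norm →
      ∃ β ∈ Subgroup.closure (artin '' {i | i + 1 < m}), ∀ j < m, β (of j) = w j := by
    intro i hi α hα hlt
    have hαm : α ∈ Subgroup.closure (artin '' {i | i + 1 < m}) := by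
      have : artin i ∈ Subgroup.closure (artin '' {i | i + 1 < m}) :=
        Subgroup.subset_closure ⟨i, hi, rfl⟩
      rcases hα with rfl | rfl
      · exact this
      · exact inv_mem this
    have hne : ∀ j, j ≠ i → j ≠ i + 1 → α (of j) = of j := by
      intro j h1 h2
      rcases hα with rfl | rfl
      · exact artin_of_ne h1 h2
      · rw [artin_symm_of, if_neg h1, if_neg h2]
    have hyy : α (yy m) = yy m := by
      have h1 : artin i (yy m) = yy m := artin_yy (by omega)
      rcases hα with rfl | rfl
      · exact h1
      · have := MulAut.inv_apply_self _ (artin i) (yy m)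
        rwa [h1] at this
    have hlift : ∀ f, lift (fun j => lift w (α (of j))) f = lift w (α f) := by
      intro f
      have : lift (fun j => lift w (α (of j))) = (lift w).comp α.toMonoidHom := by
        ext j
        simp
      rw [this]
      rfl
    have hα2 : ∀ j < m, ∃ k < m, IsConj (of k) (α (of j)) := by
      intro j hj
      by_cases h1 : j = i
      · subst h1
        rcases hα with rfl | rfl
        · exact ⟨j + 1, hi, by rw [artin_self]⟩
        · exact ⟨j + 1, hi, by
            rw [artin_symm_of, if_pos rfl]
            exact isConj_iff.2 ⟨_, rfl⟩⟩
      · by_cases h2 : j = i + 1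
        · subst h2
          rcases hα with rfl | rfl
          · exact ⟨i, by omega, by
              rw [artin_succ]
              exact isConj_iff.2 ⟨(of (i + 1))⁻¹, by group⟩⟩
          · exact ⟨i, by omega, by rw [artin_symm_of, if_neg h1, if_pos rfl]⟩
        · exact ⟨j, hj, by rw [hne j h1 h2]⟩
    suffices hs : ∃ β ∈ Subgroup.closure (artin '' {i | i + 1 < m}),
        ∀ j < m, β (of j) = lift w (α (of j)) by
      obtain ⟨β, hβ, hβw⟩ := hs
      refine ⟨β * α⁻¹, mul_mem hβ (inv_mem hαm), fun j hj => ?_⟩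
      have hkey : ∀ f ∈ FF m, β f = lift w (α f) := by
        intro f hf
        rw [← hlift]
        have : Set.EqOn β.toMonoidHom (lift fun j => lift w (α (of j)))
            (Subgroup.closure (of '' {j | j < m})) := by
          apply MonoidHom.eqOn_closure
          rintro _ ⟨l, hl, rfl⟩
          rw [FreeGroup.lift_apply_of]
          exact hβw l hl
        exact this hf
      rw [MulAut.mul_apply, hkey _ (mem_FF_of_mem_closure_artin (inv_mem hαm) (of_mem_FF hj)),
        MulAut.apply_inv_self, FreeGroup.lift_apply_of]
    refine ih _ ?_ (w := fun j => lift w (α (of j))) ?_ ?_ rfl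
    · have hsub : ({i, i + 1} : Finset ℕ) ⊆ Finset.range m := by
        intro j hj
        simp only [Finset.mem_insert, Finset.mem_singleton] at hj
        rw [Finset.mem_range]
        omega
      rw [← Finset.sum_sdiff hsub, ← Finset.sum_sdiff hsub (f := fun j => (w j).norm),
        Finset.sum_pair (by omega), Finset.sum_pair (by omega)]
      have : ∑ x ∈ Finset.range m \ {i, i + 1}, (lift w (α (of x))).norm =
          ∑ x ∈ Finset.range m \ {i, i + 1}, (w x).norm := by
        refine Finset.sum_congr rfl fun x hx => ?_
        simp only [Finset.mem_sdiff, Finset.mem_insert, Finset.mem_singleton, not_or] at hx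
        rw [hne x hx.2.1 hx.2.2, FreeGroup.lift_apply_of]
      omega
    · intro j hj
      obtain ⟨k, hk, hkj⟩ := hα2 j hj
      obtain ⟨k', hk'⟩ := hw k hk
      refine ⟨k', hk'.trans ?_⟩
      have := (lift w).map_isConj hkj
      rwa [FreeGroup.lift_apply_of] at this
    · rw [hlift, hyy, hprod]
  rw [not_and_or] at hirr
  rcases hirr with h | h
  · push Not at h
    obtain ⟨i, hi, hlt⟩ := h
    refine hstep i hi _ (Or.inr rfl) ?_
    rw [artin_symm_of, artin_symm_of, if_pos rfl, if_neg (by omega), if_pos rfl]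
    simp only [map_mul, map_inv, FreeGroup.lift_apply_of]
    omega
  · push Not at h
    obtain ⟨i, hi, hlt⟩ := h
    refine hstep i hi _ (Or.inl rfl) ?_
    rw [artin_self, artin_succ]
    simp only [map_mul, map_inv, FreeGroup.lift_apply_of]
    omega

/-- The generators of the braid group, extended by `1` outside the range. -/
def ss (n i : ℕ) : BraidGroup n := if h : i < n - 1 then braidσ n ⟨i, h⟩ else 1

theorem ss_of_lt {n i : ℕ} (h : i + 1 < n) : ss n i = braidσ n ⟨i, by omega⟩ :=
  dif_pos (by omega)

theorem ss_of_not_lt {n i : ℕ} (h : ¬ i + 1 < n) : ss n i = 1 := dif_neg (by omega)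

theorem ss_comm (n : ℕ) {i j : ℕ} (h : i + 2 ≤ j) : Commute (ss n i) (ss n j) := by
  by_cases hj : j + 1 < n
  · rw [ss_of_lt hj, ss_of_lt (show i + 1 < n by omega)]
    have : (PresentedGroup.mk (braidRels (n - 1))) (of (⟨i, by omega⟩ : Fin (n - 1)) *
        of (⟨j, by omega⟩ : Fin (n - 1)) * (of (⟨j, by omega⟩ : Fin (n - 1)) *
          of (⟨i, by omega⟩ : Fin (n - 1)))⁻¹) = 1 :=
      (PresentedGroup.mk_eq_one_iff).2
        (Subgroup.subset_normalClosure ⟨⟨i, by omega⟩, ⟨j, by omega⟩, Or.inr ⟨h, rfl⟩⟩)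
    rw [map_mul, map_inv, map_mul, map_mul] at this
    exact mul_inv_eq_one.1 this
  · rw [ss_of_not_lt hj]
    exact Commute.one_right _

theorem ss_braid {n i : ℕ} (h : i + 2 < n) :
    ss n i * ss n (i + 1) * ss n i = ss n (i + 1) * ss n i * ss n (i + 1) := by
  rw [ss_of_lt (show i + 1 < n by omega), ss_of_lt (show i + 1 + 1 < n by omega)]
  have : (PresentedGroup.mk (braidRels (n - 1))) (of (⟨i, by omega⟩ : Fin (n - 1)) *
      of (⟨i + 1, by omega⟩ : Fin (n - 1)) * of (⟨i, by omega⟩ : Fin (n - 1)) *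
      (of (⟨i + 1, by omega⟩ : Fin (n - 1)) * of (⟨i, by omega⟩ : Fin (n - 1)) *
        of (⟨i + 1, by omega⟩ : Fin (n - 1)))⁻¹) = 1 :=
    (PresentedGroup.mk_eq_one_iff).2 (Subgroup.subset_normalClosure
      ⟨⟨i, by omega⟩, ⟨i + 1, by omega⟩, Or.inl ⟨rfl, rfl⟩⟩)
  simp only [map_mul, map_inv] at this
  exact mul_inv_eq_one.1 this

/-- The subgroup of braids on the first `k` strands. -/
def HH (n k : ℕ) : Subgroup (BraidGroup n) := Subgroup.closure (ss n '' {i | i + 1 < k})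

theorem ss_mem_HH {n k i : ℕ} (h : i + 1 < k) : ss n i ∈ HH n k :=
  Subgroup.subset_closure ⟨i, h, rfl⟩

theorem HH_mono {n k l : ℕ} (h : k ≤ l) : HH n k ≤ HH n l :=
  Subgroup.closure_mono (Set.image_mono fun _ hi => lt_of_lt_of_le hi h)

theorem HH_self (n : ℕ) : HH n n = ⊤ := by
  rw [eq_top_iff, ← PresentedGroup.closure_range_of (braidRels (n - 1))]
  refine Subgroup.closure_mono ?_
  rintro _ ⟨⟨i, hi⟩, rfl⟩
  exact ⟨i, by change i + 1 < n; omega, dif_pos hi⟩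

theorem mem_HH_self {n : ℕ} (g : BraidGroup n) : g ∈ HH n n := by
  rw [HH_self]
  exact Subgroup.mem_top g

/-- Homomorphisms out of the braid group. -/
def braidLift {H : Type*} [Group H] (n : ℕ) (f : ℕ → H)
    (hb : ∀ i, f i * f (i + 1) * f i = f (i + 1) * f i * f (i + 1))
    (hc : ∀ i j, i + 2 ≤ j → f i * f j = f j * f i) : BraidGroup n →* H :=
  PresentedGroup.toGroup (rels := braidRels (n - 1)) (f := fun i : Fin (n - 1) => f i) (by
    rintro r ⟨i, j, ⟨hij, rfl⟩ | ⟨hij, rfl⟩⟩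
    · simp only [map_mul, map_inv, FreeGroup.lift_apply_of, ← hij, hb]
      group
    · simp only [map_mul, map_inv, FreeGroup.lift_apply_of, hc _ _ hij]
      group)

theorem braidLift_ss {H : Type*} [Group H] {n : ℕ} {f : ℕ → H}
    (hb : ∀ i, f i * f (i + 1) * f i = f (i + 1) * f i * f (i + 1))
    (hc : ∀ i j, i + 2 ≤ j → f i * f j = f j * f i) {i : ℕ} (hi : i + 1 < n) :
    braidLift n f hb hc (ss n i) = f i := by
  rw [ss_of_lt hi]
  exact PresentedGroup.toGroup.of _

theorem braid_induction {n : ℕ} {p : BraidGroup n → Prop} (one : p 1)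
    (gen : ∀ i, i + 1 < n → p (ss n i)) (mul : ∀ g h, p g → p h → p (g * h))
    (inv : ∀ g, p g → p g⁻¹) (g : BraidGroup n) : p g := by
  have hg := mem_HH_self g
  induction hg using Subgroup.closure_induction with
  | mem x hx =>
    obtain ⟨i, hi, rfl⟩ := hx
    exact gen i hi
  | one => exact one
  | mul x y _ _ hx hy => exact mul x y hx hy
  | inv x _ hx => exact inv x hx

theorem mulAut_ext {φ ψ : MulAut (FreeGroup ℕ)} (h : ∀ k, φ (of k) = ψ (of k)) : φ = ψ := by
  have : φ.toMonoidHom = ψ.toMonoidHom := by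
    ext k
    exact h k
  ext f
  exact DFunLike.congr_fun this f

theorem artin_braid (i : ℕ) :
    artin i * artin (i + 1) * artin i = artin (i + 1) * artin i * artin (i + 1) := by
  refine mulAut_ext fun k => ?_
  simp only [MulAut.mul_apply]
  by_cases h0 : k = i
  · subst h0
    have a1 : k + 1 + 1 ≠ k := by omega
    simp [artin_of, a1, a1.symm]
  by_cases h1 : k = i + 1
  · subst h1
    have a1 : i + 1 + 1 ≠ i := by omega
    have a2 : i ≠ i + 1 + 1 := by omega
    simp [artin_of, mul_assoc, a1, a2]
  by_cases h2 : k = i + 1 + 1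
  · subst h2
    have a1 : i + 1 + 1 ≠ i := by omega
    have a2 : i ≠ i + 1 + 1 := by omega
    simp [artin_of, mul_assoc, a1, a2]
  simp [artin_of, h0, h1, h2]

theorem artin_comm {i j : ℕ} (h : i + 2 ≤ j) : artin i * artin j = artin j * artin i := by
  refine mulAut_ext fun k => ?_
  simp only [MulAut.mul_apply]
  have a1 : i ≠ j := by omega
  have a2 : i ≠ j + 1 := by omega
  have a3 : i + 1 ≠ j := by omega
  by_cases h0 : k = i
  · subst h0
    simp [artin_of, a1, a2, a3]
  by_cases h1 : k = i + 1
  · subst h1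
    simp [artin_of, a1, a2, a3]
  by_cases h2 : k = j
  · subst h2
    simp [artin_of, a1.symm, a2.symm, a3.symm]
  by_cases h3 : k = j + 1
  · subst h3
    simp [artin_of, a1.symm, a2.symm, a3.symm]
  simp [artin_of, h0, h1, h2, h3]

/-- The Artin representation. -/
def rho (n : ℕ) : BraidGroup n →* MulAut (FreeGroup ℕ) :=
  braidLift n artin artin_braid fun _ _ h => artin_comm h

theorem rho_ss {n i : ℕ} (h : i + 1 < n) : rho n (ss n i) = artin i := braidLift_ss _ _ h

/-- The underlying permutation of a braid. -/
def pp (n : ℕ) : BraidGroup n →* Equiv.Perm ℕ :=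
  braidLift n (fun i => Equiv.swap i (i + 1))
    (by
      intro i
      ext x
      simp only [Equiv.Perm.mul_apply, Equiv.swap_apply_def]
      split_ifs <;> omega)
    (by
      intro i j h
      ext x
      simp only [Equiv.Perm.mul_apply, Equiv.swap_apply_def]
      split_ifs <;> omega)

theorem pp_ss {n i : ℕ} (h : i + 1 < n) : pp n (ss n i) = Equiv.swap i (i + 1) :=
  braidLift_ss _ _ h

/-- The exponent sum, multiplicatively. -/
def exM (n : ℕ) : BraidGroup n →* Multiplicative ℤ :=
  braidLift n (fun _ => Multiplicative.ofAdd 1) (fun _ => rfl) (fun _ _ _ => rfl)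

/-- The exponent sum. -/
def ex {n : ℕ} (g : BraidGroup n) : ℤ := (exM n g).toAdd

theorem ex_ss {n i : ℕ} (h : i + 1 < n) : ex (ss n i) = 1 := by
  rw [ex, exM, braidLift_ss _ _ h]
  rfl

@[simp] theorem ex_one {n : ℕ} : ex (1 : BraidGroup n) = 0 := by simp [ex]

@[simp] theorem ex_mul {n : ℕ} (g h : BraidGroup n) : ex (g * h) = ex g + ex h := by simp [ex]

@[simp] theorem ex_inv {n : ℕ} (g : BraidGroup n) : ex g⁻¹ = - ex g := by simp [ex]

@[simp] theorem ex_pow {n : ℕ} (g : BraidGroup n) (k : ℕ) : ex (g ^ k) = k * ex g := by simp [ex]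

@[simp] theorem ex_zpow {n : ℕ} (g : BraidGroup n) (k : ℤ) : ex (g ^ k) = k * ex g := by simp [ex]

theorem pp_of_le {n : ℕ} (g : BraidGroup n) {a : ℕ} (h : n ≤ a) : pp n g a = a := by
  induction g using braid_induction with
  | one => simp
  | gen i hi =>
    rw [pp_ss hi]
    exact Equiv.swap_apply_of_ne_of_ne (by omega) (by omega)
  | mul g g' hg hg' => rw [map_mul, Equiv.Perm.mul_apply, hg', hg]
  | inv g hg =>
    rw [map_inv, Equiv.Perm.inv_eq_iff_eq]
    exact hg.symm

theorem pp_lt {n : ℕ} (g : BraidGroup n) {a : ℕ} (h : a < n) : pp n g a < n := by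
  by_contra hlt
  have h1 := pp_of_le g (not_lt.1 hlt)
  have := (pp n g).injective h1
  omega

theorem rho_of_isConj {n : ℕ} (g : BraidGroup n) (j : ℕ) :
    IsConj (of (pp n g j)) (rho n g (of j)) := by
  induction g using braid_induction generalizing j with
  | one => exact IsConj.refl _
  | gen i hi =>
    rw [pp_ss hi, rho_ss hi, artin_of]
    split_ifs with h h'
    · rw [h, Equiv.swap_apply_left]
    · rw [h', Equiv.swap_apply_right]
      exact isConj_iff.2 ⟨(of (i + 1))⁻¹, by group⟩
    · rw [Equiv.swap_apply_of_ne_of_ne h h']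
  | mul g g' hg hg' =>
    rw [map_mul, map_mul, Equiv.Perm.mul_apply, MulAut.mul_apply]
    exact (hg _).trans ((rho n g).toMonoidHom.map_isConj (hg' j))
  | inv g hg =>
    have h1 := hg ((pp n g)⁻¹ j)
    rw [show pp n g ((pp n g)⁻¹ j) = j from (pp n g).apply_symm_apply j] at h1
    have h2 := ((rho n g)⁻¹).toMonoidHom.map_isConj h1
    rw [map_inv, map_inv]
    have h3 : ((rho n g)⁻¹).toMonoidHom (rho n g (of ((pp n g)⁻¹ j))) = of ((pp n g)⁻¹ j) :=
      MulAut.inv_apply_self _ _ _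
    rw [h3] at h2
    exact h2.symm

/-- The crossing number of the strands starting at `a` and `b` in the `i`-th generator. -/
def cx (i a b : ℕ) : ℤ := if (a = i ∧ b = i + 1) ∨ (a = i + 1 ∧ b = i) then 1 else 0

/-- The elementary crossing permutation. -/
def crossStep (i : ℕ) : Equiv.Perm ((ℕ × ℕ) × ℤ) where
  toFun p := ((Equiv.swap i (i + 1) p.1.1, Equiv.swap i (i + 1) p.1.2), p.2 + cx i p.1.1 p.1.2)
  invFun p := ((Equiv.swap i (i + 1) p.1.1, Equiv.swap i (i + 1) p.1.2), p.2 - cx i p.1.1 p.1.2)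
  left_inv := by
    rintro ⟨⟨a, b⟩, t⟩
    simp only [Equiv.swap_apply_def, Prod.mk.injEq, cx]
    split_ifs <;> simp <;> omega
  right_inv := by
    rintro ⟨⟨a, b⟩, t⟩
    simp only [Equiv.swap_apply_def, Prod.mk.injEq, cx]
    split_ifs <;> simp <;> omega

theorem crossStep_apply (i a b : ℕ) (t : ℤ) : crossStep i ((a, b), t) =
    ((Equiv.swap i (i + 1) a, Equiv.swap i (i + 1) b), t + cx i a b) := rfl

theorem swap_comm {i j : ℕ} (h : i + 2 ≤ j) (x : ℕ) :
    Equiv.swap i (i + 1) (Equiv.swap j (j + 1) x) =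
      Equiv.swap j (j + 1) (Equiv.swap i (i + 1) x) := by
  simp only [Equiv.swap_apply_def]
  split_ifs <;> omega

theorem swap_braid (i x : ℕ) :
    Equiv.swap i (i + 1) (Equiv.swap (i + 1) (i + 1 + 1) (Equiv.swap i (i + 1) x)) =
      Equiv.swap (i + 1) (i + 1 + 1) (Equiv.swap i (i + 1)
        (Equiv.swap (i + 1) (i + 1 + 1) x)) := by
  simp only [Equiv.swap_apply_def]
  split_ifs <;> omega

theorem swap_eq_iff {i j x : ℕ} : Equiv.swap i (i + 1) x = j ↔ x = Equiv.swap i (i + 1) j := by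
  rw [← Equiv.symm_apply_eq, Equiv.symm_swap, eq_comm]

theorem crossStep_comm {i j : ℕ} (h : i + 2 ≤ j) :
    crossStep i * crossStep j = crossStep j * crossStep i := by
  refine Equiv.ext ?_
  rintro ⟨⟨a, b⟩, t⟩
  rw [Equiv.Perm.mul_apply, Equiv.Perm.mul_apply]
  simp only [crossStep_apply]
  have e1 : Equiv.swap j (j + 1) i = i := Equiv.swap_apply_of_ne_of_ne (by omega) (by omega)
  have e2 : Equiv.swap j (j + 1) (i + 1) = i + 1 :=
    Equiv.swap_apply_of_ne_of_ne (by omega) (by omega)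
  have e3 : Equiv.swap i (i + 1) j = j := Equiv.swap_apply_of_ne_of_ne (by omega) (by omega)
  have e4 : Equiv.swap i (i + 1) (j + 1) = j + 1 :=
    Equiv.swap_apply_of_ne_of_ne (by omega) (by omega)
  simp only [cx, swap_eq_iff, e1, e2, e3, e4, swap_comm h]
  rw [add_right_comm]

theorem crossStep_braid (i : ℕ) :
    crossStep i * crossStep (i + 1) * crossStep i =
      crossStep (i + 1) * crossStep i * crossStep (i + 1) := by
  refine Equiv.ext ?_
  rintro ⟨⟨a, b⟩, t⟩
  simp only [Equiv.Perm.mul_apply, crossStep_apply, swap_braid]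
  have e1 : Equiv.swap i (i + 1) (i + 1 + 1) = i + 1 + 1 :=
    Equiv.swap_apply_of_ne_of_ne (by omega) (by omega)
  have e2 : Equiv.swap (i + 1) (i + 1 + 1) i = i :=
    Equiv.swap_apply_of_ne_of_ne (by omega) (by omega)
  simp only [cx, swap_eq_iff, e1, e2, Equiv.swap_apply_left, Equiv.swap_apply_right]
  congr 1
  split_ifs <;> omega

/-- The crossing homomorphism. -/
def kap (n : ℕ) : BraidGroup n →* Equiv.Perm ((ℕ × ℕ) × ℤ) :=
  braidLift n crossStep crossStep_braid fun _ _ h => crossStep_comm h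

/-- The signed number of crossings between the strands starting at `a` and `b`. -/
def cr {n : ℕ} (a b : ℕ) (g : BraidGroup n) : ℤ := (kap n g ((a, b), 0)).2

theorem kap_apply {n : ℕ} (g : BraidGroup n) (a b : ℕ) (t : ℤ) :
    kap n g ((a, b), t) = ((pp n g a, pp n g b), t + cr a b g) := by
  suffices H : ∃ c : ℤ, ∀ t, kap n g ((a, b), t) = ((pp n g a, pp n g b), t + c) by
    obtain ⟨c, hc⟩ := H
    rw [hc, cr, hc]
    simp
  induction g using braid_induction generalizing a b with
  | one => exact ⟨0, by simp⟩
  | gen i hi =>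
    refine ⟨cx i a b, fun t => ?_⟩
    rw [kap, braidLift_ss _ _ hi, pp_ss hi, crossStep_apply]
  | mul g g' hg hg' =>
    obtain ⟨c', hc'⟩ := hg' a b
    obtain ⟨c, hc⟩ := hg (pp n g' a) (pp n g' b)
    refine ⟨c' + c, fun t => ?_⟩
    rw [map_mul, map_mul, Equiv.Perm.mul_apply, hc', hc, Equiv.Perm.mul_apply,
      Equiv.Perm.mul_apply, add_assoc]
  | inv g hg =>
    obtain ⟨c, hc⟩ := hg ((pp n g)⁻¹ a) ((pp n g)⁻¹ b)
    refine ⟨-c, fun t => ?_⟩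
    rw [map_inv, map_inv, Equiv.Perm.inv_eq_iff_eq, hc]
    have h (x : ℕ) : pp n g ((pp n g)⁻¹ x) = x := (pp n g).apply_symm_apply x
    rw [h, h, neg_add_cancel_right]

theorem cr_mul {n : ℕ} (a b : ℕ) (g h : BraidGroup n) :
    cr a b (g * h) = cr a b h + cr (pp n h a) (pp n h b) g := by
  rw [cr, map_mul, Equiv.Perm.mul_apply, kap_apply, kap_apply]
  simp

@[simp] theorem cr_one {n : ℕ} (a b : ℕ) : cr a b (1 : BraidGroup n) = 0 := by simp [cr]

theorem cr_inv {n : ℕ} (a b : ℕ) (g : BraidGroup n) :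
    cr a b g⁻¹ = - cr (pp n g⁻¹ a) (pp n g⁻¹ b) g := by
  have := cr_mul a b g g⁻¹
  rw [mul_inv_cancel, cr_one] at this
  omega

theorem cr_ss {n i : ℕ} (h : i + 1 < n) (a b : ℕ) : cr a b (ss n i) = cx i a b := by
  rw [cr, kap, braidLift_ss _ _ h, crossStep_apply]
  simp

theorem cr_symm {n : ℕ} (a b : ℕ) (g : BraidGroup n) : cr a b g = cr b a g := by
  induction g using braid_induction generalizing a b with
  | one => simp
  | gen i hi =>
    rw [cr_ss hi, cr_ss hi, cx, cx]
    split_ifs <;> omega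
  | mul g g' hg hg' => rw [cr_mul, cr_mul, hg, hg']
  | inv g hg => rw [cr_inv, cr_inv, hg]

theorem cr_self {n : ℕ} (a : ℕ) (g : BraidGroup n) : cr a a g = 0 := by
  induction g using braid_induction generalizing a with
  | one => simp
  | gen i hi =>
    rw [cr_ss hi, cx]
    split_ifs <;> omega
  | mul g g' hg hg' => rw [cr_mul, hg, hg', add_zero]
  | inv g hg => rw [cr_inv, hg, neg_zero]

theorem even_cr_iff {n : ℕ} {a b : ℕ} (hab : a ≠ b) (g : BraidGroup n) :
    Even (cr a b g) ↔ (a < b ↔ pp n g a < pp n g b) := by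
  induction g using braid_induction generalizing a b with
  | one => simp
  | gen i hi =>
    rw [cr_ss hi, cx, pp_ss hi]
    simp only [Equiv.swap_apply_def]
    split_ifs <;> simp <;> omega
  | mul g g' hg hg' =>
    have h : pp n g' a ≠ pp n g' b := fun e => hab ((pp n g').injective e)
    rw [cr_mul, Int.even_add, hg' hab, hg h, map_mul, Equiv.Perm.mul_apply,
      Equiv.Perm.mul_apply]
    tauto
  | inv g hg =>
    have h : pp n g⁻¹ a ≠ pp n g⁻¹ b := fun e => hab ((pp n g⁻¹).injective e)
    rw [cr_inv, even_neg, hg h]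
    have h1 (x : ℕ) : pp n g (pp n g⁻¹ x) = x := by
      rw [map_inv]
      exact (pp n g).apply_symm_apply x
    rw [h1, h1]
    exact iff_comm

theorem even_cr {n : ℕ} {g : BraidGroup n} (hg : pp n g = 1) (a b : ℕ) : Even (cr a b g) := by
  by_cases hab : a = b
  · rw [hab, cr_self]
    exact Even.zero
  · simp [even_cr_iff hab, hg]

theorem sum_pp {n : ℕ} (g : BraidGroup n) (f : ℕ → ℤ) :
    ∑ a ∈ Finset.range n, f (pp n g a) = ∑ a ∈ Finset.range n, f a := by
  refine Equiv.Perm.sum_comp _ _ f fun a ha => ?_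
  by_contra h
  exact ha (pp_of_le g (by simpa using h))

theorem sum_cr {n : ℕ} (g : BraidGroup n) :
    ∑ a ∈ Finset.range n, ∑ b ∈ Finset.range n, cr a b g = 2 * ex g := by
  have key (g h : BraidGroup n) :
      ∑ a ∈ Finset.range n, ∑ b ∈ Finset.range n, cr (pp n h a) (pp n h b) g =
        ∑ a ∈ Finset.range n, ∑ b ∈ Finset.range n, cr a b g := by
    rw [sum_pp h fun a => ∑ b ∈ Finset.range n, cr a (pp n h b) g]
    exact Finset.sum_congr rfl fun a _ => sum_pp h fun b => cr a b g
  induction g using braid_induction with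
  | one => simp
  | gen i hi =>
    have h (a b : ℕ) : cx i a b = (if a = i then if b = i + 1 then 1 else 0 else 0) +
        (if a = i + 1 then if b = i then 1 else 0 else 0) := by
      rw [cx]
      split_ifs <;> omega
    have h1 : i < n := by omega
    simp only [cr_ss hi, ex_ss hi, h, Finset.sum_add_distrib]
    simp [h1, hi]
  | mul g g' hg hg' =>
    simp only [cr_mul, Finset.sum_add_distrib, key, hg, hg', ex_mul]
    ring
  | inv g hg => simp only [cr_inv, Finset.sum_neg_distrib, key, hg, ex_inv, mul_neg]

theorem HH_induction {n k : ℕ} (hk : k ≤ n) {p : (g : BraidGroup n) → g ∈ HH n k → Prop}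
    (one : p 1 (one_mem _)) (gen : ∀ i, (hi : i + 1 < k) → i + 1 < n → p (ss n i) (ss_mem_HH hi))
    (mul : ∀ g h hg hh, p g hg → p h hh → p (g * h) (mul_mem hg hh))
    (inv : ∀ g hg, p g hg → p g⁻¹ (inv_mem hg)) {g : BraidGroup n} (hg : g ∈ HH n k) : p g hg := by
  induction hg using Subgroup.closure_induction with
  | mem x hx =>
    obtain ⟨i, hi, rfl⟩ := hx
    exact gen i hi (lt_of_lt_of_le hi hk)
  | one => exact one
  | mul x y _ _ hx hy => exact mul x y _ _ hx hy
  | inv x _ hx => exact inv x _ hx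

theorem ss_commute_HH {n k : ℕ} (hk : k ≤ n) {h : BraidGroup n} (hh : h ∈ HH n k) :
    Commute (ss n k) h := by
  induction hh using HH_induction hk with
  | one => exact Commute.one_right _
  | gen i hi => exact (ss_comm n (by omega)).symm
  | mul g h _ _ hg hh => exact hg.mul_right hh
  | inv g _ hg => exact hg.inv_right

/-- The pure braid generator linking the strands `j` and `k`. -/
def AA (n j : ℕ) : ℕ → BraidGroup n
  | 0 => 1
  | k + 1 => if j < k then ss n k * AA n j k * (ss n k)⁻¹ else if j = k then ss n k ^ 2 else 1

theorem AA_succ_of_lt {n j k : ℕ} (h : j < k) :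
    AA n j (k + 1) = ss n k * AA n j k * (ss n k)⁻¹ := by
  rw [AA, if_pos h]

theorem AA_self_succ (n k : ℕ) : AA n k (k + 1) = ss n k ^ 2 := by
  rw [AA, if_neg (lt_irrefl k), if_pos rfl]

theorem AA_of_le {n j k : ℕ} (h : k ≤ j) : AA n j k = 1 := by
  cases k with
  | zero => rfl
  | succ k => rw [AA, if_neg (by omega), if_neg (by omega)]

theorem AA_mem_HH (n j k : ℕ) : AA n j k ∈ HH n (k + 1) := by
  induction k with
  | zero => exact one_mem _
  | succ k ih =>
    have h1 : ss n k ∈ HH n (k + 1 + 1) := ss_mem_HH (by omega)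
    have h2 := HH_mono (show k + 1 ≤ k + 1 + 1 by omega) ih
    rw [AA]
    split_ifs
    · exact mul_mem (mul_mem h1 h2) (inv_mem h1)
    · exact pow_mem h1 2
    · exact one_mem _

theorem pp_AA (n j k : ℕ) : pp n (AA n j k) = 1 := by
  induction k with
  | zero => exact map_one _
  | succ k ih =>
    rw [AA]
    split_ifs
    · rw [map_mul, map_mul, ih, mul_one, ← map_mul, mul_inv_cancel, map_one]
    · by_cases h : k + 1 < n
      · rw [map_pow, pp_ss h, pow_two, Equiv.swap_mul_self]
      · rw [ss_of_not_lt h, one_pow, map_one]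
    · exact map_one _

theorem conj_sq_of_braid {G : Type*} [Group G] {a b : G} (h : a * b * a = b * a * b) :
    a * (b * a ^ 2 * b⁻¹) * a⁻¹ = b ^ 2 := by
  calc a * (b * a ^ 2 * b⁻¹) * a⁻¹ = (a * b * a) * (a * b⁻¹ * a⁻¹) := by rw [pow_two]; group
    _ = b * (a * b * a) * b⁻¹ * a⁻¹ := by nth_rw 1 [h]; group
    _ = b * (b * a * b) * b⁻¹ * a⁻¹ := by rw [h]
    _ = b ^ 2 := by rw [pow_two]; group

theorem conj_AA_self {n i k : ℕ} (hk : k < n) (hi : i + 1 < k) :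
    ss n i * AA n i k * (ss n i)⁻¹ = AA n (i + 1) k := by
  induction k with
  | zero => omega
  | succ k ih =>
    rcases Nat.lt_or_ge (i + 1) k with h | h
    · rw [AA_succ_of_lt (by omega), AA_succ_of_lt h, ← ih (by omega) h]
      have := ss_comm n (show i + 2 ≤ k by omega)
      have e : ss n i * ss n k = ss n k * ss n i := this
      have e' : (ss n k)⁻¹ * (ss n i)⁻¹ = (ss n i)⁻¹ * (ss n k)⁻¹ := this.inv_inv.symm
      calc _ = (ss n i * ss n k) * AA n i k * ((ss n k)⁻¹ * (ss n i)⁻¹) := by group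
        _ = _ := by rw [e, e']; group
    · obtain rfl : k = i + 1 := by omega
      rw [AA_succ_of_lt (by omega), AA_self_succ, AA_self_succ]
      exact conj_sq_of_braid (ss_braid (by omega))

theorem conj_AA_succ {n i k : ℕ} (hk : k < n) (hi : i + 1 < k) :
    ss n i * AA n (i + 1) k * (ss n i)⁻¹ = (AA n (i + 1) k)⁻¹ * AA n i k * AA n (i + 1) k := by
  induction k with
  | zero => omega
  | succ k ih =>
    rcases Nat.lt_or_ge (i + 1) k with h | h
    · rw [AA_succ_of_lt (by omega), AA_succ_of_lt (by omega)]
      have ih := ih (by omega) h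
      have := ss_comm n (show i + 2 ≤ k by omega)
      have e : ss n i * ss n k = ss n k * ss n i := this
      have e' : (ss n k)⁻¹ * (ss n i)⁻¹ = (ss n i)⁻¹ * (ss n k)⁻¹ := this.inv_inv.symm
      calc _ = (ss n i * ss n k) * AA n (i + 1) k * ((ss n k)⁻¹ * (ss n i)⁻¹) := by group
        _ = ss n k * (ss n i * AA n (i + 1) k * (ss n i)⁻¹) * (ss n k)⁻¹ := by
          rw [e, e']; group
        _ = _ := by rw [ih]; group
    · obtain rfl : k = i + 1 := by omega
      rw [AA_succ_of_lt (show i < i + 1 by omega), AA_self_succ, AA_self_succ]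
      have h := ss_braid (show i + 2 < n by omega)
      have h1 := conj_sq_of_braid h.symm
      generalize ss n i = a at *
      generalize ss n (i + 1) = b at *
      calc a * b ^ 2 * a⁻¹ = b⁻¹ * (b * (a * b ^ 2 * a⁻¹) * b⁻¹) * b := by group
        _ = _ := by rw [h1]; group

theorem conj_AA_of_ne {n i j k : ℕ} (hk : k < n) (hi : i + 1 < k) (h0 : j ≠ i) (h1 : j ≠ i + 1) :
    ss n i * AA n j k * (ss n i)⁻¹ = AA n j k := by
  induction k with
  | zero => omega
  | succ k ih =>
    rcases Nat.lt_or_ge (i + 1) k with h | h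
    · have := ss_comm n (show i + 2 ≤ k by omega)
      rw [AA]
      split_ifs
      · have ih := ih (by omega) h
        have e : ss n i * ss n k = ss n k * ss n i := this
        have e' : (ss n k)⁻¹ * (ss n i)⁻¹ = (ss n i)⁻¹ * (ss n k)⁻¹ := this.inv_inv.symm
        calc _ = (ss n i * ss n k) * AA n j k * ((ss n k)⁻¹ * (ss n i)⁻¹) := by group
          _ = ss n k * (ss n i * AA n j k * (ss n i)⁻¹) * (ss n k)⁻¹ := by
            rw [e, e']; group
          _ = _ := by rw [ih]
      · rw [(this.pow_right 2).eq, mul_inv_cancel_right]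
      · simp
    · obtain rfl : k = i + 1 := by omega
      rcases Nat.lt_or_ge j i with hj | hj
      · rw [AA_succ_of_lt (by omega), AA_succ_of_lt hj]
        have h := ss_braid (show i + 2 < n by omega)
        have h2 := ss_commute_HH (show i + 1 ≤ n by omega) (AA_mem_HH n j i)
        generalize ss n i = a at *
        generalize ss n (i + 1) = b at *
        calc _ = (a * b * a) * AA n j i * (a * b * a)⁻¹ := by group
          _ = b * a * (b * AA n j i) * b⁻¹ * a⁻¹ * b⁻¹ := by rw [h]; group
          _ = _ := by rw [h2.eq]; group
      · rw [AA_of_le (by omega)]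
        simp

/-- The homomorphism onto the subgroup of braids moving only the strand `k` around the first
`k` strands. -/
def iot (n k : ℕ) : FreeGroup ℕ →* BraidGroup n := lift fun j => AA n j k

@[simp] theorem iot_of (n k j : ℕ) : iot n k (of j) = AA n j k := by simp [iot]

theorem iot_rr (n k : ℕ) (f : FreeGroup ℕ) : iot n k (rr k f) = iot n k f := by
  have : (iot n k).comp (rr k) = iot n k := by
    ext j
    simp only [MonoidHom.comp_apply, rr_of, iot_of]
    split_ifs with h
    · simp
    · rw [map_one, AA_of_le (by omega)]
  exact DFunLike.congr_fun this f

theorem pp_iot (n k : ℕ) (f : FreeGroup ℕ) : pp n (iot n k f) = 1 := by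
  have : (pp n).comp (iot n k) = 1 := by
    ext1 j
    simp [pp_AA]
  exact DFunLike.congr_fun this f

theorem iot_mem_HH (n k : ℕ) (f : FreeGroup ℕ) : iot n k f ∈ HH n (k + 1) := by
  induction f using FreeGroup.induction_on with
  | C1 => simp
  | of j => simpa using AA_mem_HH n j k
  | inv_of j h =>
    rw [map_inv]
    exact inv_mem h
  | mul f g hf hg =>
    rw [map_mul]
    exact mul_mem hf hg

theorem iot_artin {n i k : ℕ} (hk : k < n) (hi : i + 1 < k) (f : FreeGroup ℕ) :
    iot n k (artin i f) = ss n i * iot n k f * (ss n i)⁻¹ := by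
  have : (iot n k).comp (artin i).toMonoidHom =
      (MulAut.conj (ss n i)).toMonoidHom.comp (iot n k) := by
    ext1 j
    change iot n k (artin i (of j)) = MulAut.conj (ss n i) (iot n k (of j))
    rw [MulAut.conj_apply, iot_of, artin_of]
    split_ifs with h h'
    · rw [h, conj_AA_self hk hi, iot_of]
    · rw [h', conj_AA_succ hk hi]
      simp
    · rw [conj_AA_of_ne hk hi h h', iot_of]
  exact DFunLike.congr_fun this f

theorem iot_rho {n k : ℕ} (hk : k < n) {b : BraidGroup n} (hb : b ∈ HH n k) (f : FreeGroup ℕ) :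
    iot n k (rho n b f) = b * iot n k f * b⁻¹ := by
  induction hb using HH_induction hk.le generalizing f with
  | one => simp
  | gen i hi hi' => rw [rho_ss hi', iot_artin hk hi]
  | mul g h _ _ hg hh =>
    rw [map_mul, MulAut.mul_apply, hg, hh]
    group
  | inv g _ hg =>
    have := hg (rho n g⁻¹ f)
    rw [map_inv, MulAut.apply_inv_self] at this
    rw [this, map_inv]
    group

theorem rho_of_mem_HH {n k j : ℕ} (hk : k ≤ n) (hj : k ≤ j) {b : BraidGroup n}
    (hb : b ∈ HH n k) : rho n b (of j) = of j := by
  induction hb using HH_induction hk with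
  | one => simp
  | gen i hi hi' => rw [rho_ss hi', artin_of_ne (by omega) (by omega)]
  | mul g h _ _ hg hh => rw [map_mul, MulAut.mul_apply, hh, hg]
  | inv g _ hg =>
    rw [map_inv]
    nth_rw 1 [← hg]
    exact MulAut.inv_apply_self _ _ _

theorem rho_yy {n k j : ℕ} (hk : k ≤ n) (hj : k ≤ j) {b : BraidGroup n}
    (hb : b ∈ HH n k) : rho n b (yy j) = yy j := by
  induction hb using HH_induction hk with
  | one => simp
  | gen i hi hi' => rw [rho_ss hi', artin_yy (by omega)]
  | mul g h _ _ hg hh => rw [map_mul, MulAut.mul_apply, hh, hg]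
  | inv g _ hg =>
    rw [map_inv]
    nth_rw 1 [← hg]
    exact MulAut.inv_apply_self _ _ _

theorem rho_mem_FF {n k : ℕ} (hk : k ≤ n) {b : BraidGroup n} (hb : b ∈ HH n k)
    {f : FreeGroup ℕ} (hf : f ∈ FF k) : rho n b f ∈ FF k := by
  suffices H : (∀ f ∈ FF k, rho n b f ∈ FF k) ∧ ∀ f ∈ FF k, (rho n b)⁻¹ f ∈ FF k from H.1 f hf
  clear hf f
  induction hb using HH_induction hk with
  | one => simp
  | gen i hi hi' =>
    rw [rho_ss hi']
    exact ⟨fun f hf => artin_mem_FF hi hf, fun f hf => artin_symm_mem_FF hi hf⟩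
  | mul g h _ _ hg hh =>
    rw [map_mul, mul_inv_rev]
    exact ⟨fun f hf => hg.1 _ (hh.1 _ hf), fun f hf => hh.2 _ (hg.2 _ hf)⟩
  | inv g _ hg =>
    rw [map_inv, inv_inv]
    exact hg.symm

theorem rr_rho {n k : ℕ} (hk : k ≤ n) {b : BraidGroup n} (hb : b ∈ HH n k) (f : FreeGroup ℕ) :
    rr k (rho n b f) = rho n b (rr k f) := by
  have : (rr k).comp (rho n b).toMonoidHom = (rho n b).toMonoidHom.comp (rr k) := by
    ext1 j
    change rr k (rho n b (of j)) = rho n b (rr k (of j))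
    rw [rr_of]
    split_ifs with h
    · exact rr_eq_self (rho_mem_FF hk hb (of_mem_FF h))
    · rw [rho_of_mem_HH hk (not_lt.1 h) hb, rr_of, if_neg h, map_one]
  exact DFunLike.congr_fun this f

theorem pp_of_mem_HH {n k j : ℕ} (hk : k ≤ n) (hj : k ≤ j) {b : BraidGroup n}
    (hb : b ∈ HH n k) : pp n b j = j := by
  induction hb using HH_induction hk with
  | one => simp
  | gen i hi hi' =>
    rw [pp_ss hi']
    exact Equiv.swap_apply_of_ne_of_ne (by omega) (by omega)
  | mul g h _ _ hg hh => rw [map_mul, Equiv.Perm.mul_apply, hh, hg]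
  | inv g _ hg =>
    rw [map_inv, Equiv.Perm.inv_eq_iff_eq]
    exact hg.symm

/-- The descending product of the generators from `k - 1` to `j`. -/
def tt (n j : ℕ) : ℕ → BraidGroup n
  | 0 => 1
  | k + 1 => if j ≤ k then ss n k * tt n j k else 1

theorem tt_succ {n j k : ℕ} (h : j ≤ k) : tt n j (k + 1) = ss n k * tt n j k := by
  rw [tt, if_pos h]

theorem tt_of_le {n j k : ℕ} (h : k ≤ j) : tt n j k = 1 := by
  cases k with
  | zero => rfl
  | succ k => rw [tt, if_neg (by omega)]

theorem tt_eq {n j k : ℕ} (h : j < k) : tt n j k = tt n (j + 1) k * ss n j := by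
  induction k with
  | zero => omega
  | succ k ih =>
    rw [tt_succ (by omega)]
    rcases Nat.lt_or_ge j k with hj | hj
    · rw [ih hj, tt_succ hj, mul_assoc]
    · obtain rfl : j = k := by omega
      rw [tt_of_le le_rfl, tt_of_le le_rfl, mul_one, one_mul]

theorem tt_mem_HH (n j k : ℕ) : tt n j k ∈ HH n (k + 1) := by
  induction k with
  | zero => exact one_mem _
  | succ k ih =>
    rw [tt]
    split_ifs
    · exact mul_mem (ss_mem_HH (by omega)) (HH_mono (by omega) ih)
    · exact one_mem _

theorem AA_eq {n j k : ℕ} (h : j < k) :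
    AA n j k = tt n (j + 1) k * ss n j ^ 2 * (tt n (j + 1) k)⁻¹ := by
  induction k with
  | zero => omega
  | succ k ih =>
    rcases Nat.lt_or_ge j k with hj | hj
    · rw [AA_succ_of_lt hj, ih hj, tt_succ hj]
      group
    · obtain rfl : j = k := by omega
      rw [AA_self_succ, tt_of_le le_rfl]
      group

theorem tt_commute {n i j k : ℕ} (h : i + 1 < j) : Commute (tt n j k) (ss n i) := by
  induction k with
  | zero => exact Commute.one_left _
  | succ k ih =>
    rw [tt]
    split_ifs
    · exact ((ss_comm n (by omega)).symm).mul_left ih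
    · exact Commute.one_left _

theorem tt_mul_ss {n i j k : ℕ} (hk : k < n) (h : j ≤ i) (hi : i + 1 < k) :
    tt n j k * ss n (i + 1) = ss n i * tt n j k := by
  induction k with
  | zero => omega
  | succ k ih =>
    rcases Nat.lt_or_ge (i + 1) k with h' | h'
    · rw [tt_succ (by omega), mul_assoc, ih (by omega) h', ← mul_assoc, ← mul_assoc,
        (ss_comm n (show i + 2 ≤ k by omega)).eq]
    · obtain rfl : k = i + 1 := by omega
      rw [tt_succ (by omega), tt_succ h]
      have h1 := ss_commute_HH (show i + 1 ≤ n by omega) (tt_mem_HH n j i)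
      have h2 := ss_braid (show i + 2 < n by omega)
      calc _ = ss n (i + 1) * ss n i * (tt n j i * ss n (i + 1)) := by group
        _ = ss n (i + 1) * ss n i * ss n (i + 1) * tt n j i := by rw [← h1.eq]; group
        _ = _ := by rw [← h2]; group

theorem tt_mul_ss_succ {n j k : ℕ} (h : j < k) :
    tt n (j + 1) k * (ss n j)⁻¹ = (AA n j k)⁻¹ * tt n j k := by
  rw [tt_eq h, AA_eq h]
  group

theorem tt_mul_ss_self {n j k : ℕ} (h : j < k) :
    tt n j k * ss n j = AA n j k * tt n (j + 1) k := by
  rw [tt_eq h, AA_eq h, pow_two]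
  group

theorem exists_decomp {n k : ℕ} (hk : k < n) {g : BraidGroup n} (hg : g ∈ HH n (k + 1)) :
    ∃ f ∈ FF k, ∃ h ∈ HH n k, ∃ j ≤ k, g = iot n k f * h * tt n j k := by
  suffices H : ∃ f, ∃ h ∈ HH n k, ∃ j ≤ k, g = iot n k f * h * tt n j k by
    obtain ⟨f, h, hh, j, hj, e⟩ := H
    exact ⟨rr k f, rr_mem k f, h, hh, j, hj, by rw [iot_rr, e]⟩
  have absorb {h f₁ f₂ : _} (hh : h ∈ HH n k) : iot n k f₁ * h * iot n k f₂ =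
      iot n k (f₁ * rho n h f₂) * h := by
    rw [map_mul, iot_rho hk hh]
    group
  have aux : ∀ (g : BraidGroup n) (i : ℕ), i < k →
      (∃ f, ∃ h ∈ HH n k, ∃ j ≤ k, g = iot n k f * h * tt n j k) →
      (∃ f, ∃ h ∈ HH n k, ∃ j ≤ k, g * ss n i = iot n k f * h * tt n j k) ∧
      ∃ f, ∃ h ∈ HH n k, ∃ j ≤ k, g * (ss n i)⁻¹ = iot n k f * h * tt n j k := by
    rintro g i hi ⟨f, h, hh, j, hj, rfl⟩
    rcases lt_trichotomy (i + 1) j with h1 | h1 | h1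
    · have e := tt_commute (n := n) (k := k) h1
      have hs : ss n i ∈ HH n k := ss_mem_HH (by omega)
      exact ⟨⟨f, h * ss n i, mul_mem hh hs, j, hj, by simp only [mul_assoc, e.eq]⟩,
        ⟨f, h * (ss n i)⁻¹, mul_mem hh (inv_mem hs), j, hj,
          by simp only [mul_assoc, e.inv_right.eq]⟩⟩
    · subst h1
      refine ⟨⟨f, h, hh, i, by omega, by rw [tt_eq hi, mul_assoc _ _ (ss n i)]⟩,
        ⟨f * rho n h (of i)⁻¹, h, hh, i, by omega, ?_⟩⟩
      rw [← absorb hh, mul_assoc _ _ (ss n i)⁻¹, tt_mul_ss_succ hi, map_inv, iot_of]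
      simp only [mul_assoc]
    · rcases Nat.lt_or_ge j i with h2 | h2
      · obtain ⟨i, rfl⟩ : ∃ l, i = l + 1 := ⟨i - 1, by omega⟩
        have e := tt_mul_ss hk (show j ≤ i by omega) hi
        have hs : ss n i ∈ HH n k := ss_mem_HH (by omega)
        have e' : tt n j k * (ss n (i + 1))⁻¹ = (ss n i)⁻¹ * tt n j k := by
          rw [mul_inv_eq_iff_eq_mul, mul_assoc, e, inv_mul_cancel_left]
        exact ⟨⟨f, h * ss n i, mul_mem hh hs, j, hj, by simp only [mul_assoc, e]⟩,
          ⟨f, h * (ss n i)⁻¹, mul_mem hh (inv_mem hs), j, hj, by simp only [mul_assoc, e']⟩⟩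
      · obtain rfl : j = i := by omega
        refine ⟨⟨f * rho n h (of j), h, hh, j + 1, by omega, ?_⟩,
          ⟨f, h, hh, j + 1, by omega, by rw [tt_eq hi]; group⟩⟩
        rw [← absorb hh, mul_assoc _ _ (ss n j), tt_mul_ss_self hi, iot_of, ← mul_assoc]
  induction hg using Subgroup.closure_induction_right with
  | one => exact ⟨1, 1, one_mem _, k, le_rfl, by simp [tt_of_le]⟩
  | mul_right x hx y hy ih =>
    obtain ⟨i, hi, rfl⟩ := hy
    exact (aux _ i (by simpa using hi) ih).1
  | mul_inv_cancel x hx y hy ih =>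
    obtain ⟨i, hi, rfl⟩ := hy
    exact (aux _ i (by simpa using hi) ih).2

theorem pp_tt {n j k : ℕ} (hk : k < n) (h : j ≤ k) : pp n (tt n j k) j = k := by
  induction k with
  | zero => simp only [tt, map_one, Equiv.Perm.one_apply]; omega
  | succ k ih =>
    rcases Nat.lt_or_ge k j with hj | hj
    · rw [tt_of_le (by omega), map_one, Equiv.Perm.one_apply]
      omega
    · rw [tt_succ hj, map_mul, Equiv.Perm.mul_apply, ih (by omega) hj, pp_ss hk,
        Equiv.swap_apply_left]

theorem eq_of_isConj_of {a b : ℕ} (h : IsConj (of a) (of b)) : a = b := by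
  have h1 := (lift fun j => Multiplicative.ofAdd (if j = a then (1 : ℤ) else 0)).map_isConj h
  rw [isConj_iff_eq, FreeGroup.lift_apply_of, FreeGroup.lift_apply_of, if_pos rfl] at h1
  by_contra hab
  rw [if_neg (Ne.symm hab)] at h1
  exact one_ne_zero (Multiplicative.ofAdd.injective h1)

theorem rho_iot {n k : ℕ} (hk : k < n) (f : FreeGroup ℕ) :
    (∀ x, rr k (rho n (iot n k f) x) = rr k x) ∧
    ∃ w, rho n (iot n k f) (of k) = w * of k * w⁻¹ ∧ rr k w = (rr k f)⁻¹ := by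
  have hone : (∀ x, rr k (rho n 1 x) = rr k x) ∧
    ∃ w, rho n 1 (of k) = w * of k * w⁻¹ ∧ rr k w = (rr k 1)⁻¹ :=
      ⟨fun x => by simp, 1, by simp, by simp⟩
  induction f using FreeGroup.induction_on with
  | C1 => simpa using hone
  | of j =>
    rcases Nat.lt_or_ge j k with hj | hj
    · obtain ⟨k, rfl⟩ : ∃ l, k = l + 1 := ⟨k - 1, by omega⟩
      obtain ⟨d, rfl⟩ : ∃ d, k = j + d := ⟨k - j, by omega⟩
      induction d generalizing j with
      | zero =>
        rw [iot_of, add_zero, AA_self_succ]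
        have hk' : j + 1 < n := by simpa using hk
        rw [map_pow, rho_ss hk']
        constructor
        · suffices H : (rr (j + 1)).comp (artin j ^ 2).toMonoidHom = rr (j + 1) from
            fun x => DFunLike.congr_fun H x
          ext1 i
          change rr (j + 1) (artin j (artin j (of i))) = _
          by_cases h0 : i = j
          · subst h0
            simp
          by_cases h1 : i = j + 1
          · subst h1
            simp
          · rw [artin_of_ne h0 h1, artin_of_ne h0 h1]
        · refine ⟨(of j * of (j + 1))⁻¹, ?_, by simp⟩
          change artin j (artin j (of (j + 1))) = _
          simp [mul_assoc]
      | succ d ih =>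
        have hd : j + 1 + d + 1 = j + (d + 1) + 1 := by omega
        have ih := ih (j + 1)
        rw [hd] at ih
        have ih := ih hk hone (by omega)
        set k := j + (d + 1) + 1 with hkd
        have hb : (ss n j)⁻¹ ∈ HH n k := inv_mem (ss_mem_HH (by omega))
        have hb' : ss n j ∈ HH n k := ss_mem_HH (by omega)
        have hj' : of j = rho n (ss n j)⁻¹ (of (j + 1)) := by
          rw [map_inv, rho_ss (by omega), artin_symm_of]
          simp
        obtain ⟨ih1, w, hw, hw'⟩ := ih
        rw [hj', iot_rho hk hb]
        refine ⟨fun x => ?_, rho n (ss n j)⁻¹ w, ?_, ?_⟩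
        · rw [map_mul, map_mul, MulAut.mul_apply, MulAut.mul_apply, rr_rho hk.le hb, ih1,
            inv_inv, rr_rho hk.le hb', map_inv, MulAut.inv_apply_self]
        · rw [map_mul, map_mul, MulAut.mul_apply, MulAut.mul_apply, inv_inv,
            rho_of_mem_HH hk.le le_rfl hb', hw, map_mul, map_mul,
            rho_of_mem_HH hk.le le_rfl hb, map_inv, map_inv]
        · rw [rr_rho hk.le hb, hw', rr_rho hk.le hb, map_inv]
    · rw [iot_of, AA_of_le hj, rr_of, if_neg (by omega)]
      simpa using hone
  | inv_of j h =>
    obtain ⟨h1, w, hw, hw'⟩ := h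
    have h2 (x : FreeGroup ℕ) : rr k ((rho n (iot n k (of j)))⁻¹ x) = rr k x := by
      rw [← h1, MulAut.apply_inv_self]
    rw [map_inv, map_inv]
    refine ⟨h2, (rho n (iot n k (of j)))⁻¹ w⁻¹, ?_, ?_⟩
    · have := congrArg (⇑(rho n (iot n k (of j)))⁻¹) hw
      rw [MulAut.inv_apply_self, map_mul, map_mul] at this
      rw [map_inv] at this ⊢
      nth_rw 2 [this]
      group
    · rw [h2, map_inv, hw', map_inv]
  | mul f g hf hg =>
    obtain ⟨h1, w, hw, hw'⟩ := hf
    obtain ⟨h2, v, hv, hv'⟩ := hg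
    rw [map_mul, map_mul]
    refine ⟨fun x => by rw [MulAut.mul_apply, h1, h2], rho n (iot n k f) v * w, ?_, ?_⟩
    · rw [MulAut.mul_apply, hv, map_mul, map_mul, hw, map_inv]
      group
    · rw [map_mul, h1, hv', hw', map_mul, mul_inv_rev]

theorem rr_eq_one_of_commute {k : ℕ} {w : FreeGroup ℕ} (h : Commute w (of k)) : rr k w = 1 := by
  obtain ⟨e, rfl⟩ := exists_eq_zpow_of_commute h
    (lift fun _ => Multiplicative.ofAdd (1 : ℤ)) (by simp)
  simp

theorem iot_eq_one {n k : ℕ} (hk : k < n) {f : FreeGroup ℕ}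
    (h : rho n (iot n k f) (of k) = of k) : rr k f = 1 := by
  obtain ⟨-, w, hw, hw'⟩ := rho_iot hk f
  rw [h] at hw
  have := rr_eq_one_of_commute (k := k) (w := w) (mul_inv_eq_iff_eq_mul.1 hw.symm)
  rwa [hw', inv_eq_one] at this

theorem iot_injOn {n k : ℕ} (hk : k < n) {f g : FreeGroup ℕ} (hf : f ∈ FF k) (hg : g ∈ FF k)
    (h : iot n k f = iot n k g) : f = g := by
  have h1 : rr k (f * g⁻¹) = 1 := iot_eq_one hk (by
    rw [map_mul, map_inv, h, mul_inv_cancel, map_one, MulAut.one_apply])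
  rw [rr_eq_self (mul_mem hf (inv_mem hg))] at h1
  exact mul_inv_eq_one.1 h1

theorem pp_eq_one_of_rho {n : ℕ} {g : BraidGroup n} (h : rho n g = 1) : pp n g = 1 := by
  ext a
  have := rho_of_isConj g a
  rw [h, MulAut.one_apply] at this
  exact eq_of_isConj_of this

/-- Faithfulness of the Artin representation. -/
theorem rho_injective (n : ℕ) : Function.Injective (rho n) := by
  rw [injective_iff_map_eq_one]
  suffices H : ∀ k ≤ n, ∀ g ∈ HH n k, rho n g = 1 → g = 1 from
    fun g hg => H n le_rfl g (mem_HH_self g) hg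
  intro k hk
  induction k with
  | zero =>
    intro g hg _
    have : HH n 0 = ⊥ := by simp [HH]
    rwa [this, Subgroup.mem_bot] at hg
  | succ k ih =>
    intro g hg hρ
    obtain ⟨f, hf, h, hh, j, hj, rfl⟩ := exists_decomp (by omega) hg
    have hπ := congrArg (fun σ : Equiv.Perm ℕ => σ j) (pp_eq_one_of_rho hρ)
    simp only [map_mul, pp_iot, one_mul, Equiv.Perm.mul_apply, pp_tt hk hj,
      pp_of_mem_HH (show k ≤ n by omega) le_rfl hh, Equiv.Perm.one_apply] at hπ
    rw [← hπ, tt_of_le le_rfl, mul_one] at hρ ⊢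
    have h1 : rho n h = 1 := by
      refine mulAut_ext fun i => ?_
      rw [MulAut.one_apply]
      rcases Nat.lt_or_ge i k with hi | hi
      · have h2 := (rho_iot hk f).1 (rho n h (of i))
        rw [← MulAut.mul_apply, ← map_mul, hρ, MulAut.one_apply, rr_of, if_pos hi,
          rr_eq_self (rho_mem_FF (by omega) hh (of_mem_FF hi))] at h2
        exact h2.symm
      · exact rho_of_mem_HH (by omega) hi hh
    have h2 := ih (by omega) h hh h1
    subst h2
    rw [mul_one] at hρ ⊢
    have h3 := iot_eq_one (f := f) hk (by rw [hρ, MulAut.one_apply])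
    rw [← iot_rr, h3, map_one]

/-- The product of the first `k` generators. -/
def dl (n : ℕ) : ℕ → BraidGroup n
  | 0 => 1
  | k + 1 => dl n k * ss n k

theorem dl_succ (n k : ℕ) : dl n (k + 1) = dl n k * ss n k := rfl

theorem dl_mem_HH (n k : ℕ) : dl n k ∈ HH n (k + 1) := by
  induction k with
  | zero => exact one_mem _
  | succ k ih => exact mul_mem (HH_mono (by omega) ih) (ss_mem_HH (by omega))

theorem dl_mul_ss {n i k : ℕ} (hk : k < n) (hi : i + 1 < k) :
    dl n k * ss n i = ss n (i + 1) * dl n k := by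
  induction k with
  | zero => omega
  | succ k ih =>
    rcases Nat.lt_or_ge (i + 1) k with h | h
    · rw [dl_succ, mul_assoc, ← (ss_comm n (show i + 2 ≤ k by omega)).eq, ← mul_assoc,
        ih (by omega) h, mul_assoc]
    · obtain rfl : k = i + 1 := by omega
      rw [dl_succ, dl_succ, mul_assoc, mul_assoc, ← mul_assoc (ss n i),
        ss_braid (show i + 2 < n by omega)]
      have := ss_commute_HH (show i + 1 ≤ n by omega) (dl_mem_HH n i)
      simp only [← mul_assoc, this.eq]

theorem rho_dl_of_lt {n j k : ℕ} (hk : k < n) (hj : j < k) :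
    rho n (dl n k) (of j) = of (j + 1) := by
  induction k with
  | zero => omega
  | succ k ih =>
    rw [dl_succ, map_mul, MulAut.mul_apply, rho_ss hk]
    rcases Nat.lt_or_ge j k with h | h
    · rw [artin_of_ne (by omega) (by omega), ih (by omega) h]
    · obtain rfl : j = k := by omega
      rw [artin_self, rho_of_mem_HH (by omega) le_rfl (dl_mem_HH n j)]

theorem rho_dl_self {n k : ℕ} (hk : k < n) :
    rho n (dl n k) (of k) = (yy (k + 1))⁻¹ * of 0 * yy (k + 1) := by
  induction k with
  | zero => simp [dl, yy_succ]
  | succ k ih =>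
    rw [dl_succ, map_mul, MulAut.mul_apply, rho_ss hk, artin_succ, map_mul, map_mul, map_inv,
      rho_of_mem_HH (by omega) le_rfl (dl_mem_HH n k), ih (by omega), yy_succ (k + 1)]
    group

/-- The full twist on the first `k + 1` strands. -/
def zt (n k : ℕ) : BraidGroup n := dl n k ^ (k + 1)

theorem zt_mem_HH (n k : ℕ) : zt n k ∈ HH n (k + 1) := pow_mem (dl_mem_HH n k) _

theorem iterate_of_step {τ : MulAut (FreeGroup ℕ)} {v : ℕ → FreeGroup ℕ} {m : ℕ} {c : FreeGroup ℕ}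
    (h : ∀ j, j + 1 < m → τ (v j) = v (j + 1)) (hm : τ (v (m - 1)) = c⁻¹ * v 0 * c)
    (hc : τ c = c) {j : ℕ} (hj : j < m) : (τ ^ m) (v j) = c⁻¹ * v j * c := by
  have h1 : ∀ i j, i + j < m → (τ ^ i) (v j) = v (j + i) := by
    intro i
    induction i with
    | zero => simp
    | succ i ih =>
      intro j hj
      rw [pow_succ, MulAut.mul_apply, h j (by omega), ih _ (by omega)]
      congr 1
      omega
  have h2 : ∀ i, (τ ^ i) c = c := by
    intro i
    induction i with
    | zero => simp
    | succ i ih => rw [pow_succ, MulAut.mul_apply, hc, ih]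
  obtain ⟨d, rfl⟩ : ∃ d, m = j + 1 + d := ⟨m - (j + 1), by omega⟩
  rw [pow_add, pow_succ, MulAut.mul_apply, MulAut.mul_apply, h1 d j (by omega)]
  rw [show j + 1 + d - 1 = j + d by omega] at hm
  rw [hm, map_mul, map_mul, map_inv, h2, h1 j 0 (by omega), zero_add]

theorem rho_zt {n k : ℕ} (hk : k < n) {f : FreeGroup ℕ} (hf : f ∈ FF (k + 1)) :
    rho n (zt n k) f = (yy (k + 1))⁻¹ * f * yy (k + 1) := by
  have : ∀ x ∈ of '' {j | j < k + 1}, (MulAut.conj (yy (k + 1)) * rho n (zt n k)).toMonoidHom x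
      = x := by
    rintro _ ⟨j, hj, rfl⟩
    change MulAut.conj (yy (k + 1)) (rho n (zt n k) (of j)) = of j
    rw [zt, map_pow, iterate_of_step (v := of) (c := yy (k + 1)) (m := k + 1)
      (fun j hj => rho_dl_of_lt hk (by omega)) (rho_dl_self hk)
      (rho_yy (by omega) le_rfl (dl_mem_HH n k)) hj, MulAut.conj_apply]
    group
  have h : MulAut.conj (yy (k + 1)) (rho n (zt n k) f) = f := map_eq_self_of_mem_closure _ _ this hf
  rw [MulAut.conj_apply] at h
  nth_rw 2 [← h]
  group

theorem eq_of_rho {n m : ℕ} (hm : m ≤ n) {g h : BraidGroup n} (hg : g ∈ HH n m)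
    (hh : h ∈ HH n m) (H : ∀ j < m, rho n g (of j) = rho n h (of j)) : g = h := by
  refine rho_injective n (mulAut_ext fun j => ?_)
  rcases Nat.lt_or_ge j m with hj | hj
  · exact H j hj
  · rw [rho_of_mem_HH hm hj hg, rho_of_mem_HH hm hj hh]

theorem zt_commute {n k : ℕ} (hk : k < n) {h : BraidGroup n} (hh : h ∈ HH n (k + 1)) :
    Commute (zt n k) h := by
  refine eq_of_rho hk (mul_mem (zt_mem_HH n k) hh) (mul_mem hh (zt_mem_HH n k)) fun j hj => ?_
  rw [map_mul, map_mul, MulAut.mul_apply, MulAut.mul_apply, rho_zt hk (of_mem_FF hj),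
    rho_zt hk (rho_mem_FF hk hh (of_mem_FF hj)), map_mul, map_mul, map_inv, rho_yy hk le_rfl hh]

theorem ex_dl {n k : ℕ} (hk : k < n) : ex (dl n k) = k := by
  induction k with
  | zero => simp [dl]
  | succ k ih => rw [dl_succ, ex_mul, ih (by omega), ex_ss hk]; simp

theorem ex_zt {n k : ℕ} (hk : k < n) : ex (zt n k) = (k + 1) * k := by
  rw [zt, ex_pow, ex_dl hk]
  push_cast
  rfl

theorem eps_pow {n k : ℕ} (hk : k < n) (h1 : 1 ≤ k) : (dl n k * ss n 0) ^ k = zt n k := by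
  set ε := dl n k * ss n 0 with hε
  have hmem : ε ∈ HH n (k + 1) := mul_mem (dl_mem_HH n k) (ss_mem_HH (by omega))
  have hy : rho n ε (yy (k + 1)) = yy (k + 1) := rho_yy hk le_rfl hmem
  have hstep : ∀ j, j + 1 < k → rho n ε (of (if j = 0 then 0 else j + 1)) =
      of (if j + 1 = 0 then 0 else j + 1 + 1) := by
    intro j hj
    rw [hε, map_mul, MulAut.mul_apply, rho_ss (by omega), if_neg (show j + 1 ≠ 0 by omega)]
    by_cases h : j = 0
    · subst h
      rw [if_pos rfl, artin_self, rho_dl_of_lt hk (by omega)]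
    · rw [if_neg h, artin_of_ne (by omega) (by omega), rho_dl_of_lt hk (by omega)]
  have hlast : rho n ε (of (if k - 1 = 0 then 0 else k - 1 + 1)) =
      (yy (k + 1))⁻¹ * of (if 0 = 0 then 0 else 0 + 1) * yy (k + 1) := by
    rw [hε, map_mul, MulAut.mul_apply, rho_ss (by omega), if_pos rfl, ← rho_dl_self hk]
    split_ifs with h
    · obtain rfl : k = 1 := by omega
      rw [artin_self]
    · rw [artin_of_ne (by omega) (by omega)]
      congr 2
      omega
  have key (j : ℕ) (hj : j < k + 1) (hj1 : j ≠ 1) :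
      rho n (ε ^ k) (of j) = (yy (k + 1))⁻¹ * of j * yy (k + 1) := by
    have := iterate_of_step (v := fun j => of (if j = 0 then 0 else j + 1)) hstep hlast hy
      (j := j - 1) (by omega)
    rw [map_pow]
    rcases Nat.eq_zero_or_pos j with h | h
    · subst h
      simpa using this
    · simp only [show j - 1 ≠ 0 by omega, if_false, show j - 1 + 1 = j by omega] at this
      exact this
  refine eq_of_rho hk (pow_mem hmem k) (zt_mem_HH n k) fun j hj => ?_
  rw [rho_zt hk (of_mem_FF hj)]
  by_cases hj1 : j = 1
  swap
  · exact key j hj hj1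
  subst hj1
  set ψ : MulAut (FreeGroup ℕ) := MulAut.conj (yy (k + 1)) * rho n (ε ^ k) with hψ
  have hfix (i : ℕ) (hi : i < k + 1) (hi1 : i ≠ 1) : ψ (of i) = of i := by
    rw [hψ, MulAut.mul_apply, key i hi hi1, MulAut.conj_apply]
    group
  have hψy : ψ (yy (k + 1)) = yy (k + 1) := by
    rw [hψ, MulAut.mul_apply, rho_yy hk le_rfl (pow_mem hmem k), MulAut.conj_apply]
    group
  have hdec : ∀ d, d + 2 ≤ k + 1 → ∃ r, ψ r = r ∧ yy (d + 2) = of 0 * of 1 * r := by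
    intro d
    induction d with
    | zero => exact fun _ => ⟨1, map_one _, by simp [yy_succ]⟩
    | succ d ih =>
      intro hd
      obtain ⟨r, hr, hr'⟩ := ih (by omega)
      refine ⟨r * of (d + 2), by rw [map_mul, hr, hfix _ (by omega) (by omega)], ?_⟩
      rw [show d + 1 + 2 = d + 2 + 1 by omega, yy_succ, hr', mul_assoc]
  obtain ⟨r, hr, hr'⟩ := hdec (k - 1) (by omega)
  rw [show k - 1 + 2 = k + 1 by omega] at hr'
  have h1 : ψ (of 1) = of 1 := by
    rw [hr', map_mul, map_mul, hr, hfix 0 (by omega) (by omega)] at hψy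
    exact mul_left_cancel (mul_right_cancel hψy)
  rw [hψ, MulAut.mul_apply, MulAut.conj_apply] at h1
  nth_rw 2 [← h1]
  group

theorem cr_conj {n : ℕ} {g : BraidGroup n} (hg : pp n g = 1) (h : BraidGroup n) (a b : ℕ) :
    cr (pp n h a) (pp n h b) (h * g * h⁻¹) = cr a b g := by
  have h1 (x : ℕ) : pp n h⁻¹ (pp n h x) = x := by
    rw [map_inv]
    exact (pp n h).symm_apply_apply x
  rw [cr_mul, cr_mul, cr_inv, h1, h1, hg, Equiv.Perm.one_apply, Equiv.Perm.one_apply]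
  ring

theorem cr_AA {n j k : ℕ} (hk : k < n) (hj : j < k) (a b : ℕ) :
    cr a b (AA n j k) = if (a = j ∧ b = k) ∨ (a = k ∧ b = j) then 2 else 0 := by
  induction k generalizing a b with
  | zero => omega
  | succ k ih =>
    rcases Nat.lt_or_ge j k with h | h
    · obtain ⟨a, rfl⟩ := (pp n (ss n k)).surjective a
      obtain ⟨b, rfl⟩ := (pp n (ss n k)).surjective b
      rw [AA_succ_of_lt h, cr_conj (pp_AA n j k), ih (by omega) h, pp_ss hk]
      simp only [swap_eq_iff, Equiv.swap_apply_right]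
      rw [Equiv.swap_apply_of_ne_of_ne (show j ≠ k by omega) (by omega)]
    · obtain rfl : j = k := by omega
      rw [AA_self_succ, pow_two, cr_mul, cr_ss hk, cr_ss hk, cx, cx, pp_ss hk]
      simp only [swap_eq_iff, Equiv.swap_apply_right, Equiv.swap_apply_left]
      split_ifs <;> omega

theorem ex_AA {n j k : ℕ} (hk : k < n) (hj : j < k) : ex (AA n j k) = 2 := by
  rw [AA_eq hj]
  simp [ex_ss (show j + 1 < n by omega)]

theorem ex_iot_yy {n k m : ℕ} (hk : k < n) (hm : m ≤ k) : ex (iot n k (yy m)) = 2 * m := by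
  induction m with
  | zero => simp
  | succ m ih =>
    rw [yy_succ, map_mul, ex_mul, ih (by omega), iot_of, ex_AA hk (by omega)]
    push_cast
    ring

theorem exists_iot_mul {n k : ℕ} (hk : k < n) {g : BraidGroup n} (hg : g ∈ HH n (k + 1))
    (h : pp n g k = k) : ∃ f ∈ FF k, ∃ h ∈ HH n k, g = iot n k f * h := by
  obtain ⟨f, hf, h', hh, j, hj, rfl⟩ := exists_decomp hk hg
  have h1 : pp n (iot n k f * h' * tt n j k) j = k := by
    simp only [map_mul, pp_iot, one_mul, Equiv.Perm.mul_apply, pp_tt hk hj,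
      pp_of_mem_HH (show k ≤ n by omega) le_rfl hh]
  have h2 : k = j := (pp n (iot n k f * h' * tt n j k)).injective (h.trans h1.symm)
  exact ⟨f, hf, h', hh, by rw [h2, tt_of_le le_rfl, mul_one]⟩

theorem exists_eq_zpow_of_commute_yy {m : ℕ} (hm : 1 ≤ m) {f : FreeGroup ℕ}
    (h : Commute f (yy m)) : ∃ e : ℤ, f = yy m ^ e := by
  refine exists_eq_zpow_of_commute h
    (lift fun j => Multiplicative.ofAdd (if j = 0 then (1 : ℤ) else 0)) ?_
  obtain ⟨m, rfl⟩ : ∃ l, m = l + 1 := ⟨m - 1, by omega⟩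
  clear h hm
  induction m with
  | zero => simp [yy_succ]
  | succ m ih =>
    rw [yy_succ, map_mul, toAdd_mul, ih]
    simp

theorem pp_eq_self_of_commute_AA {n k : ℕ} (hkn : k < n) (hk : 2 ≤ k) {g : BraidGroup n}
    (hg : ∀ j < k, Commute g (AA n j k)) : pp n g k = k := by
  have hpair (j : ℕ) (hj : j < k) : (pp n g j = j ∧ pp n g k = k) ∨
      (pp n g j = k ∧ pp n g k = j) := by
    have h1 := cr_conj (pp_AA n j k) g j k
    rw [(hg j hj).eq, mul_inv_cancel_right, cr_AA hkn hj, cr_AA hkn hj,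
      if_pos (show (j = j ∧ k = k) ∨ (j = k ∧ k = j) from Or.inl ⟨rfl, rfl⟩)] at h1
    by_contra h
    rw [if_neg h] at h1
    omega
  rcases hpair 0 (by omega) with h | h
  · exact h.2
  · rcases hpair 1 (by omega) with h' | h' <;> omega

theorem exists_eq_zpow_zt {n k : ℕ} (hn : n = k + 1) (hk : 2 ≤ k) {g : BraidGroup n}
    (hg : ∀ j < k, Commute g (AA n j k)) : ∃ e : ℤ, g = zt n k ^ e := by
  have hkn : k < n := by omega
  have main : ∀ g : BraidGroup n, (∀ j < k, Commute g (AA n j k)) → pp n g k = k →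
      ∃ e : ℤ, g = (iot n k (yy k) * zt n (k - 1)) ^ e := by
    clear hg g
    intro g hg hk'
    obtain ⟨f, hf, h, hh, rfl⟩ := exists_iot_mul hkn (hn ▸ mem_HH_self g) hk'
    have hcomm (u : FreeGroup ℕ) : Commute (iot n k f * h) (iot n k u) := by
      induction u using FreeGroup.induction_on with
      | C1 => simp
      | of j =>
        rw [iot_of]
        rcases Nat.lt_or_ge j k with hj | hj
        · exact hg j hj
        · rw [AA_of_le hj]
          exact Commute.one_right _
      | inv_of j h =>
        rw [map_inv]
        exact h.inv_right
      | mul u v hu hv =>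
        rw [map_mul]
        exact hu.mul_right hv
    have hinv (u : FreeGroup ℕ) (hu : u ∈ FF k) : f * rho n h u * f⁻¹ = u := by
      refine iot_injOn hkn (mul_mem (mul_mem hf (rho_mem_FF hkn.le hh hu)) (inv_mem hf)) hu ?_
      rw [map_mul, map_mul, map_inv, iot_rho hkn hh]
      have := hcomm u
      calc _ = (iot n k f * h) * iot n k u * (iot n k f * h)⁻¹ := by group
        _ = _ := by rw [this.eq]; group
    have hy := hinv (yy k) (yy_mem_FF k)
    rw [rho_yy hkn.le le_rfl hh] at hy
    obtain ⟨e, rfl⟩ := exists_eq_zpow_of_commute_yy (by omega) (mul_inv_eq_iff_eq_mul.1 hy)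
    have hkk : k - 1 + 1 = k := by omega
    have hz : zt n (k - 1) ∈ HH n k := by
      have := zt_mem_HH n (k - 1)
      rwa [hkk] at this
    have hzr (f : FreeGroup ℕ) (hf : f ∈ FF k) : rho n (zt n (k - 1)) f = (yy k)⁻¹ * f * yy k := by
      have := rho_zt (n := n) (k := k - 1) (f := f) (by omega)
      rw [hkk] at this
      exact this hf
    have hc : Commute (iot n k (yy k)) (zt n (k - 1)) := by
      have := iot_rho hkn hz (yy k)
      rw [rho_yy hkn.le le_rfl hz] at this
      exact eq_mul_inv_iff_mul_eq.1 this
    have hzz (e : ℤ) (f : FreeGroup ℕ) (hf : f ∈ FF k) :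
        rho n (zt n (k - 1) ^ e) f = (yy k ^ e)⁻¹ * f * yy k ^ e := by
      have h1 : rho n (zt n (k - 1) ^ e) f = (MulAut.conj (yy k ^ e))⁻¹ f := by
        have h2 : ∀ x ∈ of '' {j | j < k}, (MulAut.conj (yy k ^ e) *
            rho n (zt n (k - 1) ^ e)).toMonoidHom x = x := by
          rintro _ ⟨j, hj, rfl⟩
          have h3 (x : _) (hx : x ∈ FF k) : MulAut.conj (yy k) (rho n (zt n (k - 1)) x) = x := by
            rw [hzr _ hx, MulAut.conj_apply]
            group
          have h4 : Commute (MulAut.conj (yy k)) (rho n (zt n (k - 1))) := by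
            ext1 x
            change MulAut.conj (yy k) (rho n (zt n (k - 1)) x) =
              rho n (zt n (k - 1)) (MulAut.conj (yy k) x)
            simp only [MulAut.conj_apply, map_mul, map_inv, rho_yy hkn.le le_rfl hz]
          change (MulAut.conj (yy k ^ e) * rho n (zt n (k - 1) ^ e)) (of j) = of j
          rw [map_zpow, map_zpow, ← h4.mul_zpow]
          exact (MulAction.stabilizer (MulAut (FreeGroup ℕ)) (of j)).zpow_mem
            (h3 _ (of_mem_FF hj)) e
        have h5 : (MulAut.conj (yy k ^ e)) (rho n (zt n (k - 1) ^ e) f) = f :=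
          map_eq_self_of_mem_closure _ _ h2 hf
        nth_rw 2 [← h5]
        rw [MulAut.inv_apply_self]
      rw [h1, MulAut.conj_inv_apply]
    have hh' : h = zt n (k - 1) ^ e := by
      refine eq_of_rho hkn.le hh (zpow_mem hz e) fun j hj => ?_
      have h1 := hinv (of j) (of_mem_FF hj)
      rw [hzz e _ (of_mem_FF hj)]
      nth_rw 2 [← h1]
      group
    exact ⟨e, by rw [hh', map_zpow, hc.mul_zpow]⟩
  have hzc : ∀ j < k, Commute (zt n k) (AA n j k) :=
    fun j _ => zt_commute hkn (hn ▸ mem_HH_self _)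
  obtain ⟨l, hl⟩ := main (zt n k) hzc (pp_eq_self_of_commute_AA hkn hk hzc)
  have hex := congrArg ex hl
  rw [ex_zt hkn, ex_zpow, ex_mul, ex_iot_yy hkn le_rfl, ex_zt (by omega)] at hex
  have hl1 : l = 1 := by
    push_cast [show 1 ≤ k by omega] at hex
    have h2 : ((k : ℤ) + 1) * k * (l - 1) = 0 := by linear_combination -hex
    have h3 : ((k : ℤ) + 1) * k ≠ 0 := by positivity
    have := (mul_eq_zero.1 h2).resolve_left h3
    omega
  rw [hl1, zpow_one] at hl
  rw [hl]
  exact main g hg (pp_eq_self_of_commute_AA hkn hk hg)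

theorem exists_pp_eq {n : ℕ} (σ : Equiv.Perm ℕ) (hσ : ∀ a, n ≤ a → σ a = a) :
    ∃ g : BraidGroup n, pp n g = σ := by
  suffices H : ∀ k ≤ n, ∀ σ : Equiv.Perm ℕ, (∀ a, k ≤ a → σ a = a) →
      ∃ g ∈ HH n k, pp n g = σ by
    obtain ⟨g, -, hg⟩ := H n le_rfl σ hσ
    exact ⟨g, hg⟩
  clear hσ σ
  intro k hk
  induction k with
  | zero =>
    intro σ hσ
    exact ⟨1, one_mem _, by rw [map_one]; exact Equiv.ext fun a => (hσ a (Nat.zero_le a)).symm⟩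
  | succ k ih =>
    intro σ hσ
    obtain ⟨j, hj⟩ := σ.surjective k
    have hjk : j ≤ k := by
      by_contra h
      rw [hσ j (by omega)] at hj
      omega
    obtain ⟨g, hg, hg'⟩ := ih (by omega) (σ * (pp n (tt n j k))⁻¹) (by
      intro a ha
      rw [Equiv.Perm.mul_apply]
      rcases Nat.eq_or_lt_of_le ha with rfl | ha
      · nth_rw 2 [← pp_tt hk hjk]
        rw [show (pp n (tt n j k))⁻¹ (pp n (tt n j k) j) = j from
          (pp n (tt n j k)).symm_apply_apply j, hj]
      · rw [← map_inv, pp_of_mem_HH hk ha (inv_mem (tt_mem_HH n j k)), hσ a ha])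
    exact ⟨g * tt n j k, mul_mem (HH_mono (by omega) hg) (tt_mem_HH n j k), by
      rw [map_mul, hg', inv_mul_cancel_right]⟩

theorem exists_pp_pair {n a b : ℕ} (ha : a < n) (hb : b < n) (hab : a ≠ b) :
    ∃ g : BraidGroup n, pp n g 0 = a ∧ pp n g 1 = b := by
  obtain ⟨g, hg⟩ := exists_pp_eq (n := n)
    (Equiv.swap (Equiv.swap 0 a 1) b * Equiv.swap 0 a) (by
      intro c hc
      have h1 : Equiv.swap 0 a 1 < n := by
        rw [Equiv.swap_apply_def]
        split_ifs <;> omega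
      have h2 : Equiv.swap 0 a c = c := Equiv.swap_apply_of_ne_of_ne (by omega) (by omega)
      rw [Equiv.Perm.mul_apply, h2, Equiv.swap_apply_of_ne_of_ne (by omega) (by omega)])
  refine ⟨g, ?_, ?_⟩
  · rw [hg, Equiv.Perm.mul_apply, Equiv.swap_apply_left]
    refine Equiv.swap_apply_of_ne_of_ne (fun h => ?_) hab
    exact zero_ne_one ((Equiv.swap 0 a).injective ((Equiv.swap_apply_left 0 a).trans h))
  · rw [hg, Equiv.Perm.mul_apply, Equiv.swap_apply_left]

theorem zt_central {n k : ℕ} (hn : n = k + 1) (g : BraidGroup n) : Commute (zt n k) g :=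
  zt_commute (by omega) (hn ▸ mem_HH_self g)

theorem pp_zt {n k : ℕ} (hn : n = k + 1) : pp n (zt n k) = 1 := by
  ext a
  rw [Equiv.Perm.one_apply]
  rcases Nat.lt_or_ge a n with h | h
  · have h1 := rho_of_isConj (zt n k) a
    rw [rho_zt (by omega) (of_mem_FF (by omega))] at h1
    exact eq_of_isConj_of (h1.trans (isConj_iff.2 ⟨yy (k + 1), by group⟩))
  · exact pp_of_le _ h

theorem cr_zt {n k : ℕ} (hn : n = k + 1) (hk : 1 ≤ k) {a b : ℕ} (ha : a < n) (hb : b < n)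
    (hab : a ≠ b) : cr a b (zt n k) = 2 := by
  have h1 (a b : ℕ) (ha : a < n) (hb : b < n) (hab : a ≠ b) :
      cr a b (zt n k) = cr 0 1 (zt n k) := by
    obtain ⟨g, rfl, rfl⟩ := exists_pp_pair ha hb hab
    have := cr_conj (pp_zt hn) g 0 1
    rwa [← (zt_central hn g).eq, mul_inv_cancel_right] at this
  rw [h1 a b ha hb hab]
  have h2 := sum_cr (zt n k)
  have h3 : ∀ a ∈ Finset.range n, ∑ b ∈ Finset.range n, cr a b (zt n k) =
      k * cr 0 1 (zt n k) := by
    intro a ha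
    rw [← Finset.sum_erase_add _ _ ha, cr_self, add_zero, Finset.sum_congr rfl
      (g := fun _ => cr 0 1 (zt n k))]
    · rw [Finset.sum_const, Finset.card_erase_of_mem ha, Finset.card_range, nsmul_eq_mul, hn,
        Nat.add_sub_cancel]
    · intro b hb
      rw [Finset.mem_erase, Finset.mem_range] at hb
      exact h1 a b (by simpa using ha) hb.2 (Ne.symm hb.1)
  rw [Finset.sum_congr rfl h3, Finset.sum_const, Finset.card_range, nsmul_eq_mul,
    ex_zt (by omega)] at h2
  have h4 : ((n : ℤ) * k) * (cr 0 1 (zt n k) - 2) = 0 := by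
    rw [hn] at h2 ⊢
    push_cast at h2 ⊢
    linear_combination h2
  have h5 : (n : ℤ) * k ≠ 0 := by
    rw [hn]
    positivity
  have := (mul_eq_zero.1 h4).resolve_left h5
  omega

theorem map_zt {n k : ℕ} (hn : n = k + 1) (hk : 2 ≤ k) {φ : MulAut (BraidGroup n)}
    (hφ : ∀ g, ex (φ g) = ex g) : φ (zt n k) = zt n k := by
  obtain ⟨e, he⟩ := exists_eq_zpow_zt hn hk (g := φ (zt n k)) (by
    intro j _
    obtain ⟨x, hx⟩ := φ.surjective (AA n j k)
    rw [← hx]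
    exact (zt_central hn x).map φ)
  have h := hφ (zt n k)
  rw [he, ex_zpow, ex_zt (by omega)] at h
  have h2 : ((k : ℤ) + 1) * k * (e - 1) = 0 := by linear_combination h
  have h3 : ((k : ℤ) + 1) * k ≠ 0 := by positivity
  have := (mul_eq_zero.1 h2).resolve_left h3
  rw [he, show e = 1 by omega, zpow_one]

theorem cr_pow_of_fixed {n : ℕ} {g : BraidGroup n} {a b : ℕ} (ha : pp n g a = a)
    (hb : pp n g b = b) (i : ℕ) : cr a b (g ^ i) = i * cr a b g := by
  induction i with
  | zero => simp
  | succ i ih =>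
    rw [pow_succ, cr_mul, ha, hb, ih]
    push_cast
    ring

theorem eq_of_root {n k : ℕ} (hn : n = k + 1) (hk : 1 ≤ k) {N d : ℕ} {g : BraidGroup n}
    (hg : g ^ N = zt n k) (hd : d ∣ N) {a b : ℕ} (ha : a < n) (hb : b < n)
    (hab : a ≠ b) (hda : (pp n g ^ d) a = a) (hdb : (pp n g ^ d) b = b) : d = N := by
  obtain ⟨q, rfl⟩ := hd
  rw [← map_pow] at hda hdb
  have h1 := cr_pow_of_fixed hda hdb q
  rw [← pow_mul, hg, cr_zt hn hk ha hb hab] at h1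
  obtain ⟨r, hr⟩ := (even_cr_iff hab (g ^ d)).2 (by rw [hda, hdb])
  rw [hr] at h1
  have h2 : (q : ℤ) * r = 1 := by linarith
  have h3 : q = 1 := by
    have := Int.eq_one_of_dvd_one (Int.natCast_nonneg q) (Dvd.intro _ h2)
    exact_mod_cast this
  rw [h3, mul_one]

theorem pow_apply_of_root {n k : ℕ} (hn : n = k + 1) {N : ℕ} {g : BraidGroup n}
    (hg : g ^ N = zt n k) (a : ℕ) : (pp n g ^ N) a = a := by
  rw [← map_pow, hg, pp_zt hn, Equiv.Perm.one_apply]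

/-- A point moved by the permutation of an `N`-th root of the full twist has period `N`. -/
theorem pow_ne_of_root {n k : ℕ} (hn : n = k + 1) (hk : 1 ≤ k) {N : ℕ} {g : BraidGroup n}
    (hg : g ^ N = zt n k) {a : ℕ} (ha : a < n) (hga : pp n g a ≠ a) {d : ℕ} (hd : 0 < d)
    (hdN : d < N) : (pp n g ^ d) a ≠ a := by
  intro h
  set p := Function.minimalPeriod (pp n g) a with hp
  have h1 : Function.IsPeriodicPt (pp n g) d a := by
    rw [Function.IsPeriodicPt, Function.IsFixedPt, Equiv.Perm.iterate_eq_pow, h]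
  have h2 : Function.IsPeriodicPt (pp n g) N a := by
    rw [Function.IsPeriodicPt, Function.IsFixedPt, Equiv.Perm.iterate_eq_pow,
      pow_apply_of_root hn hg]
  have h3 : p ∣ N := h2.minimalPeriod_dvd
  have h4 : (pp n g ^ p) a = a := by
    rw [← Equiv.Perm.iterate_eq_pow]
    exact Function.isPeriodicPt_minimalPeriod _ _
  have h5 : (pp n g ^ p) (pp n g a) = pp n g a := by
    rw [← Equiv.Perm.mul_apply, ← pow_succ, pow_succ', Equiv.Perm.mul_apply, h4]
  have h6 := eq_of_root hn hk hg h3 (pp_lt g ha) ha hga h5 h4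
  have := h1.minimalPeriod_le hd
  omega

theorem orbit_injOn {σ : Equiv.Perm ℕ} {N a : ℕ} (h : ∀ d, 0 < d → d < N → (σ ^ d) a ≠ a)
    {i j : ℕ} (hi : i < N) (hj : j < N) (hij : (σ ^ i) a = (σ ^ j) a) : i = j := by
  wlog hlt : i < j generalizing i j
  · by_contra hne
    exact hne (this hj hi hij.symm (by omega)).symm
  · obtain ⟨d, rfl⟩ : ∃ d, j = i + d := ⟨j - i, by omega⟩
    rw [pow_add, Equiv.Perm.mul_apply] at hij
    exact absurd ((σ ^ i).injective hij).symm (h d (by omega) (by omega))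

theorem card_orbit {σ : Equiv.Perm ℕ} {N a : ℕ} (h : ∀ d, 0 < d → d < N → (σ ^ d) a ≠ a) :
    ((Finset.range N).image fun i => (σ ^ i) a).card = N := by
  rw [Finset.card_image_of_injOn, Finset.card_range]
  intro i hi j hj hij
  exact orbit_injOn h (by simpa using hi) (by simpa using hj) hij

theorem pp_pow_lt {n : ℕ} (g : BraidGroup n) {a : ℕ} (h : a < n) (i : ℕ) :
    (pp n g ^ i) a < n := by
  rw [← map_pow]
  exact pp_lt _ h

theorem orbit_subset {n : ℕ} (g : BraidGroup n) {a : ℕ} (h : a < n) (N : ℕ) :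
    ((Finset.range N).image fun i => (pp n g ^ i) a) ⊆ Finset.range n := by
  intro x hx
  simp only [Finset.mem_image] at hx
  obtain ⟨i, -, rfl⟩ := hx
  exact Finset.mem_range.2 (pp_pow_lt g h i)

theorem apply_ne_of_root {n k : ℕ} (hn : n = k + 1) (hk : 1 ≤ k) {g : BraidGroup n}
    (hg : g ^ (k + 1) = zt n k) {a : ℕ} (ha : a < n) : pp n g a ≠ a := by
  intro hga
  obtain ⟨b, hb, hab⟩ : ∃ b, b < n ∧ a ≠ b := by
    by_cases h : a = 0
    · exact ⟨1, by omega, by omega⟩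
    · exact ⟨0, by omega, h⟩
  have hgb : pp n g b ≠ b := by
    intro hgb
    have := eq_of_root hn hk hg (one_dvd _) ha hb hab (by simpa using hga) (by simpa using hgb)
    omega
  have h1 := fun d hd hdN => pow_ne_of_root hn hk hg hb hgb (d := d) hd hdN
  have h2 : ((Finset.range (k + 1)).image fun i => (pp n g ^ i) b) = Finset.range n :=
    Finset.eq_of_subset_of_card_le (orbit_subset g hb _) (by
      rw [card_orbit h1, Finset.card_range, hn])
  have h3 : a ∈ Finset.range n := Finset.mem_range.2 ha
  rw [← h2] at h3
  simp only [Finset.mem_image] at h3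
  obtain ⟨i, -, hi⟩ := h3
  have h4 : (pp n g ^ i) a = a := by
    rw [← Equiv.Perm.iterate_eq_pow]
    exact Function.IsFixedPt.iterate hga i
  exact hab ((pp n g ^ i).injective (h4.trans hi.symm))

theorem exists_fixed_of_root {n k : ℕ} (hn : n = k + 1) (hk : 1 ≤ k) {g : BraidGroup n}
    (hg : g ^ k = zt n k) : ∃ a < n, pp n g a = a := by
  by_contra! hno
  have h0 : 0 < n := by omega
  have h1 := fun d hd hdN => pow_ne_of_root hn hk hg h0 (hno 0 h0) (d := d) hd hdN
  obtain ⟨b, hb, hb'⟩ : ∃ b ∈ Finset.range n,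
      b ∉ (Finset.range k).image fun i => (pp n g ^ i) 0 := by
    apply Finset.exists_mem_notMem_of_card_lt_card
    rw [card_orbit h1, Finset.card_range]
    omega
  have hinv : ∀ x, x ∉ ((Finset.range k).image fun i => (pp n g ^ i) 0) →
      pp n g x ∉ (Finset.range k).image fun i => (pp n g ^ i) 0 := by
    intro x hx hgx
    simp only [Finset.mem_image, Finset.mem_range, not_exists, not_and] at hx hgx
    obtain ⟨i, hi, hgx⟩ := hgx
    rcases Nat.eq_zero_or_pos i with rfl | hi0
    · refine hx (k - 1) (by omega) ((pp n g).injective ?_)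
      rw [← hgx, ← Equiv.Perm.mul_apply, ← pow_succ', show k - 1 + 1 = k by omega,
        pow_apply_of_root hn hg]
      rfl
    · refine hx (i - 1) (by omega) ((pp n g).injective ?_)
      rw [← hgx, ← Equiv.Perm.mul_apply, ← pow_succ', show i - 1 + 1 = i by omega]
  have hsub : insert b (insert (pp n g b) ((Finset.range k).image fun i => (pp n g ^ i) 0)) ⊆
      Finset.range n := by
    refine Finset.insert_subset hb (Finset.insert_subset ?_ (orbit_subset g h0 k))
    exact Finset.mem_range.2 (pp_lt g (Finset.mem_range.1 hb))
  have hcard := Finset.card_le_card hsub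
  rw [Finset.card_insert_of_notMem, Finset.card_insert_of_notMem (hinv b hb'), card_orbit h1,
    Finset.card_range] at hcard
  · omega
  · rw [Finset.mem_insert, not_or]
    exact ⟨fun h => hno b (Finset.mem_range.1 hb) h.symm, hb'⟩

theorem zmod_natCast_ne {n i j : ℕ} (hi : i < n) (hj : j < n) (h : i ≠ j) :
    (i : ZMod n) ≠ j := by
  intro h'
  rw [ZMod.natCast_eq_natCast_iff', Nat.mod_eq_of_lt hi, Nat.mod_eq_of_lt hj] at h'
  exact h h'

theorem zmod_neg_one {k : ℕ} : (-1 : ZMod (k + 1)) = (k : ℕ) := by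
  have : ((k + 1 : ℕ) : ZMod (k + 1)) = 0 := ZMod.natCast_self _
  push_cast at this
  linear_combination -this

theorem zmod_exists_natCast {k : ℕ} {x : ZMod (k + 1)} (h0 : x ≠ 0) (h1 : x ≠ -1) :
    ∃ j : ℕ, 1 ≤ j ∧ j < k ∧ (j : ZMod (k + 1)) = x := by
  have hx : ((x.val : ℕ) : ZMod (k + 1)) = x := ZMod.natCast_rightInverse x
  have hlt := ZMod.val_lt x
  refine ⟨x.val, ?_, ?_, hx⟩
  · rw [Nat.one_le_iff_ne_zero]
    intro h
    rw [h, Nat.cast_zero] at hx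
    exact h0 hx.symm
  · by_contra h
    rw [show x.val = k by omega, ← zmod_neg_one] at hx
    exact h1 hx.symm

/-- The combinatorial core of the classification of the permutations induced by an automorphism:
a permutation of `ZMod n` commuting with its translates by `i ≠ 0, ±1`, and whose composition with
the rotation is a cycle fixing one point, is a transposition, up to one exception for `n = 4`. -/
theorem cyclic_classification {k : ℕ} (hk : 3 ≤ k) (a : ZMod (k + 1) → ZMod (k + 1))
    (ha : Function.Injective a) (h0 : a 0 = -1)
    (hu : ∀ x ≠ 0, ∀ d, 0 < d → d < k → (fun y => a y + 1)^[d] x ≠ x)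
    (hc : ∀ i : ℕ, 2 ≤ i → i < k → ∀ x, a (a (x - i) + i) = a (a x - i) + i) :
    (∀ x, x ≠ 0 → x ≠ -1 → a x = x) ∨
      (k = 3 ∧ a 0 = 3 ∧ a 3 = 1 ∧ a 1 = 2 ∧ a 2 = 0) := by
  set u : ZMod (k + 1) → ZMod (k + 1) := fun y => a y + 1 with hudef
  have hui : Function.Injective u := fun x y h => ha (add_right_cancel h)
  have hu0 : u 0 = 0 := by simp [hudef, h0]
  set v : ZMod (k + 1) → ZMod (k + 1) := fun x => a x - x with hvdef
  have hv1 {x : ZMod (k + 1)} (h : v x = -1) : x = 0 := by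
    by_contra hx
    refine hu x hx 1 one_pos (by omega) ?_
    rw [Function.iterate_one]
    simp only [hudef, hvdef] at h ⊢
    linear_combination h
  have hstep (i : ℕ) (hi : 1 ≤ i) (hik : i + 1 < k) :
      u (v ((i + 1 : ℕ) : ZMod (k + 1))) = v (i : ZMod (k + 1)) := by
    have := hc (i + 1) (by omega) hik ((i + 1 : ℕ) : ZMod (k + 1))
    rw [sub_self, h0] at this
    have e : (-1 + ((i + 1 : ℕ) : ZMod (k + 1))) = i := by push_cast; ring
    rw [e] at this
    simp only [hudef, hvdef]
    rw [this]
    push_cast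
    ring
  have hiter (d i : ℕ) (hi : 1 ≤ i) (hik : i + d < k) :
      u^[d] (v ((i + d : ℕ) : ZMod (k + 1))) = v (i : ZMod (k + 1)) := by
    induction d with
    | zero => rfl
    | succ d ih =>
      rw [Function.iterate_succ_apply, ← add_assoc, hstep (i + d) (by omega) (by omega)]
      exact ih (by omega)
  have hu0' (d : ℕ) : u^[d] 0 = 0 := Function.iterate_fixed hu0 d
  by_cases hgood : ∃ i : ℕ, 1 ≤ i ∧ i < k ∧ v (i : ZMod (k + 1)) = 0
  · left
    obtain ⟨i, hi1, hik, hi⟩ := hgood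
    intro x hx0 hx1
    obtain ⟨j, hj1, hjk, rfl⟩ := zmod_exists_natCast hx0 hx1
    suffices h : v (j : ZMod (k + 1)) = 0 from sub_eq_zero.1 h
    rcases le_total j i with hji | hji
    · obtain ⟨d, rfl⟩ := Nat.exists_eq_add_of_le hji
      rw [← hiter d j hj1 hik, hi, hu0']
    · obtain ⟨d, rfl⟩ := Nat.exists_eq_add_of_le hji
      have := hiter d i hi1 hjk
      rw [hi, ← hu0' d] at this
      exact hui.iterate d this
  · push Not at hgood
    have hvinj (i j : ℕ) (hi : 1 ≤ i) (hij : i < j) (hjk : j < k) :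
        v (i : ZMod (k + 1)) ≠ v (j : ZMod (k + 1)) := by
      intro h
      obtain ⟨d, rfl⟩ := Nat.exists_eq_add_of_le hij.le
      have h1 := hiter d i hi hjk
      rw [← h] at h1
      exact hu _ (hgood i hi (by omega)) d (by omega) (by omega) h1
    have hvne (i j : ℕ) (hi : 1 ≤ i) (hj : 1 ≤ j) (hik : i < k) (hjk : j < k) (hij : i ≠ j) :
        v (i : ZMod (k + 1)) ≠ v (j : ZMod (k + 1)) := by
      rcases Nat.lt_or_gt_of_ne hij with h | h
      · exact hvinj i j hi h hjk
      · exact (hvinj j i hj h hik).symm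
    have hcast0 (j : ℕ) (hj : 1 ≤ j) (hjk : j < k) : (j : ZMod (k + 1)) ≠ 0 := by
      have := zmod_natCast_ne (n := k + 1) (i := j) (j := 0) (by omega) (by omega) (by omega)
      simpa using this
    have hcast1 (j : ℕ) (hjk : j < k) : (j : ZMod (k + 1)) ≠ -1 := by
      rw [zmod_neg_one]
      exact zmod_natCast_ne (by omega) (by omega) (by omega)
    have hneg : (-1 : ZMod (k + 1)) ≠ 0 := by
      rw [zmod_neg_one]
      have := zmod_natCast_ne (n := k + 1) (i := k) (j := 0) (by omega) (by omega) (by omega)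
      simpa using this
    have hsurj (x : ZMod (k + 1)) (hx0 : x ≠ 0) (hx1 : x ≠ -1) :
        ∃ j : ℕ, 1 ≤ j ∧ j < k ∧ v (j : ZMod (k + 1)) = x := by
      have hinj : Set.InjOn (fun j : ℕ => v (j : ZMod (k + 1))) (Finset.Ico 1 k) := by
        intro i hi j hj h
        by_contra hij
        rw [Finset.mem_coe, Finset.mem_Ico] at hi hj
        exact hvne i j hi.1 hj.1 hi.2 hj.2 hij h
      have hsub : ((Finset.Ico 1 k).image fun j : ℕ => v (j : ZMod (k + 1))) ⊆
          (Finset.univ.erase 0).erase (-1) := by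
        intro y hy
        obtain ⟨j, hj, rfl⟩ := Finset.mem_image.1 hy
        rw [Finset.mem_Ico] at hj
        refine Finset.mem_erase.2 ⟨fun h => hcast0 j hj.1 hj.2 (hv1 h),
          Finset.mem_erase.2 ⟨hgood j hj.1 hj.2, Finset.mem_univ _⟩⟩
      have heq := Finset.eq_of_subset_of_card_le hsub (by
        rw [Finset.card_image_of_injOn hinj, Finset.card_erase_of_mem, Finset.card_erase_of_mem
          (Finset.mem_univ _), Finset.card_univ, ZMod.card, Nat.card_Ico]
        · omega
        · exact Finset.mem_erase.2 ⟨hneg, Finset.mem_univ _⟩)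
      have hx : x ∈ (Finset.univ.erase (0 : ZMod (k + 1))).erase (-1) :=
        Finset.mem_erase.2 ⟨hx1, Finset.mem_erase.2 ⟨hx0, Finset.mem_univ _⟩⟩
      rw [← heq] at hx
      obtain ⟨j, hj, hjx⟩ := Finset.mem_image.1 hx
      rw [Finset.mem_Ico] at hj
      exact ⟨j, hj.1, hj.2, hjx⟩
    have hvu : v (-1) = u (-1) := by simp [hudef, hvdef]
    obtain ⟨j, hj1, hjk, hj⟩ := hsurj (v (-1)) (by
      rw [hvu]
      intro h
      exact hneg (hui (h.trans hu0.symm))) (fun h => hneg (hv1 h))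
    have hjk' : j + 1 = k := by
      by_contra hne
      rw [hvu, ← hstep j hj1 (by omega)] at hj
      exact hcast0 (j + 1) (by omega) (by omega) (hv1 (hui hj))
    have hjj : (j : ZMod (k + 1)) = -2 := by
      have := zmod_neg_one (k := k)
      rw [← hjk'] at this ⊢
      push_cast at this
      linear_combination -this
    rw [hjj] at hj
    rcases Nat.lt_or_ge 3 k with hk4 | hk4
    · exfalso
      have e1 := hc 2 le_rfl (by omega) 1
      have e2 := hc 3 (by omega) hk4 1
      push_cast at e1 e2
      rw [show (1 : ZMod (k + 1)) - 2 = -1 by ring] at e1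
      rw [show (1 : ZMod (k + 1)) - 3 = -2 by ring] at e2
      simp only [hvdef] at hj
      rw [show a (-2) + 3 = a (-1) + 2 by linear_combination hj, e1] at e2
      set y := a 1 - 2 with hy
      rw [show a 1 - 3 = y - 1 by rw [hy]; ring] at e2
      have hvy : v y = v (y - 1) := by
        simp only [hvdef]
        linear_combination e2
      have hy1 : y ≠ -1 := by
        intro h
        refine hgood 1 le_rfl (by omega) ?_
        simp only [hvdef]
        push_cast
        linear_combination h
      have hy0 : y ≠ 0 := by
        intro h
        rw [h, show v 0 = -1 by simp [hvdef, h0]] at hvy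
        rw [zero_sub] at hvy
        exact hneg (hv1 hvy.symm)
      obtain ⟨i, hi1, hik, hi⟩ := zmod_exists_natCast hy0 hy1
      rw [← hi] at hvy
      obtain ⟨i, rfl⟩ : ∃ i', i = i' + 1 := ⟨i - 1, by omega⟩
      rw [show (((i + 1 : ℕ) : ZMod (k + 1)) - 1) = (i : ℕ) by push_cast; ring] at hvy
      rcases Nat.eq_zero_or_pos i with rfl | hi0
      · rw [Nat.cast_zero, show v 0 = -1 by simp [hvdef, h0]] at hvy
        exact hcast0 _ hi1 hik (hv1 hvy)
      · exact hvne i (i + 1) hi0 hi1 (by omega) hik (by omega) hvy.symm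
    · right
      obtain rfl : k = 3 := by omega
      refine ⟨rfl, ?_⟩
      have g1 := hgood 1 le_rfl (by omega)
      have g2 := hgood 2 (by omega) (by omega)
      have n12 := hvne 1 2 (by omega) (by omega) (by omega) (by omega) (by omega)
      have f1 : a 1 ≠ a 0 := fun h => absurd (ha h) (by decide)
      have w1 : v 1 ≠ -1 := fun h => absurd (hv1 h) (by decide)
      have w2 : v 2 ≠ -1 := fun h => absurd (hv1 h) (by decide)
      simp only [hvdef] at hj g1 g2 n12 w1 w2
      push_cast at g1 g2 n12
      rw [show (-1 : ZMod (3 + 1)) = 3 by decide] at h0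
      rw [show (-1 : ZMod (3 + 1)) = 3 by decide, show (-2 : ZMod (3 + 1)) = 2 by decide] at hj
      have key : ∀ w1 w2 w3 : Fin 4, w1 ≠ 3 ∧ w2 - 2 = w3 - 3 ∧ w1 - 1 ≠ 0 ∧
          w2 - 2 ≠ 0 ∧ w1 - 1 ≠ w2 - 2 ∧ w1 - 1 ≠ -1 ∧ w2 - 2 ≠ -1 →
            w3 = 1 ∧ w1 = 2 ∧ w2 = 0 := by decide
      exact ⟨h0, key _ _ _ ⟨h0 ▸ f1, hj, g1, g2, n12, w1, w2⟩⟩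

theorem exists_labels {k : ℕ} (hk : 2 ≤ k) {φ : MulAut (BraidGroup (k + 1))}
    (hφ : ∀ g, ex (φ g) = ex g) :
    ∃ L : ZMod (k + 1) → ℕ, Function.Injective L ∧ (∀ x, L x < k + 1) ∧
      (∀ c < k + 1, ∃ x, L x = c) ∧
      (∀ x, pp (k + 1) (φ (dl (k + 1) k)) (L x) = L (x + 1)) ∧
      pp (k + 1) (φ (dl (k + 1) k * ss (k + 1) 0)) (L 0) = L 0 := by
  have hz := map_zt rfl hk hφ
  have hd : φ (dl (k + 1) k) ^ (k + 1) = zt (k + 1) k := by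
    rw [← map_pow, ← hz]
    rfl
  have he : φ (dl (k + 1) k * ss (k + 1) 0) ^ k = zt (k + 1) k := by
    rw [← map_pow, eps_pow (by omega) (by omega), hz]
  obtain ⟨p, hp, hpe⟩ := exists_fixed_of_root rfl (by omega) he
  set C := pp (k + 1) (φ (dl (k + 1) k)) with hC
  have hper : Function.IsPeriodicPt C (k + 1) p := by
    rw [Function.IsPeriodicPt, Function.IsFixedPt, Equiv.Perm.iterate_eq_pow]
    exact pow_apply_of_root rfl hd p
  have horb : ∀ d, 0 < d → d < k + 1 → (C ^ d) p ≠ p := fun d h0 hlt =>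
    pow_ne_of_root rfl (by omega) hd hp (apply_ne_of_root rfl (by omega) hd hp) h0 hlt
  have hL (j : ℕ) : (C ^ (j : ZMod (k + 1)).val) p = (C ^ j) p := by
    rw [ZMod.val_natCast, ← Equiv.Perm.iterate_eq_pow, ← Equiv.Perm.iterate_eq_pow,
      hper.iterate_mod_apply]
  refine ⟨fun x => (C ^ x.val) p, ?_, ?_, ?_, ?_, ?_⟩
  · intro x y hxy
    exact ZMod.val_injective _ (orbit_injOn horb (ZMod.val_lt x) (ZMod.val_lt y) hxy)
  · intro x
    exact pp_pow_lt _ hp _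
  · intro c hc
    have h := Finset.eq_of_subset_of_card_le (orbit_subset (φ (dl (k + 1) k)) hp (k + 1)) (by
      rw [← hC, card_orbit horb, Finset.card_range])
    rw [← Finset.mem_range, ← h] at hc
    obtain ⟨j, -, hj⟩ := Finset.mem_image.1 hc
    exact ⟨j, (hL j).trans hj⟩
  · intro x
    obtain ⟨j, rfl⟩ : ∃ j : ℕ, (j : ZMod (k + 1)) = x := ⟨x.val, ZMod.natCast_rightInverse x⟩
    have := hL (j + 1)
    rw [Nat.cast_add, Nat.cast_one] at this
    simp only [hL j, this, pow_succ', Equiv.Perm.mul_apply]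
  · simpa using hpe

theorem exists_pp_conj {k : ℕ} (hk : 3 ≤ k) {φ : MulAut (BraidGroup (k + 1))}
    (hφ : ∀ g, ex (φ g) = ex g) :
    ∃ c : BraidGroup (k + 1), ∀ g, pp (k + 1) (c⁻¹ * φ g * c) = pp (k + 1) g := by
  obtain ⟨L, hLi, hLlt, hLs, hLd, hLe⟩ := exists_labels (by omega) hφ
  have hex (g : BraidGroup (k + 1)) (x : ZMod (k + 1)) :
      ∃ y, L y = pp (k + 1) (φ g) (L x) := hLs _ (pp_lt _ (hLlt x))
  choose a ha using hex
  have ha_mul (g h : BraidGroup (k + 1)) (x) : a (g * h) x = a g (a h x) := by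
    apply hLi
    rw [ha, ha, ha, map_mul, map_mul, Equiv.Perm.mul_apply]
  have ha_inj (g : BraidGroup (k + 1)) : Function.Injective (a g) := by
    intro x y h
    have := congrArg L h
    rw [ha, ha] at this
    exact hLi ((pp (k + 1) (φ g)).injective this)
  have ha_d (x) : a (dl (k + 1) k) x = x + 1 := hLi (by rw [ha, hLd])
  have ha_s (i : ℕ) (hi : i + 1 < k) (x) :
      a (ss (k + 1) (i + 1)) x = a (ss (k + 1) i) (x - 1) + 1 := by
    have h := congrArg (fun g => a g (x - 1)) (dl_mul_ss (n := k + 1) (by omega) hi)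
    simp only [ha_mul, ha_d, sub_add_cancel] at h
    exact h.symm
  have ha_si (i : ℕ) (hi : i < k) (x) :
      a (ss (k + 1) i) x = a (ss (k + 1) 0) (x - i) + i := by
    induction i generalizing x with
    | zero => simp
    | succ i ih =>
      rw [ha_s i hi, ih (by omega)]
      push_cast
      rw [sub_sub, add_comm (1 : ZMod (k + 1)), add_assoc]
  have hz := map_zt rfl (by omega) hφ
  have he : φ (dl (k + 1) k * ss (k + 1) 0) ^ k = zt (k + 1) k := by
    rw [← map_pow, eps_pow (by omega) (by omega), hz]
  have hu (x) : a (dl (k + 1) k * ss (k + 1) 0) x = a (ss (k + 1) 0) x + 1 := by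
    rw [ha_mul, ha_d]
  have hu0 : a (ss (k + 1) 0) 0 + 1 = 0 := by
    rw [← hu]
    exact hLi (by rw [ha, hLe])
  have hiter (d : ℕ) (x) : L ((fun y => a (ss (k + 1) 0) y + 1)^[d] x) =
      (pp (k + 1) (φ (dl (k + 1) k * ss (k + 1) 0)) ^ d) (L x) := by
    induction d with
    | zero => rfl
    | succ d ih =>
      rw [Function.iterate_succ_apply', ← hu, ha, ih, pow_succ', Equiv.Perm.mul_apply]
  rcases cyclic_classification hk (a (ss (k + 1) 0)) (ha_inj _) (eq_neg_of_add_eq_zero_left hu0) (by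
      intro x hx d hd hdk h
      have h1 := congrArg L h
      rw [hiter] at h1
      refine pow_ne_of_root rfl (by omega) he (hLlt x) (fun h2 => ?_) hd hdk h1
      have := eq_of_root rfl (by omega) he (one_dvd _) (hLlt x) (hLlt 0) (fun h => hx (hLi h))
        (by simpa using h2) (by simpa using hLe)
      omega) (by
      intro i hi hik x
      have := congrArg (fun g => a g x) (ss_comm (k + 1) (i := 0) (j := i) (by omega)).eq
      simp only [ha_mul, ha_si i hik] at this
      exact this) with h | ⟨rfl, h0, h3, h1, h2⟩
  · have h0 := eq_neg_of_add_eq_zero_left hu0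
    have hneg : a (ss (k + 1) 0) (-1) = 0 := by
      by_contra hne
      by_cases hne1 : a (ss (k + 1) 0) (-1) = -1
      · have := (ha_inj _ (hne1.trans h0.symm))
        rw [zmod_neg_one] at this
        refine zmod_natCast_ne (n := k + 1) (i := k) (j := 0) (by omega) (by omega) (by omega) ?_
        simpa using this
      · exact hne1 (ha_inj _ (h _ hne hne1))
    have hswap (i : ℕ) (hi : i < k) :
        pp (k + 1) (φ (ss (k + 1) i)) = Equiv.swap (L (i - 1)) (L i) := by
      ext c
      rcases Nat.lt_or_ge c (k + 1) with hc | hc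
      · obtain ⟨x, rfl⟩ := hLs c hc
        rw [← ha, ha_si i hi]
        by_cases hx : x = i
        · rw [hx, sub_self, h0, Equiv.swap_apply_right, neg_add_eq_sub]
        · by_cases hx1 : x = i - 1
          · rw [hx1, Equiv.swap_apply_left, sub_sub_cancel_left, hneg, zero_add]
          · rw [h _ (sub_ne_zero.2 hx) (fun h => hx1 (by linear_combination h)), sub_add_cancel,
              Equiv.swap_apply_of_ne_of_ne (fun h => hx1 (hLi h)) (fun h => hx (hLi h))]
      · rw [pp_of_le _ hc, Equiv.swap_apply_of_ne_of_ne]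
        · exact ((hLlt _).trans_le hc).ne'
        · exact ((hLlt _).trans_le hc).ne'
    let f : ℕ → ℕ := fun j => if j < k + 1 then L (j - 1) else j
    have hf : Function.Bijective f := by
      constructor
      · intro i j hij
        simp only [f] at hij
        split_ifs at hij with hi hj hj
        · by_contra hne
          exact zmod_natCast_ne hi hj hne (sub_left_injective (hLi hij))
        · have := hLlt (i - 1)
          omega
        · have := hLlt (j - 1)
          omega
        · exact hij
      · intro c
        rcases Nat.lt_or_ge c (k + 1) with hc | hc
        · obtain ⟨x, rfl⟩ := hLs c hc
          refine ⟨(x + 1).val, ?_⟩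
          simp only [f]
          rw [if_pos (ZMod.val_lt _), ZMod.natCast_rightInverse (x + 1), add_sub_cancel_right]
        · exact ⟨c, by simp only [f]; rw [if_neg (by omega)]⟩
    set τ := Equiv.ofBijective f hf with hτ
    have hτ_lt (j : ℕ) (hj : j < k + 1) : τ j = L (j - 1) := if_pos hj
    obtain ⟨c, hc⟩ := exists_pp_eq (n := k + 1) τ fun j hj => if_neg (by omega)
    have key (g : BraidGroup (k + 1)) : pp (k + 1) (φ g) = τ * pp (k + 1) g * τ⁻¹ := by
      induction g using braid_induction with
      | one => simp
      | gen i hi =>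
        rw [hswap i (by omega), pp_ss hi, ← Equiv.swap_apply_apply, hτ_lt i (by omega),
          hτ_lt (i + 1) hi, Nat.cast_add, Nat.cast_one, add_sub_cancel_right]
      | mul g h hg hh =>
        rw [map_mul, map_mul, hg, hh, map_mul]
        group
      | inv g hg =>
        rw [map_inv, map_inv, hg, map_inv]
        group
    refine ⟨c, fun g => ?_⟩
    rw [map_mul, map_mul, map_inv, key, hc]
    group
  · exfalso
    set s := φ (ss 4 0) with hs
    set g := φ (ss 4 0 * ss 4 2) with hg
    have hcard (F : ℕ → ℤ) : ∑ c ∈ Finset.range 4, F c = ∑ x : ZMod 4, F (L x) := by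
      rw [← Finset.sum_image (g := L) (fun x _ y _ h => hLi h)]
      refine Finset.sum_congr (Finset.ext fun c => ?_) fun _ _ => rfl
      rw [Finset.mem_range, Finset.mem_image]
      exact ⟨fun hc => (hLs c hc).imp fun x hx => ⟨Finset.mem_univ _, hx⟩,
        fun ⟨x, _, hx⟩ => hx ▸ hLlt x⟩
    have hgp : pp 4 g = 1 := by
      have h4 (x : ZMod 4) : a (ss 4 0 * ss 4 2) x = x := by
        rw [ha_mul]
        have := ha_si 2 (by omega) x
        rw [this]
        have key : ∀ y : ZMod 4, y = 0 ∨ y = 1 ∨ y = 2 ∨ y = 3 := by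
          change ∀ y : Fin 4, y = 0 ∨ y = 1 ∨ y = 2 ∨ y = 3
          decide
        push_cast
        rcases key x with rfl | rfl | rfl | rfl
        · rw [show (0 : ZMod 4) - 2 = 2 by decide, h2, zero_add]
          exact h2
        · rw [show (1 : ZMod 4) - 2 = 3 by decide, h3]
          exact h3
        · rw [show (2 : ZMod 4) - 2 = 0 by decide, h0, show (3 : ZMod 4) + 2 = 1 by decide]
          exact h1
        · rw [show (3 : ZMod 4) - 2 = 1 by decide, h1, show (2 : ZMod 4) + 2 = 0 by decide]
          exact h0
      ext c
      rcases Nat.lt_or_ge c 4 with hc | hc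
      · obtain ⟨x, rfl⟩ := hLs c hc
        rw [hg, ← ha, h4]
        rfl
      · exact pp_of_le _ hc
    have hconj (x y : ZMod 4) : cr (L (a (ss 4 0) x)) (L (a (ss 4 0) y)) g = cr (L x) (L y) g := by
      have h4 := cr_conj hgp s (L x) (L y)
      have h5 : Commute s g := by
        rw [hs, hg]
        exact Commute.map ((Commute.refl _).mul_right (ss_comm 4 le_rfl)) φ
      rwa [h5.eq, mul_inv_cancel_right, ← ha, ← ha] at h4
    have hsum := sum_cr g
    rw [hg, hφ, ex_mul, ex_ss (by omega), ex_ss (by omega), ← hg, hcard] at hsum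
    simp only [hcard] at hsum
    obtain ⟨p, hp⟩ := even_cr hgp (L 0) (L 3)
    obtain ⟨q, hq⟩ := even_cr hgp (L 0) (L 1)
    have e1 := hconj 0 3
    have e2 := hconj 3 1
    have e3 := hconj 1 2
    have e4 := hconj 0 1
    rw [h0, h3] at e1
    rw [h3, h1] at e2
    rw [h1, h2] at e3
    rw [h0, h1] at e4
    have hsum4 (F : ZMod 4 → ℤ) : ∑ x, F x = F 0 + F 1 + F 2 + F 3 := Fin.sum_univ_four F
    simp only [hsum4, cr_self] at hsum
    rw [cr_symm (L 1) (L 0), cr_symm (L 2) (L 1), cr_symm (L 2) (L 3), cr_symm (L 1) (L 3),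
      cr_symm (L 3) (L 0), cr_symm (L 0) (L 2)] at hsum
    omega

theorem isConj_ss {n i : ℕ} (h : i + 1 < n) : ∃ h : BraidGroup n, ss n i = h * ss n 0 * h⁻¹ := by
  induction i with
  | zero => exact ⟨1, by simp⟩
  | succ i ih =>
    obtain ⟨h', hh⟩ := ih (by omega)
    refine ⟨dl n (i + 2) * h', ?_⟩
    rw [← mul_inv_eq_iff_eq_mul.2 (dl_mul_ss h (by omega : i + 1 < i + 2)), hh]
    group

theorem HH_zero {n : ℕ} {g : BraidGroup n} (hg : g ∈ HH n 0) : g = 1 := by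
  induction hg using HH_induction (Nat.zero_le n) with
  | one => rfl
  | gen i hi hi' => omega
  | mul g h _ _ hg hh => rw [hg, hh, one_mul]
  | inv g _ hg => rw [hg, inv_one]

/-- The pure braid group is the normal closure of `σ_0 ^ 2`. -/
theorem pure_induction {n : ℕ} {p : BraidGroup n → Prop} (hs : p (ss n 0 ^ 2)) (one : p 1)
    (mul : ∀ g h, pp n g = 1 → pp n h = 1 → p g → p h → p (g * h))
    (inv : ∀ g, pp n g = 1 → p g → p g⁻¹)
    (conj : ∀ g h, pp n g = 1 → p g → p (h * g * h⁻¹)) {g : BraidGroup n} (hg : pp n g = 1) :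
    p g := by
  have hAA (j k : ℕ) (hk : k < n) : p (AA n j k) := by
    induction k with
    | zero => rwa [AA_of_le (Nat.zero_le _)]
    | succ k ih =>
      rcases lt_trichotomy j k with hj | rfl | hj
      · rw [AA_succ_of_lt hj]
        exact conj _ _ (pp_AA ..) (ih (by omega))
      · obtain ⟨h, hh⟩ := isConj_ss hk
        rw [AA_self_succ, hh, conj_pow]
        refine conj _ _ ?_ hs
        rw [map_pow, pp_ss (by omega), pow_two, Equiv.swap_mul_self]
      · rwa [AA_of_le hj]
  suffices H : ∀ k ≤ n, ∀ g ∈ HH n k, pp n g = 1 → p g from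
    H n le_rfl g (mem_HH_self g) hg
  intro k hk
  induction k with
  | zero =>
    intro g hg _
    rwa [HH_zero hg]
  | succ k ih =>
    intro g hg hgp
    obtain ⟨f, hf, h, hh, rfl⟩ := exists_iot_mul (by omega) hg (by rw [hgp]; rfl)
    have hp : pp n h = 1 := by
      rwa [map_mul, pp_iot, one_mul] at hgp
    refine mul _ _ (pp_iot ..) hp ?_ (ih (by omega) h hh hp)
    clear hgp hf hg
    induction f using FreeGroup.induction_on with
    | C1 => rwa [map_one]
    | of j => rw [iot_of]; exact hAA j k (by omega)
    | inv_of j _ =>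
      rw [map_inv, iot_of]
      exact inv _ (pp_AA ..) (hAA j k (by omega))
    | mul x y hx hy =>
      rw [map_mul]
      exact mul _ _ (pp_iot ..) (pp_iot ..) hx hy

/-- The total linking number of the strand `a` with the others. -/
def lk {n : ℕ} (a : ℕ) (g : BraidGroup n) : ℤ := ∑ b ∈ Finset.range n, cr a b g

theorem sum_lk {n : ℕ} (g : BraidGroup n) : ∑ a ∈ Finset.range n, lk a g = 2 * ex g := sum_cr g

theorem cr_mul_of_pure {n : ℕ} {h : BraidGroup n} (hh : pp n h = 1) (a b : ℕ) (g : BraidGroup n) :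
    cr a b (g * h) = cr a b g + cr a b h := by
  rw [cr_mul, hh, add_comm]
  rfl

theorem cr_inv_of_pure {n : ℕ} {g : BraidGroup n} (hg : pp n g = 1) (a b : ℕ) :
    cr a b g⁻¹ = - cr a b g := by
  rw [cr_inv, map_inv, hg]
  rfl

theorem lk_mul {n : ℕ} {h : BraidGroup n} (hh : pp n h = 1) (a : ℕ) (g : BraidGroup n) :
    lk a (g * h) = lk a g + lk a h := by
  simp only [lk, cr_mul_of_pure hh, Finset.sum_add_distrib]

theorem lk_inv {n : ℕ} {g : BraidGroup n} (hg : pp n g = 1) (a : ℕ) : lk a g⁻¹ = - lk a g := by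
  simp only [lk, cr_inv_of_pure hg, Finset.sum_neg_distrib]

theorem lk_conj {n : ℕ} {g : BraidGroup n} (hg : pp n g = 1) (h : BraidGroup n) (a : ℕ) :
    lk (pp n h a) (h * g * h⁻¹) = lk a g := by
  rw [lk, ← sum_pp h fun b => cr (pp n h a) b (h * g * h⁻¹)]
  simp only [cr_conj hg]
  rfl

/-- The effect on linking numbers of an automorphism preserving the permutations. -/
theorem cr_map_formula {n : ℕ} (hn : 2 ≤ n) {φ : MulAut (BraidGroup n)}
    (hp : ∀ g, pp n (φ g) = pp n g) {α β γ : ℤ}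
    (hα : cr 0 1 (φ (ss n 0 ^ 2)) = 2 * α)
    (hβ₀ : ∀ a, 2 ≤ a → a < n → cr 0 a (φ (ss n 0 ^ 2)) = 2 * β)
    (hβ₁ : ∀ a, 2 ≤ a → a < n → cr 1 a (φ (ss n 0 ^ 2)) = 2 * β)
    (hγ : ∀ a b, 2 ≤ a → a < b → b < n → cr a b (φ (ss n 0 ^ 2)) = 2 * γ)
    {g : BraidGroup n} (hg : pp n g = 1) {a b : ℕ} (ha : a < n) (hb : b < n) (hab : a ≠ b) :
    cr a b (φ g) = α * cr a b g + β * (lk a g + lk b g - 2 * cr a b g) +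
      γ * (ex g - lk a g - lk b g + cr a b g) := by
  revert a b
  refine pure_induction (p := fun g => ∀ {a b : ℕ}, a < n → b < n → a ≠ b → cr a b (φ g) =
      α * cr a b g + β * (lk a g + lk b g - 2 * cr a b g) +
      γ * (ex g - lk a g - lk b g + cr a b g)) ?_ ?_ ?_ ?_ ?_ hg
  · have hc (a b : ℕ) : cr a b (ss n 0 ^ 2) =
        if (a = 0 ∧ b = 1) ∨ (a = 1 ∧ b = 0) then 2 else 0 := by
      rw [← AA_self_succ, cr_AA (by omega) (by omega)]
    have h0 : lk 0 (ss n 0 ^ 2) = 2 := by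
      rw [lk, Finset.sum_eq_single 1]
      · rw [hc]
        simp
      · intro b _ hb
        rw [hc]
        simp [hb]
      · intro h
        simp at h
        omega
    have h1 : lk 1 (ss n 0 ^ 2) = 2 := by
      rw [lk, Finset.sum_eq_single 0]
      · rw [hc]
        simp
      · intro b _ hb
        rw [hc]
        simp [hb]
      · intro h
        simp at h
        omega
    have h2 (a : ℕ) (ha : 2 ≤ a) : lk a (ss n 0 ^ 2) = 0 := by
      rw [lk]
      refine Finset.sum_eq_zero fun b _ => ?_
      rw [hc, if_neg (by omega)]
    have he : ex (ss n 0 ^ 2) = 2 := by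
      rw [ex_pow, ex_ss (by omega)]
      rfl
    intro a b ha hb hab
    wlog hlt : a < b generalizing a b
    · rw [cr_symm, this hb ha hab.symm (by omega), cr_symm b a]
      ring
    rw [hc, he]
    rcases (by omega : a = 0 ∨ a = 1 ∨ 2 ≤ a) with rfl | rfl | ha2
    · rcases (by omega : b = 1 ∨ 2 ≤ b) with rfl | hb2
      · rw [hα, h0, h1, if_pos (by omega)]
        ring
      · rw [hβ₀ b hb2 hb, h0, h2 b hb2, if_neg (by omega)]
        ring
    · rw [hβ₁ b (by omega) hb, h1, h2 b (by omega), if_neg (by omega)]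
      ring
    · rw [hγ a b ha2 hlt hb, h2 a ha2, h2 b (by omega), if_neg (by omega)]
      ring
  · intro a b _ _ _
    simp [lk]
  · intro g h hg hh ihg ihh a b ha hb hab
    rw [map_mul, cr_mul_of_pure ((hp h).trans hh), ihg ha hb hab, ihh ha hb hab,
      cr_mul_of_pure hh, lk_mul hh, lk_mul hh, ex_mul]
    ring
  · intro g hg ihg a b ha hb hab
    rw [map_inv, cr_inv_of_pure ((hp g).trans hg), ihg ha hb hab,
      cr_inv_of_pure hg, lk_inv hg, lk_inv hg, ex_inv]
    ring
  · intro g h hg ihg a b ha hb hab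
    obtain ⟨a, rfl⟩ := (pp n h).surjective a
    obtain ⟨b, rfl⟩ := (pp n h).surjective b
    have ha' : a < n := by
      by_contra hlt
      rw [pp_of_le h (by omega)] at ha
      exact hlt ha
    have hb' : b < n := by
      by_contra hlt
      rw [pp_of_le h (by omega)] at hb
      exact hlt hb
    rw [map_mul, map_mul, map_inv, ← hp h, cr_conj ((hp g).trans hg), hp h,
      ihg ha' hb' (fun h' => hab (by rw [h'])), cr_conj hg, lk_conj hg, lk_conj hg]
    simp only [ex_mul, ex_inv, add_neg_cancel_comm]

theorem exists_cr_map_formula {n : ℕ} (hn : 4 ≤ n) {φ : MulAut (BraidGroup n)}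
    (hp : ∀ g, pp n (φ g) = pp n g) : ∃ α β γ : ℤ, Odd α ∧
      ∀ g, pp n g = 1 → ∀ a b, a < n → b < n → a ≠ b →
        cr a b (φ g) = α * cr a b g + β * (lk a g + lk b g - 2 * cr a b g) +
          γ * (ex g - lk a g - lk b g + cr a b g) := by
  have hT : pp n (φ (ss n 0 ^ 2)) = 1 := by
    rw [hp, map_pow, pp_ss (by omega), pow_two, Equiv.swap_mul_self]
  have hcomm {h : BraidGroup n} (hh : Commute h (ss n 0 ^ 2)) (a b : ℕ) :
      cr (pp n h a) (pp n h b) (φ (ss n 0 ^ 2)) = cr a b (φ (ss n 0 ^ 2)) := by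
    have := cr_conj hT (φ h) a b
    rwa [(hh.map φ).eq, mul_inv_cancel_right, hp] at this
  have h0 (a b : ℕ) : cr (Equiv.swap 0 1 a) (Equiv.swap 0 1 b) (φ (ss n 0 ^ 2)) =
      cr a b (φ (ss n 0 ^ 2)) := by
    have := hcomm ((Commute.refl (ss n 0)).pow_right 2) a b
    rwa [pp_ss (by omega)] at this
  have hi (i : ℕ) (hi : 2 ≤ i) (hin : i + 1 < n) (a b : ℕ) :
      cr (Equiv.swap i (i + 1) a) (Equiv.swap i (i + 1) b) (φ (ss n 0 ^ 2)) =
        cr a b (φ (ss n 0 ^ 2)) := by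
    have := hcomm ((ss_comm n (i := 0) (j := i) (by omega)).symm.pow_right 2) a b
    rwa [pp_ss hin] at this
  obtain ⟨β, hβ⟩ := even_cr hT 0 2
  obtain ⟨γ, hγ⟩ := even_cr hT 2 3
  have hβ₀ (a : ℕ) (ha : 2 ≤ a) : a < n → cr 0 a (φ (ss n 0 ^ 2)) = 2 * β := by
    induction a, ha using Nat.le_induction with
    | base => intro _; omega
    | succ a ha ih =>
      intro han
      rw [← ih (by omega), ← hi a ha han 0 a, Equiv.swap_apply_left,
        Equiv.swap_apply_of_ne_of_ne (by omega) (by omega)]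
  have hγ₂ (b : ℕ) (hb : 3 ≤ b) : b < n → cr 2 b (φ (ss n 0 ^ 2)) = 2 * γ := by
    induction b, hb using Nat.le_induction with
    | base => intro _; omega
    | succ b hb ih =>
      intro hbn
      rw [← ih (by omega), ← hi b (by omega) hbn 2 b, Equiv.swap_apply_left,
        Equiv.swap_apply_of_ne_of_ne (by omega) (by omega)]
  have hγ' (a : ℕ) (ha : 2 ≤ a) : ∀ b, a < b → b < n → cr a b (φ (ss n 0 ^ 2)) = 2 * γ := by
    induction a, ha using Nat.le_induction with
    | base => exact fun b hb => hγ₂ b hb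
    | succ a ha ih =>
      intro b hab hb
      rw [← ih b (by omega) hb, ← hi a ha (by omega) a b, Equiv.swap_apply_left,
        Equiv.swap_apply_of_ne_of_ne (by omega) (by omega)]
  refine ⟨cr 0 1 (φ (ss n 0)), β, γ, ?_, fun g hg a b ha hb hab =>
    cr_map_formula (by omega) hp ?_ hβ₀ ?_ (fun a b ha => hγ' a ha b) hg ha hb hab⟩
  · rw [← Int.not_even_iff_odd, even_cr_iff zero_ne_one, hp, pp_ss (by omega)]
    simp
  · rw [map_pow, pow_two, cr_mul, hp, pp_ss (by omega), Equiv.swap_apply_left,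
      Equiv.swap_apply_right, cr_symm 1 0]
    ring
  · intro a ha han
    rw [← hβ₀ a ha han, ← h0 0 a, Equiv.swap_apply_left,
      Equiv.swap_apply_of_ne_of_ne (by omega) (by omega)]

theorem cr_map {n : ℕ} (hn : 4 ≤ n) {φ : MulAut (BraidGroup n)} (hφ : ∀ g, ex (φ g) = ex g)
    (hp : ∀ g, pp n (φ g) = pp n g) {g : BraidGroup n} (hg : pp n g = 1) {a b : ℕ}
    (ha : a < n) (hb : b < n) : cr a b (φ g) = cr a b g := by
  have hp' (g) : pp n (φ.symm g) = pp n g := by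
    rw [← hp, MulEquiv.apply_symm_apply]
  obtain ⟨α, β, γ, hα, h⟩ := exists_cr_map_formula hn hp
  obtain ⟨α', β', γ', -, h'⟩ := exists_cr_map_formula hn (φ := φ.symm) hp'
  have hlk {φ : MulAut (BraidGroup n)} {α β γ : ℤ} (h : ∀ g, pp n g = 1 → ∀ a b, a < n → b < n →
      a ≠ b → cr a b (φ g) = α * cr a b g + β * (lk a g + lk b g - 2 * cr a b g) +
          γ * (ex g - lk a g - lk b g + cr a b g)) (g : BraidGroup n) (hg : pp n g = 1) (a : ℕ)
      (ha : a < n) : lk a (φ g) = (α + (n - 4) * β - (n - 3) * γ) * lk a g +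
        (2 * β + (n - 3) * γ) * ex g := by
    have h1 (b : ℕ) (hb : b ∈ Finset.range n) : cr a b (φ g) =
        (α * cr a b g + β * (lk a g + lk b g - 2 * cr a b g) +
          γ * (ex g - lk a g - lk b g + cr a b g)) -
          if a = b then 2 * β * lk a g + γ * (ex g - 2 * lk a g) else 0 := by
      split_ifs with hab
      · rw [← hab, cr_self, cr_self]
        ring
      · rw [h g hg a b ha (Finset.mem_range.1 hb) hab, sub_zero]
    have hs := sum_lk g
    rw [lk, Finset.sum_congr rfl h1, Finset.sum_sub_distrib, Finset.sum_ite_eq,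
      if_pos (Finset.mem_range.2 ha)]
    simp only [Finset.sum_add_distrib, ← Finset.mul_sum, Finset.sum_sub_distrib, hs,
      Finset.sum_const, Finset.card_range, nsmul_eq_mul]
    rw [← lk]
    ring
  have hA : pp n (AA n 0 2) = 1 := pp_AA ..
  have hc (a b : ℕ) : cr a b (AA n 0 2) = if (a = 0 ∧ b = 2) ∨ (a = 2 ∧ b = 0) then 2 else 0 :=
    cr_AA (by omega) (by omega) a b
  have e2 : (α - 2 * β + γ) * (α' - 2 * β' + γ') = 1 := by
    have q1 {φ : MulAut (BraidGroup n)} {α β γ : ℤ} (h : ∀ g, pp n g = 1 → ∀ a b, a < n → b < n →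
      a ≠ b → cr a b (φ g) = α * cr a b g + β * (lk a g + lk b g - 2 * cr a b g) +
          γ * (ex g - lk a g - lk b g + cr a b g)) (g : BraidGroup n) (hg : pp n g = 1) :
        cr 0 2 (φ g) - cr 0 3 (φ g) - cr 1 2 (φ g) + cr 1 3 (φ g) =
          (α - 2 * β + γ) * (cr 0 2 g - cr 0 3 g - cr 1 2 g + cr 1 3 g) := by
      rw [h g hg 0 2 (by omega) (by omega) (by omega), h g hg 0 3 (by omega) (by omega) (by omega),
        h g hg 1 2 (by omega) (by omega) (by omega), h g hg 1 3 (by omega) (by omega) (by omega)]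
      ring
    have q2 := q1 h' (φ (AA n 0 2)) ((hp _).trans hA)
    rw [MulEquiv.symm_apply_apply, q1 h _ hA, hc, hc, hc, hc] at q2
    norm_num at q2
    linarith
  have e1 : (α + (n - 4) * β - (n - 3) * γ) * (α' + (n - 4) * β' - (n - 3) * γ') = 1 := by
    have q2 := hlk h' (φ (AA n 0 2)) ((hp _).trans hA) 0 (by omega)
    have q3 := hlk h' (φ (AA n 0 2)) ((hp _).trans hA) 1 (by omega)
    rw [MulEquiv.symm_apply_apply, hlk h _ hA 0 (by omega)] at q2
    rw [MulEquiv.symm_apply_apply, hlk h _ hA 1 (by omega)] at q3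
    have q4 : lk 0 (AA n 0 2) = 2 := by
      rw [lk, Finset.sum_eq_single 2]
      · simp [hc]
      · intro b _ hb
        simp [hc, hb]
      · intro h
        simp at h
        omega
    have q5 : lk 1 (AA n 0 2) = 0 := by
      rw [lk]
      exact Finset.sum_eq_zero fun b _ => by simp [hc]
    rw [q4] at q2
    rw [q5] at q3
    linarith
  have e0 : 2 = 2 * (α + (n - 4) * β - (n - 3) * γ) + n * (2 * β + (n - 3) * γ) := by
    have q1 := sum_lk (φ (AA n 0 2))
    rw [Finset.sum_congr rfl fun a ha => hlk h _ hA a (Finset.mem_range.1 ha),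
      Finset.sum_add_distrib, ← Finset.mul_sum, sum_lk, Finset.sum_const, Finset.card_range,
      nsmul_eq_mul, hφ, ex_AA (by omega) (by omega)] at q1
    linarith
  suffices hfin : α = 1 ∧ β = 0 ∧ γ = 0 by
    by_cases hab : a = b
    · rw [hab, cr_self, cr_self]
    · rw [h g hg a b ha hb hab, hfin.1, hfin.2.1, hfin.2.2]
      ring
  have hn' : (4 : ℤ) ≤ n := by exact_mod_cast hn
  generalize (n : ℤ) = N at *
  obtain ⟨d, rfl⟩ : ∃ d, β = γ + d := ⟨β - γ, by ring⟩
  have i1 : (N - 2) * d = (α + (N - 4) * (γ + d) - (N - 3) * γ) - (α - 2 * (γ + d) + γ) := by ring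
  obtain ⟨t, rfl⟩ := hα
  rcases Int.eq_one_or_neg_one_of_mul_eq_one e2 with e2 | e2 <;>
  rcases Int.eq_one_or_neg_one_of_mul_eq_one e1 with e1 | e1 <;>
  rw [e1, e2] at i1 <;> rw [e1] at e0
  · obtain rfl : d = 0 := by
      rcases mul_eq_zero.1 (show (N - 2) * d = 0 by linarith) with h | h
      · omega
      · exact h
    have h1 : (N * (N - 1)) * γ = 0 := by linear_combination -e0
    have h2 : N * (N - 1) ≠ 0 := mul_ne_zero (by omega) (by omega)
    have h3 := (mul_eq_zero.1 h1).resolve_left h2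
    omega
  · have hd : d < 0 := by nlinarith
    have hd1 : -1 ≤ d := by nlinarith
    obtain rfl : d = -1 := by omega
    obtain rfl : N = 4 := by omega
    omega
  · have hd : 0 < d := by nlinarith
    have hd1 : d ≤ 1 := by nlinarith
    obtain rfl : d = 1 := by omega
    obtain rfl : N = 4 := by omega
    omega
  · obtain rfl : d = 0 := by
      rcases mul_eq_zero.1 (show (N - 2) * d = 0 by linarith) with h | h
      · omega
      · exact h
    have h1 : (N * (N - 1)) * γ = 4 := by linear_combination -e0
    have h2 : 12 ≤ N * (N - 1) := by nlinarith
    have h3 : 0 < γ := by nlinarith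
    nlinarith

/-- The pure braids that become trivial when only the first `k` strands are kept. -/
def RR (n k : ℕ) : Subgroup (BraidGroup n) where
  carrier := {g | pp n g = 1 ∧ ∀ x, rr k (rho n g x) = rr k x}
  one_mem' := ⟨map_one _, fun x => by rw [map_one, MulAut.one_apply]⟩
  mul_mem' := by
    rintro g h ⟨hg, hg'⟩ ⟨hh, hh'⟩
    refine ⟨by rw [map_mul, hg, hh, one_mul], fun x => ?_⟩
    rw [map_mul, MulAut.mul_apply, hg', hh']
  inv_mem' := by
    rintro g ⟨hg, hg'⟩
    refine ⟨by rw [map_inv, hg, inv_one], fun x => ?_⟩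
    rw [← hg', ← MulAut.mul_apply, ← map_mul, mul_inv_cancel, map_one, MulAut.one_apply]

theorem rr_rr {k j : ℕ} (h : k ≤ j) (x : FreeGroup ℕ) : rr k (rr j x) = rr k x := by
  have : (rr k).comp (rr j) = rr k := by
    ext1 i
    rw [MonoidHom.comp_apply, rr_of]
    split_ifs with hi
    · rfl
    · rw [map_one, rr_of, if_neg (by omega)]
  exact DFunLike.congr_fun this x

theorem RR_anti {n k j : ℕ} (h : k ≤ j) : RR n j ≤ RR n k := by
  rintro g ⟨hg, hg'⟩
  exact ⟨hg, fun x => by rw [← rr_rr h, hg', rr_rr h]⟩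

theorem iot_mem_RR {n j k : ℕ} (hj : j < n) (hk : k ≤ j) (f : FreeGroup ℕ) :
    iot n j f ∈ RR n k :=
  RR_anti hk ⟨pp_iot n j f, (rho_iot hj f).1⟩

theorem AA_mem_RR {n i j k : ℕ} (hj : j < n) (hk : k ≤ j) : AA n i j ∈ RR n k := by
  rw [← iot_of]
  exact iot_mem_RR hj hk _

theorem rr_rho_rr {n k : ℕ} {h : BraidGroup n} (hh : ∀ j, k ≤ j → k ≤ pp n h j)
    (x : FreeGroup ℕ) : rr k (rho n h (rr k x)) = rr k (rho n h x) := by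
  have : ((rr k).comp (rho n h).toMonoidHom).comp (rr k) = (rr k).comp (rho n h).toMonoidHom := by
    ext1 i
    rw [MonoidHom.comp_apply, rr_of]
    split_ifs with hi
    · rfl
    · have h1 := (rr k).map_isConj (rho_of_isConj h i)
      have := hh i (by omega)
      rw [rr_of, if_neg (by omega), isConj_one_right] at h1
      rw [map_one]
      exact h1.symm
  exact DFunLike.congr_fun this x

theorem conj_mem_RR {n k : ℕ} {g h : BraidGroup n} (hh : ∀ j, k ≤ j → k ≤ pp n h j)
    (hg : g ∈ RR n k) : h * g * h⁻¹ ∈ RR n k := by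
  refine ⟨by rw [map_mul, map_mul, hg.1, mul_one, map_inv, mul_inv_cancel], fun x => ?_⟩
  rw [map_mul, map_mul, MulAut.mul_apply, MulAut.mul_apply, ← rr_rho_rr hh, hg.2, rr_rho_rr hh,
    ← MulAut.mul_apply, ← map_mul, mul_inv_cancel, map_one, MulAut.one_apply]

theorem conj_mem_RR_of_pure {n k : ℕ} {g h : BraidGroup n} (hh : pp n h = 1)
    (hg : g ∈ RR n k) : h * g * h⁻¹ ∈ RR n k :=
  conj_mem_RR (fun j hj => by rwa [hh]) hg

theorem eq_one_of_mem_RR {n k : ℕ} (hk : k ≤ n) {h : BraidGroup n} (hh : h ∈ HH n k)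
    (hr : h ∈ RR n k) : h = 1 := by
  refine eq_of_rho hk hh (one_mem _) fun j hj => ?_
  have := hr.2 (of j)
  rw [rr_eq_self (rho_mem_FF hk hh (of_mem_FF hj)), rr_eq_self (of_mem_FF hj)] at this
  rw [this, map_one, MulAut.one_apply]

theorem exists_RR_mul {n k : ℕ} {g : BraidGroup n} (hk : k ≤ n) (hg : pp n g = 1) :
    ∃ r ∈ RR n k, ∃ p ∈ HH n k, pp n p = 1 ∧ g = r * p := by
  suffices H : ∀ j, k ≤ j → j ≤ n → ∀ g ∈ HH n j, pp n g = 1 →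
      ∃ r ∈ RR n k, ∃ p ∈ HH n k, pp n p = 1 ∧ g = r * p from H n hk le_rfl g (mem_HH_self g) hg
  intro j hj
  induction j, hj using Nat.le_induction with
  | base => exact fun _ g hg hp => ⟨1, one_mem _, g, hg, hp, (one_mul g).symm⟩
  | succ j hj ih =>
    intro hjn g hg hgp
    obtain ⟨f, hf, h, hh, rfl⟩ := exists_iot_mul hjn hg (by rw [hgp]; rfl)
    rw [map_mul, pp_iot, one_mul] at hgp
    obtain ⟨r, hr, p, hp, hp', rfl⟩ := ih (by omega) h hh hgp
    exact ⟨iot n j f * r, mul_mem (iot_mem_RR hjn hj f) hr, p, hp, hp', (mul_assoc ..).symm⟩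

theorem exists_RR_succ_mul {n j : ℕ} (hj : j < n) {g : BraidGroup n} (hg : g ∈ RR n j) :
    ∃ r ∈ RR n (j + 1), ∃ f ∈ FF j, g = r * iot n j f := by
  obtain ⟨r, hr, p, hp, hp', rfl⟩ := exists_RR_mul (k := j + 1) hj hg.1
  obtain ⟨f, hf, h, hh, rfl⟩ := exists_iot_mul hj hp (by rw [hp']; rfl)
  have h1 : h ∈ RR n j := by
    have := mul_mem (mul_mem (inv_mem (iot_mem_RR hj le_rfl f))
      (inv_mem (RR_anti (Nat.le_succ j) hr))) hg
    rwa [mul_assoc, inv_mul_cancel_left, inv_mul_cancel_left] at this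
  rw [eq_one_of_mem_RR hj.le hh h1, mul_one]
  exact ⟨r, hr, f, hf, rfl⟩

theorem RR_le {n k : ℕ} (hk : k ≤ n) {N : Subgroup (BraidGroup n)}
    (H : ∀ m, k ≤ m → m < n → ∀ i < m, AA n i m ∈ N) : RR n k ≤ N := by
  suffices h : ∀ j, k ≤ j → j ≤ n → ∀ g ∈ HH n j, g ∈ RR n k → g ∈ N from
    fun g hg => h n hk le_rfl g (mem_HH_self g) hg
  intro j hj
  induction j, hj using Nat.le_induction with
  | base =>
    intro _ g hg hr
    rw [eq_one_of_mem_RR hk hg hr]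
    exact one_mem _
  | succ j hj ih =>
    intro hjn g hg hr
    obtain ⟨f, hf, h, hh, rfl⟩ := exists_iot_mul hjn hg (by rw [hr.1]; rfl)
    refine mul_mem ?_ (ih (by omega) h hh
      ((Subgroup.mul_mem_cancel_left _ (iot_mem_RR hjn hj f)).1 hr))
    refine map_mem_of_mem_closure (iot n j) ?_ hf
    rintro _ ⟨i, hi, rfl⟩
    rw [iot_of]
    exact H j hj hjn i hi

theorem cr_of_mem_HH {n k j : ℕ} (hk : k ≤ n) (hj : k ≤ j) {p : BraidGroup n} (hp : p ∈ HH n k)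
    (a : ℕ) : cr a j p = 0 := by
  induction hp using HH_induction hk generalizing a with
  | one => simp
  | gen i hi hi' =>
    rw [cr_ss hi', cx, if_neg (by omega)]
  | mul g h hg hh ihg ihh => rw [cr_mul, ihh, pp_of_mem_HH hk hj hh, ihg, add_zero]
  | inv g hg ihg => rw [cr_inv, pp_of_mem_HH hk hj (inv_mem hg), ihg, neg_zero]

theorem cr_of_mem_RR {n k : ℕ} (hk : k ≤ n) {g : BraidGroup n} (hg : g ∈ RR n k) {a b : ℕ}
    (ha : a < k) (hb : b < k) : cr a b g = 0 := by
  let N : Subgroup (BraidGroup n) :=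
    { carrier := {g | pp n g = 1 ∧ cr a b g = 0}
      one_mem' := ⟨map_one _, cr_one a b⟩
      mul_mem' := by
        rintro g h ⟨hg, hg'⟩ ⟨hh, hh'⟩
        exact ⟨by rw [map_mul, hg, hh, one_mul], by rw [cr_mul_of_pure hh, hg', hh', add_zero]⟩
      inv_mem' := by
        rintro g ⟨hg, hg'⟩
        exact ⟨by rw [map_inv, hg, inv_one], by rw [cr_inv_of_pure hg, hg', neg_zero]⟩ }
  have : RR n k ≤ N := RR_le hk fun m hm hmn i hi =>
    ⟨pp_AA n i m, by rw [cr_AA hmn hi, if_neg (by omega)]⟩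
  exact (this hg).2

/-- The exponent sum of the letter `a`. -/
def eo (a : ℕ) : FreeGroup ℕ →* Multiplicative ℤ :=
  lift fun b => Multiplicative.ofAdd (if b = a then 1 else 0)

theorem eo_of (a b : ℕ) : (eo a (of b)).toAdd = if b = a then 1 else 0 := by
  rw [eo, FreeGroup.lift_apply_of, toAdd_ofAdd]

theorem eo_yy (a m : ℕ) : (eo a (yy m)).toAdd = if a < m then 1 else 0 := by
  induction m with
  | zero => simp
  | succ m ih =>
    rw [yy_succ, map_mul, toAdd_mul, ih, eo_of]
    split_ifs <;> omega

theorem eo_isConj {f g : FreeGroup ℕ} (h : IsConj f g) (a : ℕ) : eo a f = eo a g :=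
  isConj_iff_eq.1 ((eo a).map_isConj h)

theorem cr_iot {n a j : ℕ} (hj : j < n) (ha : a < j) (f : FreeGroup ℕ) :
    cr a j (iot n j f) = 2 * (eo a f).toAdd := by
  have hof (b : ℕ) : cr a j (iot n j (of b)) = 2 * (eo a (of b)).toAdd := by
    rw [iot_of, eo_of]
    rcases Nat.lt_or_ge b j with hb | hb
    · rw [cr_AA hj hb]
      split_ifs <;> omega
    · rw [AA_of_le hb, cr_one, if_neg (by omega)]
      rfl
  induction f using FreeGroup.induction_on with
  | C1 => simp
  | of b => exact hof b
  | inv_of b _ => rw [map_inv, map_inv, cr_inv_of_pure (pp_iot ..), hof, toAdd_inv, mul_neg]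
  | mul x y hx hy =>
    rw [map_mul, map_mul, cr_mul_of_pure (pp_iot ..), hx, hy, toAdd_mul, mul_add]

theorem rho_ss_sq {n i : ℕ} (h : i + 1 < n) : rho n (ss n i ^ 2) = artin i ^ 2 := by
  rw [map_pow, rho_ss h]

theorem artin_sq_self (i : ℕ) :
    (artin i ^ 2) (of i) = (of i * of (i + 1))⁻¹ * of i * (of i * of (i + 1)) := by
  rw [pow_two, MulAut.mul_apply, artin_self, artin_succ]
  group

theorem artin_sq_succ (i : ℕ) :
    (artin i ^ 2) (of (i + 1)) = (of i * of (i + 1))⁻¹ * of (i + 1) * (of i * of (i + 1)) := by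
  rw [pow_two, MulAut.mul_apply, artin_succ, map_mul, map_mul, map_inv, artin_succ, artin_self]
  group

/-- A word whose conjugacy class is fixed by the squares of the generators is conjugate to a power
of a generator or of the boundary word. -/
theorem isConj_zpow_of_artin_sq {m : ℕ} (hm : 3 ≤ m) {f : FreeGroup ℕ} (hf : f ∈ FF m)
    (hT : ∀ i, i + 1 < m → IsConj ((artin i ^ 2) f) f) :
    ∃ e : ℤ, (∃ i < m, IsConj f (of i ^ e)) ∨ IsConj f (yy m ^ e) := by
  refine isConj_zpow_of_sq_invariant hm (fun i => (artin i ^ 2).toMonoidHom)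
    (fun i _ => artin_sq_self i) (fun i _ => artin_sq_succ i) (fun i _ k h0 h1 => ?_) hf hT
  change (artin i ^ 2) (of k) = of k
  rw [pow_two, MulAut.mul_apply, artin_of_ne h0 h1, artin_of_ne h0 h1]

theorem pp_ss_ge {n i k : ℕ} (hi : i + 1 < n) (h : k ≤ i ∨ i + 1 < k) {j : ℕ} (hj : k ≤ j) :
    k ≤ pp n (ss n i) j := by
  rw [pp_ss hi, Equiv.swap_apply_def]
  split_ifs <;> omega

theorem pp_ss_inv_ge {n i k : ℕ} (hi : i + 1 < n) (h : k ≤ i ∨ i + 1 < k) {j : ℕ} (hj : k ≤ j) :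
    k ≤ pp n (ss n i)⁻¹ j := by
  rw [map_inv, pp_ss hi, Equiv.swap_inv, Equiv.swap_apply_def]
  split_ifs <;> omega

/-- It suffices to test the inclusion of `RR n (j + 1)` on two elements. -/
theorem RR_succ_le {n j : ℕ} (hj : j + 1 < n) {N : Subgroup (BraidGroup n)}
    (hN : ∀ g h, (∀ i, j + 1 ≤ i → j + 1 ≤ pp n h i) → g ∈ N → h * g * h⁻¹ ∈ N)
    (h0 : ss n j ^ 2 ∈ N) (h1 : j + 2 < n → ss n (j + 1) ^ 2 ∈ N) : RR n (j + 1) ≤ N := by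
  have hsq : ∀ i, j + 1 ≤ i → i + 1 < n → ss n i ^ 2 ∈ N := by
    intro i hi
    induction i, hi using Nat.le_induction with
    | base => exact h1
    | succ i hi ih =>
      intro hin
      have hb := ss_braid (n := n) (i := i) hin
      have e : ss n (i + 1) ^ 2 = ss n i * (ss n (i + 1) * ss n i ^ 2 * (ss n (i + 1))⁻¹) *
          (ss n i)⁻¹ := (conj_sq_of_braid hb).symm
      rw [e]
      exact hN _ _ (fun l hl => pp_ss_ge (by omega) (by omega) hl)
        (hN _ _ (fun l hl => pp_ss_ge hin (by omega) hl) (ih (by omega)))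
  have hA : ∀ d i, i + d = j → AA n i (j + 1) ∈ N := by
    intro d
    induction d with
    | zero =>
      rintro i rfl
      rw [Nat.add_zero, AA_self_succ]
      exact h0
    | succ d ih =>
      intro i hi
      have h2 := conj_AA_self hj (by omega : i + 1 < j + 1)
      have h3 : AA n i (j + 1) = (ss n i)⁻¹ * AA n (i + 1) (j + 1) * (ss n i)⁻¹⁻¹ := by
        rw [← h2]
        group
      rw [h3]
      exact hN _ _ (fun l hl => pp_ss_inv_ge (by omega) (by omega) hl) (ih (i + 1) (by omega))
  refine RR_le hj.le fun m hm => ?_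
  induction m, hm using Nat.le_induction with
  | base => exact fun _ i hi => hA (j - i) i (by omega)
  | succ m hm ih =>
    intro hmn i hi
    rcases Nat.lt_or_ge i m with him | him
    · rw [AA_succ_of_lt him]
      exact hN _ _ (fun l hl => pp_ss_ge hmn (by omega) hl) (ih (by omega) i him)
    · obtain rfl : i = m := by omega
      rw [AA_self_succ]
      exact hsq i hm hmn

/-- Commutation of the images in the quotient by `RR n k`. -/
theorem commute_of_RR {n k : ℕ} (hk : k ≤ n) {r s u v : BraidGroup n} (hr : r ∈ RR n k)
    (hs : s ∈ RR n k) (hu : u ∈ HH n k) (hv : v ∈ HH n k) (hu' : pp n u = 1) (hv' : pp n v = 1)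
    (h : Commute (r * u) (s * v)) : Commute u v := by
  have e : u * v * (v * u)⁻¹ = (r * (u * s * u⁻¹))⁻¹ * (s * (v * r * v⁻¹)) := by
    have h' : r * u * (s * v) = s * v * (r * u) := h
    calc u * v * (v * u)⁻¹ = (r * (u * s * u⁻¹))⁻¹ * (r * u * (s * v)) * (v * u)⁻¹ := by group
      _ = _ := by rw [h']; group
  have h1 : u * v * (v * u)⁻¹ ∈ RR n k := by
    rw [e]
    exact mul_mem (inv_mem (mul_mem hr (conj_mem_RR_of_pure hu' hs)))
      (mul_mem hs (conj_mem_RR_of_pure hv' hr))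
  exact mul_inv_eq_one.1
    (eq_one_of_mem_RR hk (mul_mem (mul_mem hu hv) (inv_mem (mul_mem hv hu))) h1)

/-- A word with zero exponent sums that is suitably invariant under the squares of the generators
is trivial. -/
theorem eq_one_of_artin_sq_invariant {j : ℕ} {f : FreeGroup ℕ} (hf : f ∈ FF j)
    (h0 : ∀ a < j, (eo a f).toAdd = 0)
    (hT : ∀ i, i + 1 < j → ∃ w, (∀ a < j, (eo a w).toAdd = 0) ∧
      w * (artin i ^ 2) f * w⁻¹ = f) : f = 1 := by
  rcases (by omega : j = 0 ∨ j = 1 ∨ j = 2 ∨ 3 ≤ j) with rfl | rfl | rfl | hj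
  · rw [← rr_eq_self hf]
    have : rr 0 = 1 := by
      ext1 i
      simp
    rw [this, MonoidHom.one_apply]
  · have hc : Commute f (of 0) := by
      have h1 : FF 1 ≤ Subgroup.centralizer {of 0} := by
        refine (Subgroup.closure_le _).2 ?_
        rintro _ ⟨i, hi, rfl⟩
        obtain rfl : i = 0 := by simpa using hi
        exact Subgroup.mem_centralizer_singleton_iff.2 rfl
      exact Subgroup.mem_centralizer_singleton_iff.1 (h1 hf)
    exact eq_one_of_commute hc (eo 0) (h0 0 (by omega)) (by simp [eo_of])
  · obtain ⟨w, hw0, hw⟩ := hT 0 (by omega)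
    have hc : (artin 0 ^ 2) f = (yy 2)⁻¹ * f * yy 2 := by
      have : ∀ x ∈ of '' {i | i < 2},
          ((MulAut.conj (yy 2)) * artin 0 ^ 2).toMonoidHom x = x := by
        rintro _ ⟨i, hi, rfl⟩
        change (MulAut.conj (yy 2)) ((artin 0 ^ 2) (of i)) = of i
        have hy : yy 2 = of 0 * of 1 := by simp [yy_succ]
        rcases (by change i < 2 at hi; omega : i = 0 ∨ i = 1) with rfl | rfl
        · rw [artin_sq_self, MulAut.conj_apply, hy]
          group
        · rw [artin_sq_succ 0, MulAut.conj_apply, hy]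
          group
      have h2 := map_eq_self_of_mem_closure _ _ this hf
      change (MulAut.conj (yy 2)) ((artin 0 ^ 2) f) = f at h2
      rw [MulAut.conj_apply] at h2
      nth_rw 2 [← h2]
      group
    rw [hc] at hw
    have hcomm : Commute f (w * (yy 2)⁻¹) := by
      change f * (w * (yy 2)⁻¹) = w * (yy 2)⁻¹ * f
      nth_rw 1 [← hw]
      group
    refine eq_one_of_commute hcomm (eo 0) (h0 0 (by omega)) ?_
    rw [map_mul, toAdd_mul, hw0 0 (by omega), map_inv, toAdd_inv, eo_yy]
    simp
  · obtain ⟨e, ⟨i, hi, hc⟩ | hc⟩ := isConj_zpow_of_artin_sq hj hf (fun i hi => by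
      obtain ⟨w, -, hw⟩ := hT i hi
      exact isConj_iff.2 ⟨w, hw⟩)
    · have := h0 i hi
      rw [eo_isConj hc, map_zpow, toAdd_zpow, eo_of, if_pos rfl, smul_eq_mul, mul_one] at this
      rwa [this, zpow_zero, isConj_one_left] at hc
    · have := h0 0 (by omega)
      rw [eo_isConj hc, map_zpow, toAdd_zpow, eo_yy, if_pos (by omega), smul_eq_mul,
        mul_one] at this
      rwa [this, zpow_zero, isConj_one_left] at hc

section Good

variable {n : ℕ} {φ : MulAut (BraidGroup n)}

theorem pp_symm (hp : ∀ g, pp n (φ g) = pp n g) (g : BraidGroup n) :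
    pp n (φ.symm g) = pp n g := by
  rw [← hp, MulEquiv.apply_symm_apply]

theorem map_mem_RR_succ (hp : ∀ g, pp n (φ g) = pp n g)
    (hcr : ∀ g, pp n g = 1 → ∀ a < n, ∀ b < n, cr a b (φ g) = cr a b g)
    {j : ℕ} (hj : j + 1 < n) (hφ : ∀ g ∈ RR n j, φ g ∈ RR n j) {A : BraidGroup n}
    (hA : A ∈ RR n j) (hAc : ∀ h ∈ HH n j, Commute A h) (hA0 : ∀ a < j, cr a j A = 0) :
    φ A ∈ RR n (j + 1) := by
  have hjn : j < n := by omega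
  obtain ⟨r, hr, f, hf, e⟩ := exists_RR_succ_mul hjn (hφ A hA)
  suffices hf1 : f = 1 by rwa [e, hf1, map_one, mul_one]
  have hrcr (r : BraidGroup n) (hr : r ∈ RR n (j + 1)) (a : ℕ) (ha : a < j) : cr a j r = 0 :=
    cr_of_mem_RR hj.le hr (by omega) (by omega)
  refine eq_one_of_artin_sq_invariant hf (fun a ha => ?_) fun i hi => ?_
  · have h1 := hcr A hA.1 a (by omega) j hjn
    rw [e, hA0 a ha, cr_mul_of_pure (pp_iot ..), hrcr r hr a ha, cr_iot hjn ha] at h1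
    omega
  · have hin : i + 1 < n := by omega
    set s := ss n i ^ 2 with hs
    have hsp : pp n s = 1 := by rw [hs, ← AA_self_succ, pp_AA]
    have hsH : s ∈ HH n j := pow_mem (ss_mem_HH hi) 2
    obtain ⟨r₀, hr₀, p, hpH, hpp, hrp⟩ := exists_RR_mul (k := j) hjn.le
      ((pp_symm hp s).trans hsp)
    have hs2 : φ r₀ * φ p = s := by rw [← map_mul, ← hrp, MulEquiv.apply_symm_apply]
    obtain ⟨r', hr', f', hf', e'⟩ := exists_RR_succ_mul hjn (inv_mem (hφ r₀ hr₀))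
    have hφp : φ p = r' * (iot n j f' * s) := by
      rw [← mul_assoc, ← e', ← hs2, inv_mul_cancel_left]
    refine ⟨f', fun a ha => ?_, ?_⟩
    · have h1 := hcr p hpp a (by omega) j hjn
      rw [hφp, cr_of_mem_HH hjn.le le_rfl hpH,
        cr_mul_of_pure (by rw [map_mul, pp_iot, hsp, one_mul]), hrcr r' hr' a ha,
        cr_mul_of_pure hsp, cr_of_mem_HH hjn.le le_rfl hsH, cr_iot hjn ha] at h1
      omega
    · have hc : Commute (φ p) (φ A) := by
        have := hAc p hpH
        exact (this.map φ).symm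
      rw [hφp, e] at hc
      have hc2 := commute_of_RR (k := j + 1) hj.le hr' hr
        (mul_mem (iot_mem_HH n j f') (HH_mono (Nat.le_succ j) hsH)) (iot_mem_HH n j f)
        (by rw [map_mul, pp_iot, hsp, one_mul]) (pp_iot ..) hc
      have hTf : (artin i ^ 2) f = rho n s f := by rw [hs, rho_ss_sq hin]
      rw [hTf]
      refine iot_injOn hjn (mul_mem (mul_mem hf' (rho_mem_FF hjn.le hsH hf)) (inv_mem hf')) hf ?_
      rw [map_mul, map_mul, map_inv, iot_rho hjn hsH]
      have hc3 : iot n j f' * s * iot n j f = iot n j f * (iot n j f' * s) := hc2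
      calc iot n j f' * (s * iot n j f * s⁻¹) * (iot n j f')⁻¹
          = iot n j f' * s * iot n j f * (iot n j f' * s)⁻¹ := by group
        _ = iot n j f := by rw [hc3]; group

theorem map_mem_RR (hp : ∀ g, pp n (φ g) = pp n g)
    (hcr : ∀ g, pp n g = 1 → ∀ a < n, ∀ b < n, cr a b (φ g) = cr a b g)
    {k : ℕ} (hk : k < n) {g : BraidGroup n} (hg : g ∈ RR n k) : φ g ∈ RR n k := by
  induction k generalizing g with
  | zero =>
    refine ⟨by rw [hp, hg.1], fun x => ?_⟩
    have : rr 0 = 1 := by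
      ext1 i
      simp
    rw [this, MonoidHom.one_apply, MonoidHom.one_apply]
  | succ j ih =>
    refine RR_succ_le (N := (RR n (j + 1)).comap φ.toMonoidHom) hk ?_ ?_ ?_ hg
    · intro g h hh hg
      change φ (h * g * h⁻¹) ∈ RR n (j + 1)
      rw [map_mul, map_mul, map_inv]
      exact conj_mem_RR (fun i hi => by rw [hp]; exact hh i hi) hg
    · rw [← AA_self_succ]
      refine map_mem_RR_succ hp hcr hk (fun g hg => ih (by omega) hg)
        (AA_mem_RR hk (by omega)) (fun h hh => ?_) fun a ha => ?_
      · rw [AA_self_succ]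
        exact (ss_commute_HH (by omega) hh).pow_left 2
      · rw [cr_AA hk (by omega), if_neg (by omega)]
    · intro hjn
      rw [← AA_self_succ]
      refine map_mem_RR_succ hp hcr hk (fun g hg => ih (by omega) hg)
        (AA_mem_RR hjn (by omega)) (fun h hh => ?_) fun a ha => ?_
      · rw [AA_self_succ]
        exact (ss_commute_HH (by omega) (HH_mono (Nat.le_succ j) hh)).pow_left 2
      · rw [cr_AA hjn (by omega), if_neg (by omega)]

end Good

theorem exists_iot_of_mem_RR {n m : ℕ} (hn : n = m + 1) {g : BraidGroup n} (hg : g ∈ RR n m) :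
    ∃ f ∈ FF m, g = iot n m f := by
  subst hn
  obtain ⟨r, hr, f, hf, rfl⟩ := exists_RR_succ_mul (Nat.lt_succ_self m) hg
  rw [eq_one_of_mem_RR le_rfl (mem_HH_self r) hr, one_mul]
  exact ⟨f, hf, rfl⟩

theorem exists_rho_eq {n m : ℕ} (hm : m ≤ n) {β : MulAut (FreeGroup ℕ)}
    (hβ : β ∈ Subgroup.closure (artin '' {i | i + 1 < m})) : ∃ b ∈ HH n m, rho n b = β := by
  have : Subgroup.closure (artin '' {i | i + 1 < m}) ≤ (HH n m).map (rho n) := by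
    refine (Subgroup.closure_le _).2 ?_
    rintro _ ⟨i, hi, rfl⟩
    change i + 1 < m at hi
    exact ⟨ss n i, ss_mem_HH hi, rho_ss (by omega)⟩
  exact this hβ

section Good

variable {n m : ℕ} {φ : MulAut (BraidGroup n)}

theorem exists_map_iot (hn : n = m + 1) (hm : 3 ≤ m) (hp : ∀ g, pp n (φ g) = pp n g)
    (hcr : ∀ g, pp n g = 1 → ∀ a < n, ∀ b < n, cr a b (φ g) = cr a b g) {f : FreeGroup ℕ}
    (hf : ∀ p ∈ HH n m, pp n p = 1 → IsConj f (rho n p f)) :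
    ∃ f' ∈ FF m, φ (iot n m f) = iot n m f' ∧ (∀ a < m, eo a f' = eo a f) ∧
      ∃ e : ℤ, (∃ i < m, IsConj f' (of i ^ e)) ∨ IsConj f' (yy m ^ e) := by
  have hmn : m < n := by omega
  obtain ⟨f', hf', e⟩ := exists_iot_of_mem_RR hn
    (map_mem_RR hp hcr hmn (iot_mem_RR hmn le_rfl f))
  refine ⟨f', hf', e, fun a ha => ?_, isConj_zpow_of_artin_sq hm hf' fun i hi => ?_⟩
  · have := hcr _ (pp_iot n m f) a (by omega) m hmn
    rw [e, cr_iot hmn ha, cr_iot hmn ha] at this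
    exact Multiplicative.toAdd.injective (by omega)
  · have hin : i + 1 < n := by omega
    rw [← rho_ss_sq hin]
    set s := ss n i ^ 2 with hs
    have hsp : pp n s = 1 := by rw [hs, ← AA_self_succ, pp_AA]
    have hsH : s ∈ HH n m := pow_mem (ss_mem_HH hi) 2
    obtain ⟨r, hr, p, hpH, hpp, hrp⟩ := exists_RR_mul (k := m) hmn.le
      ((pp_symm hp s).trans hsp)
    have hs2 : φ r * φ p = s := by rw [← map_mul, ← hrp, MulEquiv.apply_symm_apply]
    obtain ⟨w, hw⟩ := isConj_iff.1 (hf p hpH hpp)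
    have h1 : p * iot n m f * p⁻¹ = iot n m w * iot n m f * (iot n m w)⁻¹ := by
      rw [← iot_rho hmn hpH, ← hw, map_mul, map_mul, map_inv]
    obtain ⟨u, hu, hu'⟩ := exists_iot_of_mem_RR hn
      (map_mem_RR hp hcr hmn (mul_mem hr (iot_mem_RR hmn le_rfl w)))
    refine (isConj_iff.2 ⟨u, ?_⟩ : IsConj f' _).symm
    refine iot_injOn hmn (mul_mem (mul_mem hu hf') (inv_mem hu)) (rho_mem_FF hmn.le hsH hf') ?_
    rw [iot_rho hmn hsH, map_mul, map_mul, map_inv, ← hu', ← e, ← hs2]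
    have h2 := congrArg φ h1
    simp only [map_mul, map_inv] at h2 ⊢
    calc φ r * φ (iot n m w) * φ (iot n m f) * (φ r * φ (iot n m w))⁻¹
        = φ r * (φ (iot n m w) * φ (iot n m f) * (φ (iot n m w))⁻¹) * (φ r)⁻¹ := by group
      _ = _ := by rw [← h2]; group

theorem exists_map_iot_of (hn : n = m + 1) (hm : 3 ≤ m) (hp : ∀ g, pp n (φ g) = pp n g)
    (hcr : ∀ g, pp n g = 1 → ∀ a < n, ∀ b < n, cr a b (φ g) = cr a b g) (j : ℕ) :
    ∃ f ∈ FF m, φ (iot n m (of j)) = iot n m f ∧ (j < m → IsConj (of j) f) := by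
  rcases Nat.lt_or_ge j m with hj | hj
  · obtain ⟨f, hf, h1, h2, e, ⟨i, hi, hc⟩ | hc⟩ := exists_map_iot hn hm hp hcr (f := of j)
      fun p _ hpp => by
        have := rho_of_isConj p j
        rwa [hpp] at this
    · refine ⟨f, hf, h1, fun _ => ?_⟩
      have h3 := congrArg Multiplicative.toAdd ((h2 j hj).symm.trans (eo_isConj hc j))
      rw [eo_of, if_pos rfl, map_zpow, toAdd_zpow, eo_of, smul_eq_mul] at h3
      split_ifs at h3 with hij
      · subst hij
        rw [mul_one] at h3
        rw [← h3, zpow_one] at hc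
        exact hc.symm
      · omega
    · exfalso
      obtain ⟨a, ha, haj⟩ : ∃ a < m, a ≠ j := by
        rcases eq_or_ne j 0 with rfl | h0
        · exact ⟨1, by omega, by omega⟩
        · exact ⟨0, by omega, h0.symm⟩
      have h3 := congrArg Multiplicative.toAdd ((h2 j hj).symm.trans (eo_isConj hc j))
      have h4 := congrArg Multiplicative.toAdd ((h2 a ha).symm.trans (eo_isConj hc a))
      rw [eo_of, if_pos rfl, map_zpow, toAdd_zpow, eo_yy, if_pos hj, smul_eq_mul] at h3
      rw [eo_of, if_neg haj.symm, map_zpow, toAdd_zpow, eo_yy, if_pos ha, smul_eq_mul] at h4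
      omega
  · refine ⟨1, one_mem _, ?_, fun h => by omega⟩
    rw [iot_of, AA_of_le hj, map_one, map_one]

theorem exists_map_iot_yy (hn : n = m + 1) (hm : 3 ≤ m) (hp : ∀ g, pp n (φ g) = pp n g)
    (hcr : ∀ g, pp n g = 1 → ∀ a < n, ∀ b < n, cr a b (φ g) = cr a b g) :
    ∃ f ∈ FF m, φ (iot n m (yy m)) = iot n m f ∧ IsConj (yy m) f := by
  obtain ⟨f, hf, h1, h2, e, ⟨i, hi, hc⟩ | hc⟩ := exists_map_iot hn hm hp hcr (f := yy m)
    fun p hpH _ => by rw [rho_yy (by omega) le_rfl hpH]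
  · exfalso
    obtain ⟨a, ha, hai⟩ : ∃ a < m, a ≠ i := by
      rcases eq_or_ne i 0 with rfl | h0
      · exact ⟨1, by omega, by omega⟩
      · exact ⟨0, by omega, h0.symm⟩
    have h4 := congrArg Multiplicative.toAdd ((h2 a ha).symm.trans (eo_isConj hc a))
    rw [eo_yy, if_pos ha, map_zpow, toAdd_zpow, eo_of, if_neg hai.symm, smul_eq_mul] at h4
    omega
  · refine ⟨f, hf, h1, ?_⟩
    have h3 := congrArg Multiplicative.toAdd ((h2 0 (by omega)).symm.trans (eo_isConj hc 0))
    rw [eo_yy, if_pos (by omega), map_zpow, toAdd_zpow, eo_yy, if_pos (by omega), smul_eq_mul,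
      mul_one] at h3
    rw [← h3, zpow_one] at hc
    exact hc.symm

theorem exists_map_AA_eq (hn : n = m + 1) (hm : 3 ≤ m) (hp : ∀ g, pp n (φ g) = pp n g)
    (hcr : ∀ g, pp n g = 1 → ∀ a < n, ∀ b < n, cr a b (φ g) = cr a b g) :
    ∃ c, ∀ j < m, φ (AA n j m) = c * AA n j m * c⁻¹ := by
  have hmn : m < n := by omega
  choose w hwF hw hwc using exists_map_iot_of hn hm hp hcr
  obtain ⟨v, hvF, hv, hvc⟩ := exists_map_iot_yy hn hm hp hcr
  have hcomp : φ.toMonoidHom.comp (iot n m) = (iot n m).comp (lift w) := by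
    ext1 j
    rw [MonoidHom.comp_apply, MonoidHom.comp_apply, FreeGroup.lift_apply_of, ← hw]
    rfl
  have hwv : lift w (yy m) = v := by
    refine iot_injOn hmn ?_ hvF ?_
    · refine map_mem_of_mem_closure (lift w) ?_ (yy_mem_FF m)
      rintro _ ⟨j, -, rfl⟩
      rw [FreeGroup.lift_apply_of]
      exact hwF j
    · rw [← hv]
      exact (DFunLike.congr_fun hcomp (yy m)).symm
  obtain ⟨u, hu⟩ := isConj_iff.1 hvc
  have hl : lift (fun j => u⁻¹ * w j * u) = (MulAut.conj u⁻¹).toMonoidHom.comp (lift w) := by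
    ext1 j
    rw [FreeGroup.lift_apply_of, MonoidHom.comp_apply, FreeGroup.lift_apply_of]
    change _ = MulAut.conj u⁻¹ (w j)
    rw [MulAut.conj_apply, inv_inv]
  obtain ⟨β, hβ, hβw⟩ := exists_artin (m := m) (w := fun j => u⁻¹ * w j * u)
    (fun j hj => ⟨j, (hwc j hj).trans (isConj_iff.2 ⟨u⁻¹, by rw [inv_inv]⟩)⟩) (by
      rw [hl, MonoidHom.comp_apply, hwv, ← hu]
      change MulAut.conj u⁻¹ (u * yy m * u⁻¹) = yy m
      rw [MulAut.conj_apply]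
      group)
  obtain ⟨b, hb, rfl⟩ := exists_rho_eq hmn.le hβ
  refine ⟨iot n m u * b, fun j hj => ?_⟩
  have h1 := iot_rho hmn hb (of j)
  rw [hβw j hj, map_mul, map_mul, map_inv, iot_of] at h1
  calc φ (AA n j m) = iot n m (w j) := by rw [← iot_of, hw]
    _ = iot n m u * ((iot n m u)⁻¹ * iot n m (w j) * iot n m u) * (iot n m u)⁻¹ := by group
    _ = _ := by rw [h1]; group

theorem map_eq_self_of_conj (hn : n = m + 1) (hm : 2 ≤ m) (hex : ∀ g, ex (φ g) = ex g)
    (hA : ∀ j < m, φ (AA n j m) = AA n j m) {g : BraidGroup n}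
    (hg : ∀ j < m, φ (g * AA n j m * g⁻¹) = g * AA n j m * g⁻¹) : φ g = g := by
  obtain ⟨e, he⟩ := exists_eq_zpow_zt hn hm (g := g⁻¹ * φ g) fun j hj => by
    have := hg j hj
    rw [map_mul, map_mul, map_inv, hA j hj] at this
    change g⁻¹ * φ g * AA n j m = AA n j m * (g⁻¹ * φ g)
    calc g⁻¹ * φ g * AA n j m = g⁻¹ * (φ g * AA n j m * (φ g)⁻¹) * φ g := by group
      _ = _ := by rw [this]; group
  have h1 := congrArg ex he
  rw [ex_mul, ex_inv, hex, neg_add_cancel, ex_zpow, ex_zt (by omega)] at h1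
  have : e = 0 := by
    rcases mul_eq_zero.1 h1.symm with h | h
    · exact h
    · have : ((m : ℤ) + 1) * m ≠ 0 := by positivity
      exact absurd h this
  rw [this, zpow_zero] at he
  exact (inv_mul_eq_one.1 he).symm

/-- An automorphism fixing the last free factor of the pure braid group is trivial. -/
theorem map_eq_self (hn : n = m + 1) (hm : 2 ≤ m) (hex : ∀ g, ex (φ g) = ex g)
    (hA : ∀ j < m, φ (AA n j m) = AA n j m) (g : BraidGroup n) : φ g = g := by
  have hmn : m < n := by omega
  have hU (f : FreeGroup ℕ) : φ (iot n m f) = iot n m f := by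
    have : φ.toMonoidHom.comp (iot n m) = iot n m := by
      ext1 j
      rw [MonoidHom.comp_apply, iot_of]
      rcases Nat.lt_or_ge j m with hj | hj
      · exact hA j hj
      · rw [AA_of_le hj, map_one]
    exact DFunLike.congr_fun this f
  have hH (h : BraidGroup n) (hh : h ∈ HH n m) : φ h = h :=
    map_eq_self_of_conj hn hm hex hA fun j _ => by
      rw [← iot_of, ← iot_rho hmn hh, hU]
  have hP (p : BraidGroup n) (hp : pp n p = 1) : φ p = p := by
    obtain ⟨f, -, h, hh, rfl⟩ := exists_iot_mul hmn (by rw [← hn]; exact mem_HH_self p)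
      (by rw [hp]; rfl)
    rw [map_mul, hU, hH h hh]
  exact map_eq_self_of_conj hn hm hex hA fun j _ => hP _ (by
    rw [map_mul, map_mul, pp_AA, mul_one, map_inv, mul_inv_cancel])

end Good

theorem ex_conj {n : ℕ} (c g : BraidGroup n) : ex (c * g * c⁻¹) = ex g := by
  rw [ex_mul, ex_mul, ex_inv]
  ring

/-- An automorphism preserving the exponent sum is inner. -/
theorem exists_conj_of_ex {n : ℕ} (hn : 4 ≤ n) {φ : MulAut (BraidGroup n)}
    (hex : ∀ g, ex (φ g) = ex g) : ∃ c, ∀ g, φ g = c * g * c⁻¹ := by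
  obtain ⟨m, rfl⟩ : ∃ m, n = m + 1 := ⟨n - 1, by omega⟩
  obtain ⟨c, hc⟩ := exists_pp_conj (by omega) hex
  let φ₁ : MulAut (BraidGroup (m + 1)) := MulAut.conj c⁻¹ * φ
  have e₁ (g) : φ₁ g = c⁻¹ * φ g * c := by
    change MulAut.conj c⁻¹ (φ g) = _
    rw [MulAut.conj_apply, inv_inv]
  have hex₁ (g) : ex (φ₁ g) = ex g := (ex_conj _ _).trans (hex g)
  have hp₁ (g) : pp (m + 1) (φ₁ g) = pp (m + 1) g := by rw [e₁, hc]
  obtain ⟨d, hd⟩ := exists_map_AA_eq rfl (by omega) hp₁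
    fun g hg a ha b hb => cr_map hn hex₁ hp₁ hg ha hb
  let φ₂ : MulAut (BraidGroup (m + 1)) := MulAut.conj d⁻¹ * φ₁
  have e₂ (g) : φ₂ g = d⁻¹ * φ₁ g * d := by
    change MulAut.conj d⁻¹ (φ₁ g) = _
    rw [MulAut.conj_apply, inv_inv]
  have hex₂ (g) : ex (φ₂ g) = ex g := (ex_conj _ _).trans (hex₁ g)
  have hid := map_eq_self rfl (by omega : 2 ≤ m) hex₂ fun j hj => by
    rw [e₂, hd j hj]
    group
  refine ⟨c * d, fun g => ?_⟩
  have := hid g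
  rw [e₂, e₁] at this
  nth_rw 2 [← this]
  group

/-- Every automorphism preserves the exponent sum up to a sign. -/
theorem ex_map {n : ℕ} (hn : 2 ≤ n) (φ : MulAut (BraidGroup n)) :
    (∀ g, ex (φ g) = ex g) ∨ ∀ g, ex (φ g) = - ex g := by
  have key (ψ : MulAut (BraidGroup n)) (g) : ex (ψ g) = ex (ψ (ss n 0)) * ex g := by
    induction g using braid_induction with
    | one => simp
    | gen i hi =>
      obtain ⟨h, hh⟩ := isConj_ss hi
      rw [hh, map_mul, map_mul, map_inv, ex_conj, ex_conj, ex_ss (by omega), mul_one]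
    | mul g h hg hh => rw [map_mul, ex_mul, ex_mul, hg, hh, mul_add]
    | inv g hg => rw [map_inv, ex_inv, ex_inv, hg, mul_neg]
  have h1 := key φ.symm (φ (ss n 0))
  rw [MulEquiv.symm_apply_apply, ex_ss (by omega)] at h1
  rcases Int.isUnit_iff.1 (IsUnit.of_mul_eq_one_right _ h1.symm) with h | h
  · left
    intro g
    rw [key, h, one_mul]
  · right
    intro g
    rw [key, h, neg_one_mul]

theorem ex_inversion {n : ℕ} {χ : MulAut (BraidGroup n)}
    (hχ : ∀ i : Fin (n - 1), χ (braidσ n i) = (braidσ n i)⁻¹) (g : BraidGroup n) :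
    ex (χ g) = - ex g := by
  induction g using braid_induction with
  | one => simp
  | gen i hi => rw [ss_of_lt hi, hχ, ex_inv]
  | mul g h hg hh => rw [map_mul, ex_mul, ex_mul, hg, hh, neg_add]
  | inv g hg => rw [map_inv, ex_inv, ex_inv, hg]

theorem inversion_inversion {n : ℕ} {χ : MulAut (BraidGroup n)}
    (hχ : ∀ i : Fin (n - 1), χ (braidσ n i) = (braidσ n i)⁻¹) (g : BraidGroup n) :
    χ (χ g) = g := by
  induction g using braid_induction with
  | one => simp
  | gen i hi => rw [ss_of_lt hi, hχ, map_inv, hχ, inv_inv]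
  | mul g h hg hh => rw [map_mul, map_mul, hg, hh]
  | inv g hg => rw [map_inv, map_inv, hg]

end BraidOut

/-- For `n ≥ 4`, `Out(B_n)` is cyclic of order 2 generated by the class of
the inversion automorphism `χ`: every automorphism of `B_n` is `g ↦ c * χ^e g * c⁻¹` for
some `c` and `e ∈ {0,1}`, and `χ` is not inner. -/
theorem braidGroup_out_is_Z2 (n : ℕ) (hn : 4 ≤ n)
    (χ : MulAut (BraidGroup n))
    (hχ : ∀ i : Fin (n - 1), χ (braidσ n i) = (braidσ n i)⁻¹) :
    (∀ φ : MulAut (BraidGroup n),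
      ∃ (c : BraidGroup n) (e : ℕ), (e = 0 ∨ e = 1) ∧
        ∀ g : BraidGroup n, φ g = c * (χ ^ e) g * c⁻¹) ∧
    ¬ ∃ c : BraidGroup n, ∀ g : BraidGroup n, χ g = c * g * c⁻¹ := by
  have hχex := BraidOut.ex_inversion hχ
  constructor
  · intro φ
    rcases BraidOut.ex_map (by omega) φ with h | h
    · obtain ⟨c, hc⟩ := BraidOut.exists_conj_of_ex hn h
      exact ⟨c, 0, Or.inl rfl, fun g => by rw [pow_zero, MulAut.one_apply, hc]⟩
    · obtain ⟨c, hc⟩ := BraidOut.exists_conj_of_ex hn (φ := φ * χ) fun g => by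
        rw [MulAut.mul_apply, h, hχex, neg_neg]
      refine ⟨c, 1, Or.inr rfl, fun g => ?_⟩
      rw [pow_one, ← hc, MulAut.mul_apply, BraidOut.inversion_inversion hχ]
  · rintro ⟨c, hc⟩
    have h1 := hχex (BraidOut.ss n 0)
    rw [hc, BraidOut.ex_conj, BraidOut.ex_ss (by omega)] at h1
    omega
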